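/- arXiv:math/9204241 — 2 statements merged into one kernel-verified Lean document; each statement's English description precedes it below -/
import Mathlib

section
/- Let d ≥ 2 and let S : Σ_d^dual → Simp_{2d−2} be Hölder continuous: there exist K > 0 and γ ∈ (0,1) such that |S(j) − S(j')|_∞ ≤ K γ^{#(j∩j')} for all j ≠ j'. Then there exist ε' ∈ (0,1] and a C^{1+ε'} Cantor system on [0,1] with d branches whose scaling function equals S. -/
open Set Filter

noncomputable section

/-- The unit interval `[0,1] ⊆ ℝ`. -/
abbrev I01 : Set ℝ := Set.Icc (0:ℝ) 1

/-- `ψ` satisfies an `ε`-Hölder bound with constant `H` on `[0,1]`. -/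
def HolderBoundOn01 (ε H : ℝ) (ψ : ℝ → ℝ) : Prop :=
  ∀ x ∈ I01, ∀ y ∈ I01, |ψ x - ψ y| ≤ H * |x - y| ^ ε

/-- A `C^{k+ε}` Cantor system on `[0,1]` with `d` branches: each branch `g i` is a
`C^k` increasing contraction of `[0,1]` with `ε`-Hölder `k`-th derivative, the images
`g i ([0,1])` are disjoint closed intervals in increasing order, `g 0 0 = 0` and
`g (d-1) 1 = 1`. -/
structure IsCantorSystem {d : ℕ} (k : ℕ) (ε : ℝ) (g : Fin d → ℝ → ℝ) : Prop where
  maps : ∀ i, Set.MapsTo (g i) I01 I01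
  smooth : ∀ i, ContDiffOn ℝ k (g i) I01
  holder : ∀ i, ∃ H > 0, HolderBoundOn01 ε H (iteratedDerivWithin k (g i) I01)
  deriv_pos : ∀ i, ∀ x ∈ I01, 0 < derivWithin (g i) I01 x
  deriv_lt_one : ∀ i, ∀ x ∈ I01, derivWithin (g i) I01 x < 1
  ordered : ∀ i j : Fin d, i < j → g i 1 < g j 0
  first : ∀ i : Fin d, (i : ℕ) = 0 → g i 0 = 0
  last : ∀ i : Fin d, (i : ℕ) = d - 1 → g i 1 = 1

/-- For a finite word `w = [w₁,…,wₙ]`, `wordMap g w = g_{wₙ} ∘ ⋯ ∘ g_{w₁}` (i.e. `G_w`). -/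
def wordMap {d : ℕ} (g : Fin d → ℝ → ℝ) : List (Fin d) → ℝ → ℝ
  | [] => id
  | i :: w => fun x => wordMap g w (g i x)

/-- `|I_w|`, the length of the interval `I_w = G_w([0,1]) = [G_w 0, G_w 1]`. -/
def wordLen {d : ℕ} (g : Fin d → ℝ → ℝ) (w : List (Fin d)) : ℝ :=
  wordMap g w 1 - wordMap g w 0

/-- The scaling data of the word `w`: the first `d` coordinates are the ratios
`|I_{i·w}|/|I_w|`, the last `d-1` coordinates are the `d-1` gap lengths between the
consecutive children `I_{1·w},…,I_{d·w}` divided by `|I_w|`. -/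
def scalingData {d : ℕ} (g : Fin d → ℝ → ℝ) (w : List (Fin d)) : Fin (2*d-1) → ℝ :=
  fun m =>
    if h : (m : ℕ) < d then
      wordLen g ((⟨(m : ℕ), h⟩ : Fin d) :: w) / wordLen g w
    else
      (wordMap g w (g ⟨(m : ℕ) - d + 1, by have := m.isLt; omega⟩ 0)
        - wordMap g w (g ⟨(m : ℕ) - d, by have := m.isLt; omega⟩ 1)) / wordLen g w

/-- The open simplex `Simp_{2d-2} ⊆ (0,1)^{2d-1}` of vectors with coordinate sum `1`. -/
def Simp (d : ℕ) : Set (Fin (2*d-1) → ℝ) :=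
  {s | (∀ m, s m ∈ Set.Ioo (0:ℝ) 1) ∧ ∑ m, s m = 1}

/-- The initial word `j|_n = (j_1,…,j_n)` of a sequence `j ∈ Σ_d^dual = {1,…,d}^ℕ`. -/
def dword {d : ℕ} (j : ℕ → Fin d) (n : ℕ) : List (Fin d) :=
  List.ofFn (fun i : Fin n => j i)

/-- `S` is the scaling function of the system `g`:
`S(j) = lim_{n→∞} S_n(j|_n)` for every `j ∈ Σ_d^dual`. -/
def HasScalingFunction {d : ℕ} (g : Fin d → ℝ → ℝ) (S : (ℕ → Fin d) → Fin (2*d-1) → ℝ) : Prop :=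
  ∀ j : ℕ → Fin d,
    Filter.Tendsto (fun n => scalingData g (dword j n)) Filter.atTop (nhds (S j))

/-- `ρ_S(j,j')` where `n = #(j∩j')`:
`ρ_S(j,j') = sup_w ∏_{t=1}^{n} S((j_{t+1},…,j_n)·w)_{j_t}` (depends only on `j` and `n`). -/
def rhoS {d : ℕ} (S : (ℕ → Fin d) → Fin (2*d-1) → ℝ) (j : ℕ → Fin d) (n : ℕ) : ℝ :=
  ⨆ w : ℕ → Fin d, ∏ t ∈ Finset.range n,
    S (fun m => if t + 1 + m < n then j (t + 1 + m) else w (t + 1 + m - n))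
      ⟨((j t) : ℕ), by have := (j t).isLt; omega⟩

/-- Given a scaling vector `s ∈ Simp_{2d-2}`, the partition of `[0,1]` it determines has
`i`-th child interval starting at `childLeft s i = ∑_{m<i} (s_m + s_{d+m})`. -/
def childLeft {d : ℕ} (s : Fin (2*d-1) → ℝ) (i : Fin d) : ℝ :=
  ∑ m ∈ (Finset.range (i : ℕ)).attach,
    (s ⟨(m : ℕ), by have h := Finset.mem_range.mp m.2; have := i.isLt; omega⟩
      + s ⟨d + (m : ℕ), by have h := Finset.mem_range.mp m.2; have := i.isLt; omega⟩)

/-- The right endpoint of the `i`-th child interval of the partition determined by `s`. -/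
def childRight {d : ℕ} (s : Fin (2*d-1) → ℝ) (i : Fin d) : ℝ :=
  childLeft s i + s ⟨(i : ℕ), by have := i.isLt; omega⟩

/-- `A(j)`: the set of `2d` endpoints of the `d` child intervals of the partition of `[0,1]`
determined by the scaling vector `s = S(j)`. -/
def Apts {d : ℕ} (s : Fin (2*d-1) → ℝ) : Set ℝ :=
  ⋃ i : Fin d, {childLeft s i, childRight s i}

/-- An increasing `C^k` diffeomorphism of `[0,1]`. -/
structure IsDiffeo01 (k : ℕ) (φ : ℝ → ℝ) : Prop where
  smooth : ContDiffOn ℝ k φ I01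
  mono : StrictMonoOn φ I01
  deriv_pos : ∀ x ∈ I01, 0 < derivWithin φ I01 x
  bij : Set.BijOn φ I01 I01

/-- `D^k(A₁,A₂)`: increasing `C^k` diffeomorphisms of `[0,1]` mapping `A₁` onto `A₂`. -/
def Dk (k : ℕ) (A₁ A₂ : Set ℝ) : Set (ℝ → ℝ) :=
  {φ | IsDiffeo01 k φ ∧ φ '' A₁ = A₂}

/-- `D^k_var(M)(A₁,A₂)`: members of `D^k(A₁,A₂)` whose `k`-th derivative has variation `< M`. -/
def DkVar (k : ℕ) (M : ℝ) (A₁ A₂ : Set ℝ) : Set (ℝ → ℝ) :=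
  {φ | φ ∈ Dk k A₁ A₂ ∧ ∀ x ∈ I01, ∀ y ∈ I01,
    |iteratedDerivWithin k φ I01 x - iteratedDerivWithin k φ I01 y| < M}

/-- The renormalization `(L')⁻¹ ∘ φ ∘ L` of `φ`, where `L, L'` are the increasing affine
bijections from `[0,1]` onto `[a,b]` and `[a',b']` respectively. -/
def renorm (a b a' b' : ℝ) (φ : ℝ → ℝ) : ℝ → ℝ :=
  fun x => (φ (a + (b - a) * x) - a') / (b' - a')

/-- `R_{j₀} φ`: restrict `φ` to the `j₀`-th child interval of the partition determined by `s`
(mapped to the `j₀`-th child interval of the partition determined by `s'`) and renormalize. -/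
def Rmap {d : ℕ} (s s' : Fin (2*d-1) → ℝ) (j₀ : Fin d) (φ : ℝ → ℝ) : ℝ → ℝ :=
  renorm (childLeft s j₀) (childRight s j₀) (childLeft s' j₀) (childRight s' j₀) φ

/-- `j₀·j = (j₀, j_1, j_2, …)`. -/
def consSeq {d : ℕ} (j₀ : Fin d) (j : ℕ → Fin d) : ℕ → Fin d :=
  fun m => if m = 0 then j₀ else j (m - 1)

/-- The Cantor set of the system: `C = ⋂_{n ≥ 1} ⋃_{w of length n} I_w`. -/
def systemCantorSet {d : ℕ} (g : Fin d → ℝ → ℝ) : Set ℝ :=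
  ⋂ n : ℕ, ⋃ w ∈ {w : List (Fin d) | w.length = n + 1}, wordMap g w '' I01

end

/-- A polynomial with value `1` at `0`, value `0` at `1` and integral `0` over `[0,1]`. -/
noncomputable def bump (n : ℕ) (t : ℝ) : ℝ := (1 - t) ^ n - 6 / (n + 1) * (t * (1 - t))

/-- The primitive of `bump n` vanishing at `0`. -/
noncomputable def bumpInt (n : ℕ) (t : ℝ) : ℝ :=
  (1 - (1 - t) ^ (n + 1)) / (n + 1) - 6 / (n + 1) * (t ^ 2 / 2 - t ^ 3 / 3)

lemma hasDerivAt_bumpInt (n : ℕ) (t : ℝ) : HasDerivAt (bumpInt n) (bump n t) t := by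
  have h0 : HasDerivAt (fun t : ℝ => 1 - t) (-1) t := by
    simpa using (hasDerivAt_id t).const_sub 1
  have h1 := ((h0.pow (n + 1)).const_sub 1).div_const ((n : ℝ) + 1)
  have h2 := (((hasDerivAt_pow 2 t).div_const 2).sub
    ((hasDerivAt_pow 3 t).div_const 3)).const_mul (6 / ((n : ℝ) + 1))
  have hn : (n : ℝ) + 1 ≠ 0 := by positivity
  refine (h1.sub h2).congr_deriv ?_
  unfold bump
  push_cast
  field_simp

lemma abs_bump_sub_le (n : ℕ) {x y : ℝ} (hx : x ∈ I01) (hy : y ∈ I01) :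
    |bump n x - bump n y| ≤ (n + 6) * |x - y| := by
  obtain ⟨hx0, hx1⟩ := hx
  obtain ⟨hy0, hy1⟩ := hy
  have h1 : |(1 - x) ^ n - (1 - y) ^ n| ≤ n * |x - y| := by
    refine (abs_pow_sub_pow_le _ _ n).trans ?_
    have e : |1 - x - (1 - y)| = |x - y| := by rw [← abs_neg]; congr 1; ring
    rw [e, abs_of_nonneg (by linarith : 0 ≤ 1 - x), abs_of_nonneg (by linarith : 0 ≤ 1 - y)]
    have : max (1 - x) (1 - y) ^ (n - 1) ≤ 1 :=
      pow_le_one₀ (le_max_of_le_left (by linarith)) (max_le (by linarith) (by linarith))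
    have h := mul_le_mul_of_nonneg_left this (by positivity : 0 ≤ |x - y| * n)
    linarith
  have h2 : |6 / ((n : ℝ) + 1) * (x * (1 - x)) - 6 / (n + 1) * (y * (1 - y))| ≤ 6 * |x - y| := by
    have e : 6 / ((n : ℝ) + 1) * (x * (1 - x)) - 6 / (n + 1) * (y * (1 - y))
        = 6 / (n + 1) * (1 - x - y) * (x - y) := by ring
    rw [e, abs_mul, abs_mul, abs_of_nonneg (by positivity : 0 ≤ 6 / ((n : ℝ) + 1))]
    have h6 : 6 / ((n : ℝ) + 1) ≤ 6 :=
      div_le_self (by norm_num) (by linarith [n.cast_nonneg (α := ℝ)])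
    have h7 : |1 - x - y| ≤ 1 := abs_le.2 ⟨by linarith, by linarith⟩
    have h8 : 6 / ((n : ℝ) + 1) * |1 - x - y| ≤ 6 * 1 :=
      mul_le_mul h6 h7 (abs_nonneg _) (by norm_num)
    nlinarith [abs_nonneg (x - y)]
  have : bump n x - bump n y = ((1 - x) ^ n - (1 - y) ^ n)
      - (6 / ((n : ℝ) + 1) * (x * (1 - x)) - 6 / (n + 1) * (y * (1 - y))) := by
    unfold bump; ring
  rw [this]
  simp only [← Real.norm_eq_abs] at h1 h2 ⊢
  refine (norm_sub_le _ _).trans ?_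
  linarith

/-- A polynomial with values `a`, `b` at `0`, `1` and integral `m` over `[0,1]`. -/
noncomputable def interpDeriv (n : ℕ) (a b m t : ℝ) : ℝ :=
  m + (a - m) * bump n t + (b - m) * bump n (1 - t)

/-- The primitive of `interpDeriv n a b m` vanishing at `0`. -/
noncomputable def interpFun (n : ℕ) (a b m t : ℝ) : ℝ :=
  m * t + (a - m) * bumpInt n t - (b - m) * bumpInt n (1 - t)

lemma hasDerivAt_interpFun (n : ℕ) (a b m t : ℝ) :
    HasDerivAt (interpFun n a b m) (interpDeriv n a b m t) t := by
  have h0 : HasDerivAt (fun t : ℝ => 1 - t) (-1) t := by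
    simpa using (hasDerivAt_id t).const_sub 1
  have h1 := (hasDerivAt_bumpInt n (1 - t)).comp t h0
  refine ((((hasDerivAt_id t).const_mul m).add ((hasDerivAt_bumpInt n t).const_mul (a - m))).sub
    (h1.const_mul (b - m))).congr_deriv ?_
  unfold interpDeriv
  ring

lemma bumpInt_zero (n : ℕ) : bumpInt n 0 = 0 := by simp [bumpInt]

lemma bumpInt_one (n : ℕ) : bumpInt n 1 = 0 := by
  have hn : (n : ℝ) + 1 ≠ 0 := by positivity
  simp only [bumpInt, sub_self]
  field_simp
  simp
  norm_num

lemma interpFun_zero (n : ℕ) (a b m : ℝ) : interpFun n a b m 0 = 0 := by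
  simp [interpFun, bumpInt_zero, bumpInt_one]

lemma interpFun_one (n : ℕ) (a b m : ℝ) : interpFun n a b m 1 = m := by
  simp [interpFun, bumpInt_zero, bumpInt_one]

lemma interpDeriv_zero {n : ℕ} (hn : n ≠ 0) (a b m : ℝ) : interpDeriv n a b m 0 = a := by
  simp [interpDeriv, bump, hn]

lemma interpDeriv_one {n : ℕ} (hn : n ≠ 0) (a b m : ℝ) : interpDeriv n a b m 1 = b := by
  simp [interpDeriv, bump, hn]

lemma interpDeriv_mem {n : ℕ} (hn : n ≠ 0) {a b m c t : ℝ} (hc : 0 < c)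
    (hnc : 4 / ((n : ℝ) + 1) < c) (ha : a ∈ Icc c (1 - c)) (hb : b ∈ Icc c (1 - c))
    (hm : m ∈ Icc c (1 - c)) (ht : t ∈ I01) :
    interpDeriv n a b m t ∈ Ioo 0 1 := by
  obtain ⟨ht0, ht1⟩ := ht
  obtain ⟨ha0, ha1⟩ := ha
  obtain ⟨hb0, hb1⟩ := hb
  obtain ⟨hm0, hm1⟩ := hm
  set q := (1 - t) ^ n with hq
  set q' := t ^ n with hq'
  set r := 6 / ((n : ℝ) + 1) * (t * (1 - t)) with hr
  have q0 : 0 ≤ q := pow_nonneg (by linarith) _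
  have q0' : 0 ≤ q' := pow_nonneg (by linarith) _
  have q1 : q ≤ 1 - t := pow_le_of_le_one (by linarith) (by linarith) hn
  have q1' : q' ≤ t := pow_le_of_le_one (by linarith) (by linarith) hn
  have r0 : 0 ≤ r := by
    have : 0 ≤ 1 - t := by linarith
    positivity
  have r1 : r * 2 < c := by
    have h1 : t * (1 - t) ≤ 1 / 4 := by nlinarith [sq_nonneg (t - 1 / 2)]
    have h2 : r ≤ 6 / ((n : ℝ) + 1) * (1 / 4) := mul_le_mul_of_nonneg_left h1 (by positivity)
    have h3 : 6 / ((n : ℝ) + 1) * (1 / 4) * 2 ≤ 4 / ((n : ℝ) + 1) := by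
      have : 0 ≤ 1 / ((n : ℝ) + 1) := by positivity
      have e : ∀ z : ℝ, z / ((n : ℝ) + 1) = z * (1 / ((n : ℝ) + 1)) := fun z => by ring
      rw [e 6, e 4]; linarith
    linarith
  have e : interpDeriv n a b m t = m * (1 - q - q') + a * q + b * q' - r * (a + b - 2 * m) := by
    simp only [interpDeriv, bump, hq, hq', hr, sub_sub_cancel]; ring
  have k1 : c ≤ m * (1 - q - q') + a * q + b * q' := by nlinarith
  have k2 : m * (1 - q - q') + a * q + b * q' ≤ 1 - c := by nlinarith
  rw [e]
  constructor <;> nlinarith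

lemma abs_interpDeriv_sub_le (n : ℕ) {a b m E x y : ℝ} (ha : |m - a| ≤ E) (hb : |m - b| ≤ E)
    (hx : x ∈ I01) (hy : y ∈ I01) :
    |interpDeriv n a b m x - interpDeriv n a b m y| ≤ 2 * (n + 6) * E * |x - y| := by
  have h1 := abs_bump_sub_le n hx hy
  have h2 := abs_bump_sub_le n (x := 1 - x) (y := 1 - y) ⟨by linarith [hx.2], by linarith [hx.1]⟩
    ⟨by linarith [hy.2], by linarith [hy.1]⟩
  have e : |1 - x - (1 - y)| = |x - y| := by rw [← abs_neg]; congr 1; ring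
  rw [e] at h2
  have hE : 0 ≤ E := (abs_nonneg _).trans ha
  rw [abs_sub_comm] at ha hb
  have e2 : interpDeriv n a b m x - interpDeriv n a b m y =
      (a - m) * (bump n x - bump n y) + (b - m) * (bump n (1 - x) - bump n (1 - y)) := by
    unfold interpDeriv; ring
  rw [e2]
  calc _ ≤ _ := abs_add_le _ _
    _ = |a - m| * |bump n x - bump n y| + |b - m| * |bump n (1 - x) - bump n (1 - y)| := by
      rw [abs_mul, abs_mul]
    _ ≤ E * ((n + 6) * |x - y|) + E * ((n + 6) * |x - y|) := by gcongr
    _ = _ := by ring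

/-- First-order Taylor and Hölder bounds for `F` with derivative candidate `D` between `x ≤ y`. -/
def TaylorBound (ε A : ℝ) (F D : ℝ → ℝ) (x y : ℝ) : Prop :=
  |D x - D y| ≤ A * (y - x) ^ ε ∧ |F y - F x - D x * (y - x)| ≤ A * (y - x) ^ ε * (y - x)

lemma TaylorBound.trans {ε A B : ℝ} {F D : ℝ → ℝ} {x z y : ℝ} (hε : 0 ≤ ε) (hA : 0 ≤ A)
    (hB : 0 ≤ B) (hxz : x ≤ z) (hzy : z ≤ y) (h₁ : TaylorBound ε A F D x z)
    (h₂ : TaylorBound ε B F D z y) : TaylorBound ε (2 * A + B) F D x y := by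
  obtain ⟨a1, a2⟩ := h₁
  obtain ⟨b1, b2⟩ := h₂
  have p1 : (z - x) ^ ε ≤ (y - x) ^ ε := Real.rpow_le_rpow (by linarith) (by linarith) hε
  have p2 : (y - z) ^ ε ≤ (y - x) ^ ε := Real.rpow_le_rpow (by linarith) (by linarith) hε
  have p0 : 0 ≤ (y - x) ^ ε := Real.rpow_nonneg (by linarith) _
  set P := (y - x) ^ ε
  have a1' : |D x - D z| ≤ A * P := a1.trans (by gcongr)
  have b1' : |D z - D y| ≤ B * P := b1.trans (by gcongr)
  have hzx : 0 ≤ z - x := by linarith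
  have hyz : 0 ≤ y - z := by linarith
  have a2' : |F z - F x - D x * (z - x)| ≤ A * P * (y - x) :=
    a2.trans (by gcongr)
  have b2' : |F y - F z - D z * (y - z)| ≤ B * P * (y - x) :=
    b2.trans (by gcongr)
  have c2 : |(D z - D x) * (y - z)| ≤ A * P * (y - x) := by
    rw [abs_mul, abs_of_nonneg hyz, abs_sub_comm]
    gcongr
  have hAP : 0 ≤ A * P := by positivity
  constructor
  · refine (abs_sub_le _ (D z) _).trans ?_
    linarith
  · have e : F y - F x - D x * (y - x) = (F z - F x - D x * (z - x)) +
      (F y - F z - D z * (y - z)) + (D z - D x) * (y - z) := by ring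
    rw [e]
    refine (abs_add_three _ _ _).trans ?_
    linarith

lemma TaylorBound.mono {ε A B : ℝ} {F D : ℝ → ℝ} {x y : ℝ} (hAB : A ≤ B) (hxy : x ≤ y)
    (h : TaylorBound ε A F D x y) : TaylorBound ε B F D x y := by
  have p0 : 0 ≤ (y - x) ^ ε := Real.rpow_nonneg (by linarith) _
  have : 0 ≤ y - x := by linarith
  exact ⟨h.1.trans (by gcongr), h.2.trans (by gcongr)⟩

/-- The `C¹` interpolation of first-order data `(f, D)` across `[u,v]`. -/
noncomputable def gapFun (n : ℕ) (f D : ℝ → ℝ) (u v x : ℝ) : ℝ :=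
  f u + (v - u) * interpFun n (D u) (D v) ((f v - f u) / (v - u)) ((x - u) / (v - u))

/-- The derivative of `gapFun n f D u v`. -/
noncomputable def gapDeriv (n : ℕ) (f D : ℝ → ℝ) (u v x : ℝ) : ℝ :=
  interpDeriv n (D u) (D v) ((f v - f u) / (v - u)) ((x - u) / (v - u))

lemma gapFun_left (n : ℕ) (f D : ℝ → ℝ) (u v : ℝ) : gapFun n f D u v u = f u := by
  simp [gapFun, interpFun_zero]

lemma gapDeriv_left {n : ℕ} (hn : n ≠ 0) (f D : ℝ → ℝ) (u v : ℝ) :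
    gapDeriv n f D u v u = D u := by
  simp [gapDeriv, interpDeriv_zero hn]

lemma gapFun_right (n : ℕ) (f D : ℝ → ℝ) {u v : ℝ} (huv : u ≤ v) :
    gapFun n f D u v v = f v := by
  rcases huv.eq_or_lt with rfl | h
  · exact gapFun_left _ _ _ _ _
  · have : v - u ≠ 0 := by linarith
    simp [gapFun, div_self this, interpFun_one]
    field_simp
    ring

lemma gapDeriv_right {n : ℕ} (hn : n ≠ 0) (f D : ℝ → ℝ) {u v : ℝ} (huv : u ≤ v) :
    gapDeriv n f D u v v = D v := by
  rcases huv.eq_or_lt with rfl | h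
  · exact gapDeriv_left hn _ _ _ _
  · have : v - u ≠ 0 := by linarith
    simp [gapDeriv, div_self this, interpDeriv_one hn]

lemma taylorBound_gap (n : ℕ) {ε H : ℝ} (f D : ℝ → ℝ) {u v x y : ℝ} (hε1 : ε ≤ 1)
    (hε : 0 < ε) (hH : 0 ≤ H)
    (h₁ : |f v - f u - D u * (v - u)| ≤ H * (v - u) ^ ε * (v - u))
    (h₂ : |f u - f v - D v * (u - v)| ≤ H * (v - u) ^ ε * (v - u))
    (hux : u ≤ x) (hxy : x ≤ y) (hyv : y ≤ v) :
    TaylorBound ε (2 * (n + 6) * H) (gapFun n f D u v) (gapDeriv n f D u v) x y := by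
  rcases hxy.eq_or_lt with rfl | hxy'
  · simp [TaylorBound, hε.ne']
  have hd : 0 < v - u := by linarith
  have hm1 : |(f v - f u) / (v - u) - D u| ≤ H * (v - u) ^ ε := by
    have e : (f v - f u) / (v - u) - D u = (f v - f u - D u * (v - u)) / (v - u) := by
      field_simp
    rw [e, abs_div, abs_of_pos hd]
    exact div_le_of_le_mul₀ hd.le (by positivity) h₁
  have hm2 : |(f v - f u) / (v - u) - D v| ≤ H * (v - u) ^ ε := by
    have e : (f v - f u) / (v - u) - D v = -((f u - f v - D v * (u - v)) / (v - u)) := by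
      field_simp
      ring
    rw [e, abs_neg, abs_div, abs_of_pos hd]
    exact div_le_of_le_mul₀ hd.le (by positivity) h₂
  have mem : ∀ z, u ≤ z → z ≤ v → (z - u) / (v - u) ∈ I01 := fun z h h' =>
    ⟨div_nonneg (by linarith) hd.le, (div_le_one hd).2 (by linarith)⟩
  have key : ∀ a b, u ≤ a → a ≤ b → b ≤ v →
      |gapDeriv n f D u v a - gapDeriv n f D u v b| ≤ 2 * (n + 6) * H * (b - a) ^ ε := by
    intro a b ha hab hb
    refine (abs_interpDeriv_sub_le n hm1 hm2 (mem a ha (by linarith))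
      (mem b (by linarith) hb)).trans ?_
    have e : |(a - u) / (v - u) - (b - u) / (v - u)| = (b - a) / (v - u) := by
      rw [← sub_div, abs_div, abs_of_pos hd, abs_sub_comm, abs_of_nonneg (by linarith)]
      congr 1; ring
    have hs0 : 0 ≤ (b - a) / (v - u) := div_nonneg (by linarith) hd.le
    have hs1 : (b - a) / (v - u) ≤ 1 := (div_le_one hd).2 (by linarith)
    have hs := Real.self_le_rpow_of_le_one hs0 hs1 hε1
    rw [Real.div_rpow (by linarith) hd.le] at hs
    rw [e]
    have hp : 0 < (v - u) ^ ε := Real.rpow_pos_of_pos hd _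
    calc 2 * ((n : ℝ) + 6) * (H * (v - u) ^ ε) * ((b - a) / (v - u))
        ≤ 2 * ((n : ℝ) + 6) * (H * (v - u) ^ ε) * ((b - a) ^ ε / (v - u) ^ ε) := by gcongr
      _ = _ := by field_simp
  have hder : ∀ z, HasDerivAt (gapFun n f D u v) (gapDeriv n f D u v z) z := by
    intro z
    have h0 : HasDerivAt (fun z => (z - u) / (v - u)) (1 / (v - u)) z :=
      ((hasDerivAt_id z).sub_const u).div_const _
    have h1 := (((hasDerivAt_interpFun n (D u) (D v) ((f v - f u) / (v - u))
      ((z - u) / (v - u))).comp z h0).const_mul (v - u)).const_add (f u)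
    refine h1.congr_deriv ?_
    unfold gapDeriv
    field_simp
  refine ⟨key x y hux hxy hyv, ?_⟩
  obtain ⟨z, hz, hz'⟩ := exists_hasDerivAt_eq_slope _ _ hxy'
    (fun z _ => (hder z).continuousAt.continuousWithinAt) (fun z _ => hder z)
  have hyx : 0 < y - x := by linarith
  have e : gapFun n f D u v y - gapFun n f D u v x - gapDeriv n f D u v x * (y - x) =
      (gapDeriv n f D u v z - gapDeriv n f D u v x) * (y - x) := by
    rw [hz']; field_simp
  rw [e, abs_mul, abs_of_pos hyx, abs_sub_comm]
  have k := key x z hux hz.1.le (by linarith [hz.2])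
  have k2 : (z - x) ^ ε ≤ (y - x) ^ ε :=
    Real.rpow_le_rpow (by linarith [hz.1]) (by linarith [hz.2]) hε.le
  have k3 : |gapDeriv n f D u v x - gapDeriv n f D u v z| ≤ 2 * (n + 6) * H * (y - x) ^ ε :=
    k.trans (by gcongr)
  gcongr

/-- A one-dimensional `C^{1+ε}` Whitney extension theorem that keeps the derivative in `(0,1)`. -/
theorem exists_whitney_extension {C : Set ℝ} (hC : IsCompact C) (hC01 : C ⊆ I01) (h0 : (0 : ℝ) ∈ C)
    (h1 : (1 : ℝ) ∈ C) {f D : ℝ → ℝ} {c ε H : ℝ} (hc : 0 < c) (hε : 0 < ε) (hε1 : ε ≤ 1)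
    (hH : 0 ≤ H) (hD : ∀ x ∈ C, D x ∈ Icc c (1 - c))
    (hDH : ∀ x ∈ C, ∀ y ∈ C, |D x - D y| ≤ H * |x - y| ^ ε)
    (hT : ∀ x ∈ C, ∀ y ∈ C, |f y - f x - D x * (y - x)| ≤ H * |x - y| ^ ε * |x - y|)
    (hgap : ∀ u ∈ C, ∀ v ∈ C, u < v → (∀ z ∈ C, z ≤ u ∨ v ≤ z) →
      (f v - f u) / (v - u) ∈ Icc c (1 - c)) :
    ∃ F F' : ℝ → ℝ, (∀ x ∈ C, F x = f x) ∧ (∀ x ∈ I01, F' x ∈ Ioo (0 : ℝ) 1) ∧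
      ∃ A, 0 ≤ A ∧ ∀ x ∈ I01, ∀ y ∈ I01, x ≤ y → TaylorBound ε A F F' x y := by
  obtain ⟨n, hn⟩ := exists_nat_gt (4 / c)
  have hn0 : n ≠ 0 := by
    rintro rfl
    have : 0 < 4 / c := by positivity
    simp at hn; linarith
  have hnc : 4 / ((n : ℝ) + 1) < c := by
    rw [div_lt_iff₀ hc] at hn
    rw [div_lt_iff₀ (by positivity)]
    linarith
  have hlo : ∀ x ∈ I01, ∃ u ∈ C, u ≤ x ∧ ∀ z ∈ C, z ≤ x → z ≤ u := by
    intro x hx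
    obtain ⟨u, hu, hu'⟩ := (hC.inter_right (isClosed_Iic (a := x))).exists_isGreatest ⟨0, h0, hx.1⟩
    exact ⟨u, hu.1, hu.2, fun z hz hzx => hu' ⟨hz, hzx⟩⟩
  have hhi : ∀ x ∈ I01, ∃ v ∈ C, x ≤ v ∧ ∀ z ∈ C, x ≤ z → v ≤ z := by
    intro x hx
    obtain ⟨u, hu, hu'⟩ := (hC.inter_right (isClosed_Ici (a := x))).exists_isLeast ⟨1, h1, hx.2⟩
    exact ⟨u, hu.1, hu.2, fun z hz hzx => hu' ⟨hz, hzx⟩⟩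
  choose! lo loC lo_le le_lo using hlo
  choose! hi hiC le_hi hi_le using hhi
  have loself : ∀ x ∈ C, lo x = x := fun x hx =>
    le_antisymm (lo_le x (hC01 hx)) (le_lo x (hC01 hx) x hx le_rfl)
  have hiself : ∀ x ∈ C, hi x = x := fun x hx =>
    le_antisymm (hi_le x (hC01 hx) x hx le_rfl) (le_hi x (hC01 hx))
  set F : ℝ → ℝ := fun x => gapFun n f D (lo x) (hi x) x with hF
  set F' : ℝ → ℝ := fun x => gapDeriv n f D (lo x) (hi x) x with hF'
  have FC : ∀ x ∈ C, F x = f x := by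
    intro x hx
    simp only [hF, loself x hx, hiself x hx, gapFun_left]
  have FC' : ∀ x ∈ C, F' x = D x := by
    intro x hx
    simp only [hF', loself x hx, hiself x hx, gapDeriv_left hn0]
  set B : ℝ := 2 * (n + 6) * H with hB
  have hB0 : 0 ≤ B := by positivity
  have gapTB : ∀ u ∈ C, ∀ v ∈ C, ∀ x y, u ≤ x → x ≤ y → y ≤ v →
      TaylorBound ε B (gapFun n f D u v) (gapDeriv n f D u v) x y := by
    intro u hu v hv x y hux hxy hyv
    have t1 := hT u hu v hv
    have t2 := hT v hv u hu
    rw [abs_sub_comm u v] at t1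
    rw [abs_of_nonneg (by linarith : 0 ≤ v - u)] at t1 t2
    exact taylorBound_gap n f D hε1 hε hH t1 t2 hux hxy hyv
  have hiTB : ∀ x ∈ I01, TaylorBound ε B F F' x (hi x) := by
    intro x hx
    have h := gapTB _ (loC x hx) _ (hiC x hx) x (hi x) (lo_le x hx) (le_hi x hx) le_rfl
    have hle := (lo_le x hx).trans (le_hi x hx)
    unfold TaylorBound at h ⊢
    rw [gapFun_right _ _ _ hle, gapDeriv_right hn0 _ _ hle] at h
    rw [FC _ (hiC x hx), FC' _ (hiC x hx)]
    exact h
  have loTB : ∀ x ∈ I01, TaylorBound ε B F F' (lo x) x := by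
    intro x hx
    have h := gapTB _ (loC x hx) _ (hiC x hx) (lo x) x le_rfl (lo_le x hx) (le_hi x hx)
    unfold TaylorBound at h ⊢
    rw [gapFun_left, gapDeriv_left hn0] at h
    rw [FC _ (loC x hx), FC' _ (loC x hx)]
    exact h
  have CTB : ∀ x ∈ C, ∀ y ∈ C, x ≤ y → TaylorBound ε H F F' x y := by
    intro x hx y hy hxy
    have t1 := hDH x hx y hy
    have t2 := hT x hx y hy
    rw [abs_sub_comm x y, abs_of_nonneg (by linarith : 0 ≤ y - x)] at t1 t2
    unfold TaylorBound
    rw [FC x hx, FC y hy, FC' x hx, FC' y hy]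
    exact ⟨t1, t2⟩
  refine ⟨F, F', FC, ?_, 2 * B + (2 * H + B), by positivity, ?_⟩
  · intro x hx
    rcases ((lo_le x hx).trans (le_hi x hx)).eq_or_lt with h | h
    · have hxl : x = lo x := le_antisymm (h ▸ le_hi x hx) (lo_le x hx)
      have hxC : x ∈ C := hxl ▸ loC x hx
      rw [FC' x hxC]
      exact ⟨by linarith [(hD x hxC).1], by linarith [(hD x hxC).2]⟩
    · have hm := hgap _ (loC x hx) _ (hiC x hx) h fun z hz => by
        rcases le_total z x with hzx | hzx
        · exact Or.inl (le_lo x hx z hz hzx)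
        · exact Or.inr (hi_le x hx z hz hzx)
      have hd : 0 < hi x - lo x := by linarith
      exact interpDeriv_mem hn0 hc hnc (hD _ (loC x hx)) (hD _ (hiC x hx)) hm
        ⟨div_nonneg (by linarith [lo_le x hx]) hd.le,
          (div_le_one hd).2 (by linarith [le_hi x hx])⟩
  · intro x hx y hy hxy
    by_cases hxy' : hi x ≤ y
    · have h2 : hi x ≤ lo y := le_lo y hy _ (hiC x hx) hxy'
      have := (CTB _ (hiC x hx) _ (loC y hy) h2).trans hε.le hH hB0 h2 (lo_le y hy) (loTB y hy)
      exact (hiTB x hx).trans hε.le hB0 (by positivity) (le_hi x hx) hxy' this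
    · push Not at hxy'
      have e1 : hi y = hi x := le_antisymm (hi_le y hy _ (hiC x hx) hxy'.le)
        (hi_le x hx _ (hiC y hy) (hxy.trans (le_hi y hy)))
      have e2 : lo y = lo x := by
        refine le_antisymm (le_lo x hx _ (loC y hy) ?_)
          (le_lo y hy _ (loC x hx) ((lo_le x hx).trans hxy))
        by_contra hlt
        push Not at hlt
        linarith [hi_le x hx _ (loC y hy) hlt.le, lo_le y hy]
      have h := gapTB _ (loC x hx) _ (hiC x hx) x y (lo_le x hx) hxy hxy'.le
      refine TaylorBound.mono (A := B) (by linarith) hxy ?_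
      unfold TaylorBound at h ⊢
      simpa only [hF, hF', e1, e2] using h

/-- Uniform first-order Taylor bounds give differentiability on `[0,1]`. -/
lemma hasDerivWithinAt_of_taylorBound {ε A : ℝ} {F F' : ℝ → ℝ} (hε : 0 < ε) (hA : 0 ≤ A)
    (h : ∀ x ∈ I01, ∀ y ∈ I01, x ≤ y → TaylorBound ε A F F' x y) {x : ℝ} (hx : x ∈ I01) :
    HasDerivWithinAt F (F' x) I01 x := by
  have key : ∀ y ∈ I01, |F y - F x - F' x * (y - x)| ≤ 2 * A * |y - x| ^ ε * |y - x| := by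
    intro y hy
    rcases le_total x y with hxy | hxy
    · have := (h x hx y hy hxy).2
      have p : 0 ≤ (y - x) ^ ε := Real.rpow_nonneg (by linarith) _
      rw [abs_of_nonneg (by linarith : 0 ≤ y - x)]
      have hyx : 0 ≤ y - x := by linarith
      have : 0 ≤ A * (y - x) ^ ε * (y - x) := by positivity
      linarith
    · obtain ⟨k1, k2⟩ := h y hy x hx hxy
      rw [abs_sub_comm y x, abs_of_nonneg (by linarith : 0 ≤ x - y)]
      have hyx : 0 ≤ x - y := by linarith
      have e : F y - F x - F' x * (y - x) =
        -(F x - F y - F' y * (x - y)) - (F' y - F' x) * (x - y) := by ring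
      rw [e]
      have k3 : |(F' y - F' x) * (x - y)| ≤ A * (x - y) ^ ε * (x - y) := by
        rw [abs_mul, abs_of_nonneg hyx]
        gcongr
      have k4 := norm_sub_le (-(F x - F y - F' y * (x - y))) ((F' y - F' x) * (x - y))
      rw [norm_neg] at k4
      simp only [Real.norm_eq_abs] at k4
      linarith
  rw [hasDerivWithinAt_iff_isLittleO, Asymptotics.isLittleO_iff]
  intro δ hδ
  have hlim : Tendsto (fun y => 2 * A * |y - x| ^ ε) (nhdsWithin x I01) (nhds 0) := by
    have hcont : Continuous (fun y => 2 * A * |y - x| ^ ε) :=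
      continuous_const.mul ((continuous_abs.comp (continuous_id.sub continuous_const)).rpow_const
        (fun _ => Or.inr hε.le))
    have := hcont.tendsto x
    simp only [sub_self, abs_zero, Real.zero_rpow hε.ne', mul_zero] at this
    exact this.mono_left nhdsWithin_le_nhds
  filter_upwards [hlim.eventually (gt_mem_nhds hδ), self_mem_nhdsWithin] with y hy1 hy2
  rw [Real.norm_eq_abs, Real.norm_eq_abs, smul_eq_mul, mul_comm (y - x)]
  exact (key y hy2).trans (by gcongr)

lemma holderBoundOn01_of_taylorBound {ε A : ℝ} {F F' : ℝ → ℝ}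
    (h : ∀ x ∈ I01, ∀ y ∈ I01, x ≤ y → TaylorBound ε A F F' x y) : HolderBoundOn01 ε A F' := by
  intro x hx y hy
  rcases le_total x y with hxy | hxy
  · rw [abs_sub_comm x y, abs_of_nonneg (by linarith : 0 ≤ y - x)]
    exact (h x hx y hy hxy).1
  · rw [abs_sub_comm (F' x), abs_of_nonneg (by linarith : 0 ≤ x - y)]
    exact (h y hy x hx hxy).1

lemma HolderBoundOn01.mono {ε A B : ℝ} {ψ : ℝ → ℝ} (hAB : A ≤ B) (h : HolderBoundOn01 ε A ψ) :
    HolderBoundOn01 ε B ψ := by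
  intro x hx y hy
  have : 0 ≤ |x - y| ^ ε := by positivity
  exact (h x hx y hy).trans (by gcongr)

lemma HolderBoundOn01.continuousOn {ε A : ℝ} {ψ : ℝ → ℝ} (hε : 0 < ε)
    (h : HolderBoundOn01 ε A ψ) : ContinuousOn ψ I01 := by
  intro x hx
  refine tendsto_iff_dist_tendsto_zero.2 ?_
  have hcont : Continuous (fun y => A * |y - x| ^ ε) :=
    continuous_const.mul ((continuous_abs.comp (continuous_id.sub continuous_const)).rpow_const
      (fun _ => Or.inr hε.le))
  have hl := hcont.tendsto x
  simp only [sub_self, abs_zero, Real.zero_rpow hε.ne', mul_zero] at hl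
  refine squeeze_zero' (Eventually.of_forall fun _ => dist_nonneg) ?_
    (hl.mono_left nhdsWithin_le_nhds)
  filter_upwards [self_mem_nhdsWithin] with y hy
  exact h y hy x hx

/-- A family of functions with Taylor bounds whose branches are suitably placed is a
`C^{1+ε}` Cantor system. -/
lemma isCantorSystem_of_taylorBound {d : ℕ} {ε : ℝ} (hε : 0 < ε) {g g' : Fin d → ℝ → ℝ}
    (hg' : ∀ i, ∀ x ∈ I01, g' i x ∈ Ioo (0 : ℝ) 1)
    (hg : ∀ i, ∃ A, 0 ≤ A ∧ ∀ x ∈ I01, ∀ y ∈ I01, x ≤ y → TaylorBound ε A (g i) (g' i) x y)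
    (h0 : ∀ i, 0 ≤ g i 0) (h1 : ∀ i, g i 1 ≤ 1)
    (ordered : ∀ i j : Fin d, i < j → g i 1 < g j 0)
    (first : ∀ i : Fin d, (i : ℕ) = 0 → g i 0 = 0)
    (last : ∀ i : Fin d, (i : ℕ) = d - 1 → g i 1 = 1) : IsCantorSystem 1 ε g := by
  have hud : UniqueDiffOn ℝ I01 := uniqueDiffOn_Icc_zero_one
  have hder : ∀ i, ∀ x ∈ I01, HasDerivWithinAt (g i) (g' i x) I01 x := by
    intro i x hx
    obtain ⟨A, hA, hTB⟩ := hg i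
    exact hasDerivWithinAt_of_taylorBound hε hA hTB hx
  have hdw : ∀ i, ∀ x ∈ I01, derivWithin (g i) I01 x = g' i x := fun i x hx =>
    (hder i x hx).derivWithin (hud x hx)
  have hmono : ∀ i, MonotoneOn (g i) I01 := by
    intro i
    refine (strictMonoOn_of_deriv_pos (convex_Icc 0 1)
      (fun x hx => (hder i x hx).continuousWithinAt) ?_).monotoneOn
    intro x hx
    rw [((hder i x (interior_subset hx)).hasDerivAt (mem_interior_iff_mem_nhds.1 hx)).deriv]
    exact (hg' i x (interior_subset hx)).1
  have hhol : ∀ i, ∃ H > 0, HolderBoundOn01 ε H (derivWithin (g i) I01) := by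
    intro i
    obtain ⟨A, hA, hTB⟩ := hg i
    refine ⟨A + 1, by linarith, fun x hx y hy => ?_⟩
    rw [hdw i x hx, hdw i y hy]
    exact ((holderBoundOn01_of_taylorBound hTB).mono (by linarith)) x hx y hy
  refine ⟨?_, ?_, ?_, ?_, ?_, ordered, first, last⟩
  · intro i x hx
    exact ⟨(h0 i).trans (hmono i ⟨le_rfl, zero_le_one⟩ hx hx.1),
      (hmono i hx ⟨zero_le_one, le_rfl⟩ hx.2).trans (h1 i)⟩
  · intro i
    rw [Nat.cast_one, contDiffOn_one_iff_derivWithin hud]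
    obtain ⟨H, -, hH⟩ := hhol i
    exact ⟨fun x hx => (hder i x hx).differentiableWithinAt, hH.continuousOn hε⟩
  · intro i
    simpa only [iteratedDerivWithin_one] using hhol i
  · intro i x hx
    rw [hdw i x hx]
    exact (hg' i x hx).1
  · intro i x hx
    rw [hdw i x hx]
    exact (hg' i x hx).2

/-- The left endpoint of the `i`-th child interval in the partition of `[0,1]` determined by `s`. -/
def leftSum (d : ℕ) (s : ℕ → ℝ) (i : ℕ) : ℝ := ∑ m ∈ Finset.range i, (s m + s (d + m))

/-- The length of the interval coded by a word, for prescribed scaling vectors. -/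
def treeLen {d : ℕ} (T : List (Fin d) → ℕ → ℝ) : List (Fin d) → ℝ
  | [] => 1
  | i :: w => treeLen T w * T w i

/-- The left endpoint of the interval coded by a word, for prescribed scaling vectors. -/
def treeLeft {d : ℕ} (T : List (Fin d) → ℕ → ℝ) : List (Fin d) → ℝ
  | [] => 0
  | i :: w => treeLeft T w + treeLen T w * leftSum d (T w) i

/-- The right endpoint of the interval coded by a word, for prescribed scaling vectors. -/
def treeRight {d : ℕ} (T : List (Fin d) → ℕ → ℝ) (w : List (Fin d)) : ℝ :=
  treeLeft T w + treeLen T w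

/-- The word `x_{n-1} ⋯ x_0` of the level-`n` interval containing the point with address `x`. -/
def addrWord {d : ℕ} (x : ℕ → Fin d) : ℕ → List (Fin d)
  | 0 => []
  | n + 1 => x n :: addrWord x n

/-- The point of the Cantor set with address `x`. -/
noncomputable def codePoint {d : ℕ} (T : List (Fin d) → ℕ → ℝ) (x : ℕ → Fin d) : ℝ :=
  ⨆ n, treeLeft T (addrWord x n)

/-- Prescribed scaling vectors that are bounded below by `l`, vary exponentially little and
determine uniformly contracting branches. -/
structure IsScalingTree {d : ℕ} (T : List (Fin d) → ℕ → ℝ) (l K γ c : ℝ) : Prop where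
  two_le : 2 ≤ d
  l_pos : 0 < l
  K_nonneg : 0 ≤ K
  γ_pos : 0 < γ
  γ_lt_one : γ < 1
  c_pos : 0 < c
  le_apply : ∀ w, ∀ m < 2 * d - 1, l ≤ T w m
  sum_eq : ∀ w, ∑ m ∈ Finset.range d, T w m + ∑ m ∈ Finset.range (d - 1), T w (d + m) = 1
  close : ∀ w k, ∀ m < 2 * d - 1, |T (w ++ [k]) m - T w m| ≤ K * γ ^ w.length
  singleton_mem : ∀ k, treeLen T [k] ∈ Icc c (1 - c)
  slope_mem : ∀ k w, ∀ m < 2 * d - 1,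
    treeLen T (w ++ [k]) / treeLen T w * (T (w ++ [k]) m / T w m) ∈ Icc c (1 - c)

lemma addrWord_length {d : ℕ} (x : ℕ → Fin d) (n : ℕ) : (addrWord x n).length = n := by
  induction n with
  | zero => rfl
  | succ n ih => simp [addrWord, ih]

lemma addrWord_consSeq {d : ℕ} (k : Fin d) (x : ℕ → Fin d) (n : ℕ) :
    addrWord (consSeq k x) (n + 1) = addrWord x n ++ [k] := by
  induction n with
  | zero => simp [addrWord, consSeq]
  | succ n ih =>
    rw [addrWord, ih]
    simp [addrWord, consSeq]

lemma exists_addrWord_add {d : ℕ} (x : ℕ → Fin d) (n m : ℕ) :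
    ∃ u, addrWord x (n + m) = u ++ addrWord x n := by
  induction m with
  | zero => exact ⟨[], rfl⟩
  | succ m ih =>
    obtain ⟨u, hu⟩ := ih
    exact ⟨x (n + m) :: u, by rw [← add_assoc, addrWord, hu]; rfl⟩

lemma addrWord_congr {d : ℕ} {x y : ℕ → Fin d} {n : ℕ} (h : ∀ t < n, x t = y t) :
    addrWord x n = addrWord y n := by
  induction n with
  | zero => rfl
  | succ n ih => rw [addrWord, addrWord, h n (by omega), ih fun t ht => h t (by omega)]

lemma exists_addrWord_eq_replicate_append {d : ℕ} (a : Fin d) (w : List (Fin d)) :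
    ∃ z : ℕ → Fin d, ∀ n, addrWord z (w.length + n) = List.replicate n a ++ w := by
  induction w using List.reverseRecOn with
  | nil =>
    refine ⟨fun _ => a, fun n => ?_⟩
    induction n with
    | zero => rfl
    | succ n ih => simpa [addrWord, List.replicate_succ] using ih
  | append_singleton w k ih =>
    obtain ⟨z, hz⟩ := ih
    refine ⟨consSeq k z, fun n => ?_⟩
    have e : (w ++ [k]).length + n = w.length + n + 1 := by simp; omega
    rw [e, addrWord_consSeq, hz, List.append_assoc]

lemma abs_leftSum_sub_le {d : ℕ} {s s' : ℕ → ℝ} {δ : ℝ} (hδ : 0 ≤ δ)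
    (h : ∀ m < 2 * d - 1, |s m - s' m| ≤ δ) {i : ℕ} (hi : i < d) :
    |leftSum d s i - leftSum d s' i| ≤ 2 * d * δ := by
  unfold leftSum
  rw [← Finset.sum_sub_distrib]
  refine (Finset.abs_sum_le_sum_abs _ _).trans ?_
  have : ∀ m ∈ Finset.range i, |s m + s (d + m) - (s' m + s' (d + m))| ≤ 2 * δ := by
    intro m hm
    have hm := Finset.mem_range.1 hm
    have e : s m + s (d + m) - (s' m + s' (d + m)) = (s m - s' m) + (s (d + m) - s' (d + m)) := by
      ring
    rw [e]
    refine (abs_add_le _ _).trans ?_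
    linarith [h m (by omega), h (d + m) (by omega)]
  refine (Finset.sum_le_card_nsmul _ _ _ this).trans ?_
  rw [Finset.card_range, nsmul_eq_mul]
  have : (i : ℝ) ≤ d := by exact_mod_cast hi.le
  nlinarith

namespace IsScalingTree

variable {d : ℕ} {T : List (Fin d) → ℕ → ℝ} {l K γ c : ℝ}

lemma apply_pos (hT : IsScalingTree T l K γ c) (w : List (Fin d)) {m : ℕ} (hm : m < 2 * d - 1) :
    0 < T w m :=
  hT.l_pos.trans_le (hT.le_apply w m hm)

lemma leftSum_le_leftSum (hT : IsScalingTree T l K γ c) (w : List (Fin d)) {i j : ℕ}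
    (hij : i ≤ j) (hj : j < d) : leftSum d (T w) i ≤ leftSum d (T w) j := by
  refine Finset.sum_le_sum_of_subset_of_nonneg (by simpa using hij) ?_
  intro m hm _
  have hm := Finset.mem_range.1 hm
  linarith [hT.apply_pos w (m := m) (by omega), hT.apply_pos w (m := d + m) (by omega)]

lemma leftSum_last (hT : IsScalingTree T l K γ c) (w : List (Fin d)) :
    leftSum d (T w) (d - 1) + T w (d - 1) = 1 := by
  have h := hT.sum_eq w
  have hd := hT.two_le
  obtain ⟨e, rfl⟩ : ∃ e, d = e + 1 := ⟨d - 1, by omega⟩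
  simp only [Nat.add_sub_cancel] at h ⊢
  rw [Finset.sum_range_succ] at h
  rw [leftSum, Finset.sum_add_distrib]
  linarith

lemma leftSum_nonneg (hT : IsScalingTree T l K γ c) (w : List (Fin d)) {i : ℕ} (hi : i < d) :
    0 ≤ leftSum d (T w) i := by
  simpa [leftSum] using hT.leftSum_le_leftSum w (Nat.zero_le i) hi

lemma leftSum_add_gap_le (hT : IsScalingTree T l K γ c) (w : List (Fin d)) {i j : ℕ}
    (hij : i < j) (hj : j < d) :
    leftSum d (T w) i + T w i + T w (d + i) ≤ leftSum d (T w) j := by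
  have h := hT.leftSum_le_leftSum w (Nat.succ_le_of_lt hij) hj
  rw [leftSum, Finset.sum_range_succ] at h
  rw [leftSum]
  linarith

lemma leftSum_add_le_one (hT : IsScalingTree T l K γ c) (w : List (Fin d)) {i : ℕ} (hi : i < d) :
    leftSum d (T w) i + T w i ≤ 1 := by
  have h := hT.leftSum_last w
  have hd := hT.two_le
  rcases Nat.lt_or_ge i (d - 1) with h1 | h1
  · have := hT.leftSum_add_gap_le w h1 (by omega)
    linarith [hT.apply_pos w (m := d + i) (by omega), hT.apply_pos w (m := d - 1) (by omega)]
  · obtain rfl : i = d - 1 := by omega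
    exact h.le

lemma apply_le (hT : IsScalingTree T l K γ c) (w : List (Fin d)) {i : ℕ} (hi : i < d) :
    T w i ≤ 1 - l := by
  have hd := hT.two_le
  have h1 := hT.leftSum_add_le_one w hi
  rcases Nat.eq_zero_or_pos i with rfl | h0
  · have h2 := hT.leftSum_add_gap_le w (i := 0) (j := d - 1) (by omega) (by omega)
    have h3 := hT.leftSum_add_le_one w (i := d - 1) (by omega)
    have h4 := hT.leftSum_nonneg w hi
    linarith [hT.le_apply w (d + 0) (by omega), hT.apply_pos w (m := d - 1) (by omega)]
  · have h2 := hT.leftSum_add_gap_le w h0 hi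
    have h4 := hT.leftSum_nonneg w (i := 0) (by omega)
    linarith [hT.le_apply w 0 (by omega), hT.apply_pos w (m := d + 0) (by omega)]

lemma l_lt_one (hT : IsScalingTree T l K γ c) : l < 1 := by
  have hd := hT.two_le
  linarith [hT.apply_le [] (i := 0) (by omega), hT.apply_pos [] (m := 0) (by omega)]

lemma treeLen_pos (hT : IsScalingTree T l K γ c) (w : List (Fin d)) : 0 < treeLen T w := by
  induction w with
  | nil => exact one_pos
  | cons i w ih => exact mul_pos ih (hT.apply_pos w (by omega))

lemma treeLen_le (hT : IsScalingTree T l K γ c) (w : List (Fin d)) :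
    treeLen T w ≤ (1 - l) ^ w.length := by
  induction w with
  | nil => simp [treeLen]
  | cons i w ih =>
    rw [treeLen, List.length_cons, pow_succ]
    have := hT.l_lt_one
    exact mul_le_mul ih (hT.apply_le w i.isLt) (hT.apply_pos w (by omega)).le
      (pow_nonneg (by linarith) _)

lemma le_treeLen (hT : IsScalingTree T l K γ c) (w : List (Fin d)) :
    l ^ w.length ≤ treeLen T w := by
  induction w with
  | nil => simp [treeLen]
  | cons i w ih =>
    rw [treeLen, List.length_cons, pow_succ]
    exact mul_le_mul ih (hT.le_apply w i (by omega)) hT.l_pos.le (hT.treeLen_pos w).le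

lemma treeLeft_le_cons (hT : IsScalingTree T l K γ c) (i : Fin d) (w : List (Fin d)) :
    treeLeft T w ≤ treeLeft T (i :: w) := by
  have := mul_nonneg (hT.treeLen_pos w).le (hT.leftSum_nonneg w i.isLt)
  rw [treeLeft]
  linarith

lemma treeRight_cons_le (hT : IsScalingTree T l K γ c) (i : Fin d) (w : List (Fin d)) :
    treeRight T (i :: w) ≤ treeRight T w := by
  have := mul_le_mul_of_nonneg_left (hT.leftSum_add_le_one w i.isLt) (hT.treeLen_pos w).le
  rw [treeRight, treeRight, treeLeft, treeLen]
  linarith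

lemma treeLeft_le_append (hT : IsScalingTree T l K γ c) (u w : List (Fin d)) :
    treeLeft T w ≤ treeLeft T (u ++ w) := by
  induction u with
  | nil => exact le_rfl
  | cons i u ih => exact ih.trans (hT.treeLeft_le_cons i _)

lemma treeRight_append_le (hT : IsScalingTree T l K γ c) (u w : List (Fin d)) :
    treeRight T (u ++ w) ≤ treeRight T w := by
  induction u with
  | nil => exact le_rfl
  | cons i u ih => exact (hT.treeRight_cons_le i _).trans ih

lemma treeLeft_append_le (hT : IsScalingTree T l K γ c) (u w : List (Fin d)) :
    treeLeft T (u ++ w) ≤ treeRight T w := by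
  refine le_trans ?_ (hT.treeRight_append_le u w)
  rw [treeRight]
  linarith [hT.treeLen_pos (u ++ w)]

lemma tendsto_treeLeft (hT : IsScalingTree T l K γ c) (x : ℕ → Fin d) :
    Tendsto (fun n => treeLeft T (addrWord x n)) atTop (nhds (codePoint T x)) := by
  refine tendsto_atTop_ciSup (monotone_nat_of_le_succ fun n => hT.treeLeft_le_cons _ _) ?_
  refine ⟨treeRight T [], ?_⟩
  rintro _ ⟨n, rfl⟩
  simpa using hT.treeLeft_append_le (addrWord x n) []

lemma codePoint_mem (hT : IsScalingTree T l K γ c) (x : ℕ → Fin d) (n : ℕ) :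
    codePoint T x ∈ Icc (treeLeft T (addrWord x n)) (treeRight T (addrWord x n)) := by
  have h := (tendsto_add_atTop_iff_nat n).2 (hT.tendsto_treeLeft x)
  constructor
  · refine ge_of_tendsto' h fun m => ?_
    obtain ⟨u, hu⟩ := exists_addrWord_add x n m
    rw [add_comm m n, hu]
    exact hT.treeLeft_le_append u _
  · refine le_of_tendsto' h fun m => ?_
    obtain ⟨u, hu⟩ := exists_addrWord_add x n m
    rw [add_comm m n, hu]
    exact hT.treeLeft_append_le u _

lemma tendsto_treeLen (hT : IsScalingTree T l K γ c) (x : ℕ → Fin d) :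
    Tendsto (fun n => treeLen T (addrWord x n)) atTop (nhds 0) := by
  have h := tendsto_pow_atTop_nhds_zero_of_lt_one (r := 1 - l) (by linarith [hT.l_lt_one])
    (by linarith [hT.l_pos])
  refine squeeze_zero (fun n => (hT.treeLen_pos _).le) (fun n => ?_) h
  simpa [addrWord_length] using hT.treeLen_le (addrWord x n)

lemma tendsto_treeRight (hT : IsScalingTree T l K γ c) (x : ℕ → Fin d) :
    Tendsto (fun n => treeRight T (addrWord x n)) atTop (nhds (codePoint T x)) := by
  simpa [treeRight] using (hT.tendsto_treeLeft x).add (hT.tendsto_treeLen x)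

/-- The normalized positions inside `I_w` and `I_{wk}` agree up to an exponentially small error. -/
lemma abs_position_sub_le (hT : IsScalingTree T l K γ c) (k : Fin d) (u w : List (Fin d)) :
    |(treeLeft T (u ++ (w ++ [k])) - treeLeft T (w ++ [k])) / treeLen T (w ++ [k]) -
      (treeLeft T (u ++ w) - treeLeft T w) / treeLen T w| ≤
      (2 * d + 1) * K / (1 - γ) * γ ^ w.length := by
  have hγ1 : 0 < 1 - γ := by linarith [hT.γ_lt_one]
  have hK := hT.K_nonneg
  have hγ := hT.γ_pos
  induction u using List.reverseRecOn generalizing w with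
  | nil =>
    simp only [List.nil_append, sub_self, zero_div, abs_zero]
    positivity
  | append_singleton u i ih =>
    have step : ∀ v : List (Fin d), (treeLeft T (u ++ [i] ++ v) - treeLeft T v) / treeLen T v =
        leftSum d (T v) i + T v i *
          ((treeLeft T (u ++ (i :: v)) - treeLeft T (i :: v)) / treeLen T (i :: v)) := by
      intro v
      have h1 := (hT.treeLen_pos v).ne'
      have h2 := (hT.apply_pos v (m := i) (by omega)).ne'
      rw [List.append_assoc, List.singleton_append]
      conv_rhs => rw [treeLen, treeLeft]
      field_simp
      ring
    rw [step, step]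
    have hi := ih (i :: w)
    rw [List.cons_append] at hi
    set p := (treeLeft T (u ++ (i :: (w ++ [k]))) - treeLeft T (i :: (w ++ [k]))) /
      treeLen T (i :: (w ++ [k])) with hp
    set p' := (treeLeft T (u ++ (i :: w)) - treeLeft T (i :: w)) / treeLen T (i :: w)
    have hp01 : |p| ≤ 1 := by
      have h1 := hT.treeLen_pos (i :: (w ++ [k]))
      have h2 := hT.treeLeft_le_append u (i :: (w ++ [k]))
      have h3 := hT.treeLeft_append_le u (i :: (w ++ [k]))
      rw [treeRight] at h3
      rw [abs_of_nonneg (div_nonneg (by linarith) h1.le), div_le_one h1]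
      linarith
    have hG : 0 ≤ K * γ ^ w.length := by positivity
    have e1 := abs_leftSum_sub_le hG (hT.close w k) i.isLt
    have e2 := hT.close w k i (by omega)
    have e3 : |T w i| ≤ 1 := by
      rw [abs_of_pos (hT.apply_pos w (by omega))]
      linarith [hT.apply_le w i.isLt, hT.l_pos]
    have e : leftSum d (T (w ++ [k])) i + T (w ++ [k]) i * p - (leftSum d (T w) i + T w i * p') =
      (leftSum d (T (w ++ [k])) i - leftSum d (T w) i) + (T (w ++ [k]) i - T w i) * p
        + T w i * (p - p') := by ring
    rw [e]
    refine (abs_add_three _ _ _).trans ?_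
    rw [abs_mul, abs_mul]
    have f2 : |T (w ++ [k]) i - T w i| * |p| ≤ K * γ ^ w.length * 1 :=
      mul_le_mul e2 hp01 (abs_nonneg _) hG
    have f3 : |T w i| * |p - p'| ≤ 1 * ((2 * d + 1) * K / (1 - γ) * γ ^ (i :: w).length) :=
      mul_le_mul e3 hi (abs_nonneg _) zero_le_one
    rw [List.length_cons, pow_succ] at f3
    have e4 : (2 * d + 1) * K / (1 - γ) * γ ^ w.length =
      (2 * d + 1) * (K * γ ^ w.length) +
        1 * ((2 * d + 1) * K / (1 - γ) * (γ ^ w.length * γ)) := by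
      field_simp
      ring
    rw [e4]
    linarith

lemma abs_codePoint_position_sub_le (hT : IsScalingTree T l K γ c) (k : Fin d) (x : ℕ → Fin d)
    (n : ℕ) :
    |(codePoint T (consSeq k x) - treeLeft T (addrWord x n ++ [k])) /
        treeLen T (addrWord x n ++ [k]) -
      (codePoint T x - treeLeft T (addrWord x n)) / treeLen T (addrWord x n)| ≤
      (2 * d + 1) * K / (1 - γ) * γ ^ n := by
  have h1 := (tendsto_add_atTop_iff_nat n).2 (hT.tendsto_treeLeft x)
  have h2 := (tendsto_add_atTop_iff_nat (n + 1)).2 (hT.tendsto_treeLeft (consSeq k x))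
  have h3 := (((h2.sub_const (treeLeft T (addrWord x n ++ [k]))).div_const
    (treeLen T (addrWord x n ++ [k]))).sub
    ((h1.sub_const (treeLeft T (addrWord x n))).div_const (treeLen T (addrWord x n)))).abs
  refine le_of_tendsto' h3 fun m => ?_
  obtain ⟨u, hu⟩ := exists_addrWord_add x n m
  rw [← add_assoc m n 1, addrWord_consSeq, add_comm m n, hu, List.append_assoc]
  simpa [addrWord_length] using hT.abs_position_sub_le k u (addrWord x n)

/-- Distinct addresses code points whose distance is comparable to their common interval. -/
lemma treeLen_le_treeLeft_sub (hT : IsScalingTree T l K γ c) {x y : ℕ → Fin d} {n : ℕ}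
    (hxy : ∀ t < n, x t = y t) (hn : x n < y n) :
    l * treeLen T (addrWord x n) ≤ treeLeft T (addrWord y (n + 1)) -
      treeRight T (addrWord x (n + 1)) := by
  rw [addrWord, addrWord, ← addrWord_congr hxy, treeRight, treeLeft, treeLeft, treeLen]
  have h1 := hT.leftSum_add_gap_le (addrWord x n) (Fin.lt_def.1 hn) (y n).isLt
  have h2 := hT.le_apply (addrWord x n) (d + x n) (by omega)
  have h3 := mul_le_mul_of_nonneg_left (h2.trans (le_sub_iff_add_le'.2 h1))
    (hT.treeLen_pos (addrWord x n)).le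
  linarith

lemma treeLen_le_abs_codePoint_sub (hT : IsScalingTree T l K γ c) {x y : ℕ → Fin d} {n : ℕ}
    (hxy : ∀ t < n, x t = y t) (hn : x n ≠ y n) :
    l * treeLen T (addrWord x n) ≤ |codePoint T x - codePoint T y| := by
  rcases lt_or_gt_of_ne hn with h | h
  · have := hT.treeLen_le_treeLeft_sub hxy h
    rw [abs_sub_comm]
    refine le_trans ?_ (le_abs_self _)
    linarith [(hT.codePoint_mem x (n + 1)).2, (hT.codePoint_mem y (n + 1)).1]
  · have := hT.treeLen_le_treeLeft_sub (fun t ht => (hxy t ht).symm) h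
    rw [addrWord_congr hxy]
    refine le_trans ?_ (le_abs_self _)
    linarith [(hT.codePoint_mem y (n + 1)).2, (hT.codePoint_mem x (n + 1)).1]

end IsScalingTree

lemma exists_first_difference {α : Type*} {x y : ℕ → α} (h : x ≠ y) :
    ∃ n, (∀ t < n, x t = y t) ∧ x n ≠ y n := by
  classical
  have hex : ∃ n, x n ≠ y n := Function.ne_iff.1 h
  exact ⟨Nat.find hex, fun t ht => not_not.1 (Nat.find_min hex ht), Nat.find_spec hex⟩

/-- The ratio `|I_{wk}| / |I_w|`. -/
noncomputable def branchRatio {d : ℕ} (T : List (Fin d) → ℕ → ℝ) (k : Fin d)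
    (w : List (Fin d)) : ℝ :=
  treeLen T (w ++ [k]) / treeLen T w

lemma treeLeft_replicate_append {d : ℕ} (T : List (Fin d) → ℕ → ℝ) {a : Fin d} (ha : (a : ℕ) = 0)
    (n : ℕ) (w : List (Fin d)) : treeLeft T (List.replicate n a ++ w) = treeLeft T w := by
  induction n with
  | zero => rfl
  | succ n ih => simp [List.replicate_succ, treeLeft, ih, ha, leftSum]

namespace IsScalingTree

variable {d : ℕ} {T : List (Fin d) → ℕ → ℝ} {l K γ c : ℝ}

lemma treeRight_replicate_append (hT : IsScalingTree T l K γ c) {a : Fin d}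
    (ha : (a : ℕ) = d - 1) (n : ℕ) (w : List (Fin d)) :
    treeRight T (List.replicate n a ++ w) = treeRight T w := by
  induction n with
  | zero => rfl
  | succ n ih =>
    rw [← ih, List.replicate_succ, List.cons_append, treeRight, treeRight, treeLeft, treeLen,
      add_assoc, ← mul_add, ha, hT.leftSum_last, mul_one]

lemma exists_codePoint_eq_treeLeft (hT : IsScalingTree T l K γ c) (w : List (Fin d)) :
    ∃ z, codePoint T z = treeLeft T w ∧
      ∀ k, codePoint T (consSeq k z) = treeLeft T (w ++ [k]) := by
  have hd := hT.two_le
  obtain ⟨z, hz⟩ := exists_addrWord_eq_replicate_append (⟨0, by omega⟩ : Fin d) w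
  refine ⟨z, ?_, fun k => ?_⟩
  · have h := (tendsto_add_atTop_iff_nat w.length).2 (hT.tendsto_treeLeft z)
    simp only [add_comm _ w.length, hz, treeLeft_replicate_append] at h
    exact tendsto_nhds_unique h tendsto_const_nhds
  · have h := (tendsto_add_atTop_iff_nat (w.length + 1)).2 (hT.tendsto_treeLeft (consSeq k z))
    simp only [← add_assoc, addrWord_consSeq, add_comm _ w.length, hz, List.append_assoc,
      treeLeft_replicate_append] at h
    exact tendsto_nhds_unique h tendsto_const_nhds

lemma exists_codePoint_eq_treeRight (hT : IsScalingTree T l K γ c) (w : List (Fin d)) :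
    ∃ z, codePoint T z = treeRight T w ∧
      ∀ k, codePoint T (consSeq k z) = treeRight T (w ++ [k]) := by
  have hd := hT.two_le
  obtain ⟨z, hz⟩ := exists_addrWord_eq_replicate_append (⟨d - 1, by omega⟩ : Fin d) w
  refine ⟨z, ?_, fun k => ?_⟩
  · have h := (tendsto_add_atTop_iff_nat w.length).2 (hT.tendsto_treeRight z)
    simp only [add_comm _ w.length, hz, hT.treeRight_replicate_append] at h
    exact tendsto_nhds_unique h tendsto_const_nhds
  · have h := (tendsto_add_atTop_iff_nat (w.length + 1)).2 (hT.tendsto_treeRight (consSeq k z))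
    simp only [← add_assoc, addrWord_consSeq, add_comm _ w.length, hz, List.append_assoc,
      hT.treeRight_replicate_append] at h
    exact tendsto_nhds_unique h tendsto_const_nhds

lemma branchRatio_cons (k i : Fin d) (w : List (Fin d)) :
    branchRatio T k (i :: w) = branchRatio T k w * (T (w ++ [k]) i / T w i) := by
  rw [branchRatio, branchRatio, List.cons_append, treeLen, treeLen, mul_div_mul_comm]

lemma branchRatio_mem (hT : IsScalingTree T l K γ c) (k : Fin d) (w : List (Fin d)) :
    branchRatio T k w ∈ Icc c (1 - c) := by
  cases w with
  | nil => simpa [branchRatio, treeLen] using hT.singleton_mem k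
  | cons i w =>
    rw [branchRatio_cons]
    exact hT.slope_mem k w i (by omega)

lemma abs_branchRatio_sub_le (hT : IsScalingTree T l K γ c) (k i : Fin d) (w : List (Fin d)) :
    |branchRatio T k w - branchRatio T k (i :: w)| ≤ K / l * γ ^ w.length := by
  obtain ⟨h1, h2⟩ := hT.branchRatio_mem k w
  have hc := hT.c_pos
  have hl := hT.l_pos
  have hp := hT.apply_pos w (m := i) (by omega)
  have e : branchRatio T k w - branchRatio T k (i :: w) =
      branchRatio T k w * ((T w i - T (w ++ [k]) i) / T w i) := by
    rw [branchRatio_cons]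
    field_simp
  rw [e, abs_mul, abs_div, abs_of_pos hp, abs_sub_comm, abs_of_nonneg (by linarith)]
  have h3 := hT.close w k i (by omega)
  have h4 : |T (w ++ [k]) i - T w i| / T w i ≤ K * γ ^ w.length / l :=
    div_le_div₀ ((abs_nonneg _).trans h3) h3 hl (hT.le_apply w i (by omega))
  calc _ ≤ 1 * (K * γ ^ w.length / l) :=
        mul_le_mul (by linarith) h4 (by positivity) zero_le_one
    _ = _ := by ring

lemma exists_limit_branchRatio (hT : IsScalingTree T l K γ c) (k : Fin d) (x : ℕ → Fin d) :
    ∃ D ∈ Icc c (1 - c), ∀ n, |branchRatio T k (addrWord x n) - D| ≤ K / l / (1 - γ) * γ ^ n := by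
  have h : ∀ n, dist (branchRatio T k (addrWord x n)) (branchRatio T k (addrWord x (n + 1))) ≤
      K / l * γ ^ n := fun n => by
    rw [Real.dist_eq, addrWord]
    simpa [addrWord_length] using hT.abs_branchRatio_sub_le k (x n) (addrWord x n)
  obtain ⟨D, hD⟩ := cauchySeq_tendsto_of_complete (cauchySeq_of_le_geometric _ _ hT.γ_lt_one h)
  refine ⟨D, isClosed_Icc.mem_of_tendsto hD (Eventually.of_forall fun n => hT.branchRatio_mem k _),
    fun n => ?_⟩
  have := dist_le_of_le_geometric_of_tendsto _ _ hT.γ_lt_one h hD n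
  rw [Real.dist_eq] at this
  refine this.trans_eq ?_
  ring

lemma codePoint_injective (hT : IsScalingTree T l K γ c) : Function.Injective (codePoint T) := by
  intro x y hxy
  by_contra hne
  obtain ⟨n, hn, hn'⟩ := exists_first_difference hne
  have := hT.treeLen_le_abs_codePoint_sub hn hn'
  rw [hxy, sub_self, abs_zero] at this
  linarith [mul_pos hT.l_pos (hT.treeLen_pos (addrWord x n))]

lemma continuous_codePoint (hT : IsScalingTree T l K γ c) : Continuous (codePoint T) := by
  refine continuous_iff_continuousAt.2 fun x => Metric.tendsto_nhds.2 fun δ hδ => ?_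
  obtain ⟨n, hn⟩ := ((hT.tendsto_treeLen x).eventually (gt_mem_nhds hδ)).exists
  have : ∀ᶠ y in nhds x, ∀ t ∈ Finset.range n, y t = x t := by
    rw [Filter.eventually_all_finset]
    intro t _
    exact (continuous_apply t).continuousAt.eventually
      ((isOpen_discrete {x t}).mem_nhds (mem_singleton _))
  filter_upwards [this] with y hy
  have h1 := hT.codePoint_mem x n
  have h2 := hT.codePoint_mem y n
  rw [addrWord_congr (y := x) fun t ht => hy t (Finset.mem_range.2 ht)] at h2
  rw [treeRight] at h1 h2
  rw [Real.dist_eq, abs_lt]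
  constructor <;> linarith [h1.1, h1.2, h2.1, h2.2]

lemma abs_codePoint_consSeq_sub_le (hT : IsScalingTree T l K γ c) (k : Fin d) {x y : ℕ → Fin d}
    {n : ℕ} (hxy : ∀ t < n, x t = y t) :
    |codePoint T (consSeq k y) - codePoint T (consSeq k x) -
      branchRatio T k (addrWord x n) * (codePoint T y - codePoint T x)| ≤
      2 * ((2 * d + 1) * K / (1 - γ)) * γ ^ n * treeLen T (addrWord x n) := by
  have hx := hT.abs_codePoint_position_sub_le k x n
  have hy := hT.abs_codePoint_position_sub_le k y n
  rw [← addrWord_congr hxy] at hy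
  set w := addrWord x n
  have p1 := hT.treeLen_pos w
  have p2 := hT.treeLen_pos (w ++ [k])
  obtain ⟨q1, q2⟩ := hT.branchRatio_mem k w
  have hc := hT.c_pos
  set ex := (codePoint T (consSeq k x) - treeLeft T (w ++ [k])) / treeLen T (w ++ [k]) -
    (codePoint T x - treeLeft T w) / treeLen T w with hex
  set ey := (codePoint T (consSeq k y) - treeLeft T (w ++ [k])) / treeLen T (w ++ [k]) -
    (codePoint T y - treeLeft T w) / treeLen T w with hey
  have e : codePoint T (consSeq k y) - codePoint T (consSeq k x) -
      branchRatio T k w * (codePoint T y - codePoint T x) =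
      branchRatio T k w * ((ey - ex) * treeLen T w) := by
    rw [hex, hey, branchRatio]
    field_simp
    ring
  rw [e, abs_mul, abs_mul, abs_of_pos p1, abs_of_nonneg (by linarith : 0 ≤ branchRatio T k w)]
  have h3 : |ey - ex| ≤ 2 * ((2 * d + 1) * K / (1 - γ)) * γ ^ n := by
    have := norm_sub_le ey ex
    simp only [Real.norm_eq_abs] at this
    linarith
  calc _ ≤ 1 * (2 * ((2 * d + 1) * K / (1 - γ)) * γ ^ n * treeLen T w) :=
        mul_le_mul (by linarith) (by gcongr) (by positivity) zero_le_one
    _ = _ := one_mul _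

lemma exists_holder_exponent (hT : IsScalingTree T l K γ c) :
    ∃ ε ∈ Ioc (0 : ℝ) 1, ∀ (x y : ℕ → Fin d) (n : ℕ), (∀ t < n, x t = y t) → x n ≠ y n →
      l * γ ^ n ≤ |codePoint T x - codePoint T y| ^ ε := by
  have hl := hT.l_pos
  have hl1 := hT.l_lt_one
  have hγ := hT.γ_pos
  have hlogl : Real.log l < 0 := Real.log_neg hl hl1
  have hlogγ : Real.log γ < 0 := Real.log_neg hγ hT.γ_lt_one
  have hε : 0 < min 1 (Real.log γ / Real.log l) :=
    lt_min one_pos (div_pos_of_neg_of_neg hlogγ hlogl)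
  refine ⟨min 1 (Real.log γ / Real.log l), ⟨hε, min_le_left _ _⟩, ?_⟩
  set ε := min 1 (Real.log γ / Real.log l) with hεdef
  have hγl : γ ≤ l ^ ε := by
    rw [Real.le_rpow_iff_log_le hγ hl]
    have : ε ≤ Real.log γ / Real.log l := min_le_right _ _
    rwa [le_div_iff_of_neg hlogl] at this
  intro x y n hxy hn
  have h1 := hT.treeLen_le_abs_codePoint_sub hxy hn
  have h2 := hT.le_treeLen (addrWord x n)
  rw [addrWord_length] at h2
  calc l * γ ^ n ≤ l ^ ε * (l ^ ε) ^ n := by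
        have := Real.self_le_rpow_of_le_one hl.le hl1.le (min_le_left 1 _ : ε ≤ 1)
        gcongr
    _ = (l * l ^ n) ^ ε := by
        rw [Real.mul_rpow hl.le (by positivity), ← Real.rpow_natCast_mul hl.le, mul_comm (n : ℝ),
          Real.rpow_mul_natCast hl.le]
    _ ≤ _ := by
        refine Real.rpow_le_rpow (by positivity) (le_trans ?_ h1) hε.le
        gcongr

lemma gap_endpoints (hT : IsScalingTree T l K γ c) {x y : ℕ → Fin d}
    (hlt : codePoint T x < codePoint T y)
    (hz : ∀ z, codePoint T z ≤ codePoint T x ∨ codePoint T y ≤ codePoint T z) :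
    ∃ w, ∃ i j : Fin d, (j : ℕ) = i + 1 ∧ (codePoint T x = treeRight T (i :: w) ∧
        ∀ k, codePoint T (consSeq k x) = treeRight T (i :: w ++ [k])) ∧
      (codePoint T y = treeLeft T (j :: w) ∧
        ∀ k, codePoint T (consSeq k y) = treeLeft T (j :: w ++ [k])) := by
  have hne : x ≠ y := by
    rintro rfl
    exact lt_irrefl _ hlt
  obtain ⟨n, hn, hn'⟩ := exists_first_difference hne
  have hpos := mul_pos hT.l_pos (hT.treeLen_pos (addrWord x n))
  have hxy : x n < y n := by
    refine lt_of_le_of_ne (not_lt.1 fun h => ?_) hn'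
    have h1 := hT.treeLen_le_treeLeft_sub (fun t ht => (hn t ht).symm) h
    rw [← addrWord_congr hn] at h1
    linarith [(hT.codePoint_mem x (n + 1)).1, (hT.codePoint_mem y (n + 1)).2]
  have hsep := hT.treeLen_le_treeLeft_sub hn hxy
  have hxR := (hT.codePoint_mem x (n + 1)).2
  have hyL := (hT.codePoint_mem y (n + 1)).1
  rw [addrWord] at hxR hsep
  rw [addrWord, ← addrWord_congr hn] at hyL hsep
  set w := addrWord x n
  obtain ⟨z₁, hz₁, hz₁'⟩ := hT.exists_codePoint_eq_treeRight (x n :: w)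
  have hx : codePoint T x = codePoint T z₁ := by
    rcases hz z₁ with h | h <;> linarith
  let j : Fin d := ⟨x n + 1, by have := (y n).isLt; have := Fin.lt_def.1 hxy; omega⟩
  obtain ⟨z₂, hz₂, hz₂'⟩ := hT.exists_codePoint_eq_treeLeft (j :: w)
  have hj1 : treeRight T (x n :: w) < treeLeft T (j :: w) := by
    have h1 := hT.leftSum_add_gap_le w (i := x n) (j := j) (Nat.lt_succ_self _) j.isLt
    have h2 := hT.apply_pos w (m := d + x n) (by have := j.isLt; simp only [j] at this; omega)
    have h3 := mul_lt_mul_of_pos_left (by linarith : leftSum d (T w) (x n) + T w (x n) <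
      leftSum d (T w) j) (hT.treeLen_pos w)
    rw [treeRight, treeLeft, treeLeft, treeLen]
    linarith
  have hj2 : treeLeft T (j :: w) ≤ treeLeft T (y n :: w) := by
    have h1 := hT.leftSum_le_leftSum w (i := j) (j := y n) (Nat.succ_le_of_lt (Fin.lt_def.1 hxy))
      (y n).isLt
    have h3 := mul_le_mul_of_nonneg_left h1 (hT.treeLen_pos w).le
    rw [treeLeft, treeLeft]
    linarith
  have hy : codePoint T y = codePoint T z₂ := by
    rcases hz z₂ with h | h <;> linarith
  obtain rfl := hT.codePoint_injective hx
  obtain rfl := hT.codePoint_injective hy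
  exact ⟨w, x n, j, rfl, ⟨hz₁, hz₁'⟩, ⟨hz₂, hz₂'⟩⟩

lemma treeLeft_sub_treeRight {w : List (Fin d)} {i j : Fin d} (hij : (j : ℕ) = i + 1) :
    treeLeft T (j :: w) - treeRight T (i :: w) = treeLen T w * T w (d + i) := by
  rw [treeRight, treeLeft, treeLeft, treeLen, hij]
  rw [leftSum, Finset.sum_range_succ, ← leftSum]
  ring

/-- Every branch of the tree extends to a `C^{1+ε}` contraction of `[0,1]`. -/
lemma exists_branch (hT : IsScalingTree T l K γ c) :
    ∃ ε ∈ Ioc (0 : ℝ) 1, ∀ k : Fin d, ∃ g g' : ℝ → ℝ,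
      (∀ x, g (codePoint T x) = codePoint T (consSeq k x)) ∧
      (∀ x ∈ I01, g' x ∈ Ioo (0 : ℝ) 1) ∧
      ∃ A, 0 ≤ A ∧ ∀ x ∈ I01, ∀ y ∈ I01, x ≤ y → TaylorBound ε A g g' x y := by
  obtain ⟨ε, ⟨hε0, hε1⟩, hε⟩ := hT.exists_holder_exponent
  refine ⟨ε, ⟨hε0, hε1⟩, fun k => ?_⟩
  have hd := hT.two_le
  have hl := hT.l_pos
  have hK := hT.K_nonneg
  have hγ := hT.γ_pos
  have hγ1 : 0 < 1 - γ := by linarith [hT.γ_lt_one]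
  have : Nonempty (ℕ → Fin d) := ⟨fun _ => ⟨0, by omega⟩⟩
  choose D hD hDlim using hT.exists_limit_branchRatio k
  have hinv := Function.leftInverse_invFun hT.codePoint_injective
  set A := (2 * d + 1) * K / (1 - γ) with hA
  set B := K / l / (1 - γ) with hB
  have hA0 : 0 ≤ A := by positivity
  have hB0 : 0 ≤ B := by positivity
  have hrange : ∀ x, codePoint T x ∈ I01 := fun x => by
    simpa [addrWord, treeLeft, treeRight, treeLen] using hT.codePoint_mem x 0
  obtain ⟨z₀, hz₀, -⟩ := hT.exists_codePoint_eq_treeLeft []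
  obtain ⟨z₁, hz₁, -⟩ := hT.exists_codePoint_eq_treeRight []
  have key := exists_whitney_extension (C := range (codePoint T))
    (isCompact_range hT.continuous_codePoint) (range_subset_iff.2 hrange)
    ⟨z₀, by simpa [treeLeft] using hz₀⟩ ⟨z₁, by simpa [treeRight, treeLeft, treeLen] using hz₁⟩
    (f := fun t => codePoint T (consSeq k (Function.invFun (codePoint T) t)))
    (D := fun t => D (Function.invFun (codePoint T) t))
    (c := c) (ε := ε) (H := (2 * A / l + 2 * B) / l) hT.c_pos hε0 hε1 (by positivity)
    (by rintro _ ⟨x, rfl⟩; exact hD _) ?_ ?_ ?_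
  · obtain ⟨F, F', h1, h2, h3⟩ := key
    refine ⟨F, F', fun x => ?_, h2, h3⟩
    rw [h1 _ (mem_range_self x), hinv x]
  · rintro _ ⟨x, rfl⟩ _ ⟨y, rfl⟩
    simp only [hinv _]
    rcases eq_or_ne x y with rfl | hne
    · simp [Real.zero_rpow hε0.ne']
    obtain ⟨n, hn, hn'⟩ := exists_first_difference hne
    have e := hε x y n hn hn'
    have hx := hDlim x n
    have hy := hDlim y n
    rw [← addrWord_congr hn] at hy
    rw [abs_sub_comm] at hx
    calc |D x - D y| ≤ 2 * B * γ ^ n := by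
          refine (abs_sub_le _ _ _).trans (add_le_add hx hy) |>.trans_eq ?_
          ring
      _ ≤ (2 * A / l + 2 * B) * γ ^ n := by
          gcongr
          linarith [show 0 ≤ 2 * A / l by positivity]
      _ = (2 * A / l + 2 * B) / l * (l * γ ^ n) := by field_simp
      _ ≤ _ := by gcongr
  · rintro _ ⟨x, rfl⟩ _ ⟨y, rfl⟩
    simp only [hinv _]
    rcases eq_or_ne x y with rfl | hne
    · simp
    obtain ⟨n, hn, hn'⟩ := exists_first_difference hne
    have e := hε x y n hn hn'
    have hx := hDlim x n
    have h1 := hT.abs_codePoint_consSeq_sub_le k hn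
    have h2 := hT.treeLen_le_abs_codePoint_sub hn hn'
    set δ := |codePoint T x - codePoint T y| with hδ
    have hδ' : |codePoint T y - codePoint T x| = δ := abs_sub_comm _ _
    have e2 : codePoint T (consSeq k y) - codePoint T (consSeq k x) -
        D x * (codePoint T y - codePoint T x) =
        (codePoint T (consSeq k y) - codePoint T (consSeq k x) -
          branchRatio T k (addrWord x n) * (codePoint T y - codePoint T x)) +
        (branchRatio T k (addrWord x n) - D x) * (codePoint T y - codePoint T x) := by ring
    have hlen : treeLen T (addrWord x n) ≤ δ / l := by
      rw [le_div_iff₀ hl]; linarith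
    rw [e2]
    calc _ ≤ _ := abs_add_le _ _
      _ ≤ 2 * A * γ ^ n * (δ / l) + B * γ ^ n * δ := by
          rw [abs_mul, hδ']
          gcongr
          exact h1.trans (by gcongr)
      _ = (2 * A / l + B) * γ ^ n * δ := by ring
      _ ≤ (2 * A / l + 2 * B) * γ ^ n * δ := by gcongr; linarith
      _ = (2 * A / l + 2 * B) / l * (l * γ ^ n) * δ := by field_simp
      _ ≤ _ := by gcongr
  · rintro _ ⟨x, rfl⟩ _ ⟨y, rfl⟩ hlt hz
    simp only [hinv _]
    obtain ⟨w, i, j, hij, ⟨hx, hx'⟩, hy, hy'⟩ :=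
      hT.gap_endpoints hlt fun z => hz _ (mem_range_self z)
    have hid : d + (i : ℕ) < 2 * d - 1 := by have := j.isLt; omega
    rw [hx, hx' k, hy, hy' k, List.cons_append, List.cons_append, treeLeft_sub_treeRight hij,
      treeLeft_sub_treeRight hij, mul_div_mul_comm]
    exact hT.slope_mem k w _ hid

/-- The tree of prescribed scaling vectors is realized by a `C^{1+ε}` Cantor system. -/
theorem exists_cantorSystem (hT : IsScalingTree T l K γ c) :
    ∃ ε ∈ Ioc (0 : ℝ) 1, ∃ g : Fin d → ℝ → ℝ, IsCantorSystem 1 ε g ∧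
      ∀ k w, g k (treeLeft T w) = treeLeft T (w ++ [k]) ∧
        g k (treeRight T w) = treeRight T (w ++ [k]) := by
  obtain ⟨ε, hε, hg⟩ := hT.exists_branch
  choose g g' hcode hg' hTB using hg
  have hL : ∀ k w, g k (treeLeft T w) = treeLeft T (w ++ [k]) := by
    intro k w
    obtain ⟨z, hz, hz'⟩ := hT.exists_codePoint_eq_treeLeft w
    rw [← hz, hcode, hz']
  have hR : ∀ k w, g k (treeRight T w) = treeRight T (w ++ [k]) := by
    intro k w
    obtain ⟨z, hz, hz'⟩ := hT.exists_codePoint_eq_treeRight w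
    rw [← hz, hcode, hz']
  have h0 : ∀ k : Fin d, g k 0 = leftSum d (T []) k := by
    intro k
    simpa [treeLeft, treeLen] using hL k []
  have h1 : ∀ k : Fin d, g k 1 = leftSum d (T []) k + T [] k := by
    intro k
    simpa [treeRight, treeLeft, treeLen] using hR k []
  refine ⟨ε, hε, g, isCantorSystem_of_taylorBound hε.1 hg' hTB ?_ ?_ ?_ ?_ ?_,
    fun k w => ⟨hL k w, hR k w⟩⟩
  · intro i
    rw [h0]
    exact hT.leftSum_nonneg [] i.isLt
  · intro i
    rw [h1]
    exact hT.leftSum_add_le_one [] i.isLt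
  · intro i j hij
    rw [h0, h1]
    have h := hT.leftSum_add_gap_le [] (Fin.lt_def.1 hij) j.isLt
    have hlt : (i : ℕ) < j := hij
    linarith [hT.apply_pos [] (m := d + i) (by omega)]
  · intro i hi
    rw [h0, hi]
    simp [leftSum]
  · intro i hi
    rw [h1, hi, hT.leftSum_last]

end IsScalingTree

lemma wordMap_append_singleton {d : ℕ} (g : Fin d → ℝ → ℝ) (w : List (Fin d)) (k : Fin d) (x : ℝ) :
    wordMap g (w ++ [k]) x = g k (wordMap g w x) := by
  induction w generalizing x with
  | nil => rfl
  | cons i w ih => exact ih (g i x)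

lemma IsScalingTree.scalingData_eq {d : ℕ} {T : List (Fin d) → ℕ → ℝ} {l K γ c : ℝ}
    (hT : IsScalingTree T l K γ c) {g : Fin d → ℝ → ℝ}
    (hg : ∀ k w, g k (treeLeft T w) = treeLeft T (w ++ [k]) ∧
      g k (treeRight T w) = treeRight T (w ++ [k])) (w : List (Fin d)) :
    scalingData g w = fun m : Fin (2 * d - 1) => T w m := by
  have h0 : ∀ w, wordMap g w 0 = treeLeft T w := by
    intro w
    induction w using List.reverseRecOn with
    | nil => rfl
    | append_singleton w k ih => rw [wordMap_append_singleton, ih, (hg k w).1]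
  have h1 : ∀ w, wordMap g w 1 = treeRight T w := by
    intro w
    induction w using List.reverseRecOn with
    | nil => simp [wordMap, treeRight, treeLeft, treeLen]
    | append_singleton w k ih => rw [wordMap_append_singleton, ih, (hg k w).2]
  have hlen : ∀ w, wordLen g w = treeLen T w := by
    intro w
    rw [wordLen, h0, h1, treeRight, add_sub_cancel_left]
  have hp := (hT.treeLen_pos w).ne'
  funext m
  unfold scalingData
  split_ifs with hm
  · rw [hlen, hlen, treeLen]
    field_simp
  · have hm' := m.isLt
    have e0 : ∀ i : Fin d, wordMap g w (g i 0) = treeLeft T (i :: w) := fun i => h0 (i :: w)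
    have e1 : ∀ i : Fin d, wordMap g w (g i 1) = treeRight T (i :: w) := fun i => h1 (i :: w)
    rw [hlen, e0, e1, IsScalingTree.treeLeft_sub_treeRight rfl]
    have : d + ((m : ℕ) - d) = m := by omega
    simp only [this]
    field_simp

lemma abs_sub_le_of_agree {d : ℕ} {S : (ℕ → Fin d) → Fin (2 * d - 1) → ℝ} {K γ : ℝ} (hK : 0 < K)
    (hγ : γ ∈ Ioo (0 : ℝ) 1)
    (hS : ∀ j j' : ℕ → Fin d, ∀ p : ℕ, (∀ t < p, j t = j' t) → j p ≠ j' p →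
      ∀ m, |S j m - S j' m| ≤ K * γ ^ p)
    {j j' : ℕ → Fin d} {n : ℕ} (h : ∀ t < n, j t = j' t) (m : Fin (2 * d - 1)) :
    |S j m - S j' m| ≤ K * γ ^ n := by
  obtain ⟨h0, h1⟩ := hγ
  rcases eq_or_ne j j' with rfl | hne
  · simp only [sub_self, abs_zero]
    positivity
  obtain ⟨p, hp, hp'⟩ := exists_first_difference hne
  have hnp : n ≤ p := not_lt.1 fun hlt => hp' (h p hlt)
  refine (hS j j' p hp hp' m).trans ?_
  exact mul_le_mul_of_nonneg_left (pow_le_pow_of_le_one h0.le h1.le hnp) hK.le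

lemma continuous_of_agree {d : ℕ} {φ : (ℕ → Fin d) → ℝ} {K γ : ℝ} (hγ : γ ∈ Ioo (0 : ℝ) 1)
    (hφ : ∀ (j j' : ℕ → Fin d) (n : ℕ), (∀ t < n, j t = j' t) → |φ j - φ j'| ≤ K * γ ^ n) :
    Continuous φ := by
  refine continuous_iff_continuousAt.2 fun x => Metric.tendsto_nhds.2 fun δ hδ => ?_
  have hlim : Tendsto (fun n : ℕ => K * γ ^ n) atTop (nhds 0) := by
    simpa using (tendsto_pow_atTop_nhds_zero_of_lt_one hγ.1.le hγ.2).const_mul K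
  obtain ⟨n, hn⟩ := (hlim.eventually (gt_mem_nhds hδ)).exists
  have : ∀ᶠ y in nhds x, ∀ t ∈ Finset.range n, y t = x t := by
    rw [Filter.eventually_all_finset]
    intro t _
    exact (continuous_apply t).continuousAt.eventually
      ((isOpen_discrete {x t}).mem_nhds (mem_singleton _))
  filter_upwards [this] with y hy
  rw [Real.dist_eq]
  exact (hφ y x n fun t ht => hy t (Finset.mem_range.2 ht)).trans_lt hn

/-- A continuous function from the space of sequences to the open simplex stays away from the
boundary. -/
lemma exists_uniform_lower_bound {d : ℕ} (hd : 2 ≤ d) {S : (ℕ → Fin d) → Fin (2 * d - 1) → ℝ}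
    (hSsimp : ∀ j, S j ∈ Simp d) (hcont : ∀ m, Continuous fun j => S j m) :
    ∃ l > 0, ∀ j m, l ≤ S j m := by
  have : Nonempty (ℕ → Fin d) := ⟨fun _ => ⟨0, by omega⟩⟩
  have : Nonempty (Fin (2 * d - 1)) := ⟨⟨0, by omega⟩⟩
  have hmin : ∀ m, ∃ j₀, ∀ j, S j₀ m ≤ S j m := fun m => by
    obtain ⟨j₀, -, hj₀⟩ := isCompact_univ.exists_isMinOn univ_nonempty (hcont m).continuousOn
    exact ⟨j₀, fun j => hj₀ (mem_univ j)⟩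
  choose j₀ hj₀ using hmin
  obtain ⟨m₀, hm₀⟩ := Finite.exists_min fun m => S (j₀ m) m
  exact ⟨S (j₀ m₀) m₀, ((hSsimp _).1 m₀).1, fun j m => (hm₀ m).trans (hj₀ m j)⟩

/-- The scaling vectors prescribed by `S`, replaced by the uniform vector on words of length less
than `N`; a word is extended to a sequence by repeating the letter `a`. -/
noncomputable def truncTree {d : ℕ} (a : Fin d) (S : (ℕ → Fin d) → Fin (2 * d - 1) → ℝ) (N : ℕ)
    (w : List (Fin d)) (m : ℕ) : ℝ :=
  if h : N ≤ w.length ∧ m < 2 * d - 1 then S (fun t => w.getD t a) ⟨m, h.2⟩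
  else ((2 * d - 1 : ℕ) : ℝ)⁻¹

section truncTree

variable {d : ℕ} {a : Fin d} {S : (ℕ → Fin d) → Fin (2 * d - 1) → ℝ} {N : ℕ}

lemma truncTree_of_lt {w : List (Fin d)} (h : w.length < N) (m : ℕ) :
    truncTree a S N w m = ((2 * d - 1 : ℕ) : ℝ)⁻¹ :=
  dif_neg (by omega)

lemma truncTree_of_le {w : List (Fin d)} (h : N ≤ w.length) {m : ℕ} (hm : m < 2 * d - 1) :
    truncTree a S N w m = S (fun t => w.getD t a) ⟨m, hm⟩ :=
  dif_pos ⟨h, hm⟩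

lemma sum_truncTree (hd : 2 ≤ d) (hSsimp : ∀ j, S j ∈ Simp d) (w : List (Fin d)) :
    ∑ m ∈ Finset.range (2 * d - 1), truncTree a S N w m = 1 := by
  rcases lt_or_ge w.length N with h | h
  · have : ((2 * d - 1 : ℕ) : ℝ) ≠ 0 := Nat.cast_ne_zero.2 (by omega)
    simp only [truncTree_of_lt h, Finset.sum_const, Finset.card_range, nsmul_eq_mul]
    exact mul_inv_cancel₀ this
  · rw [Finset.sum_range, ← (hSsimp fun t => w.getD t a).2]
    exact Finset.sum_congr rfl fun m _ => truncTree_of_le h m.isLt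

lemma truncTree_mem (hd : 2 ≤ d) (hSsimp : ∀ j, S j ∈ Simp d) {l : ℝ} (hl : 0 < l)
    (hlS : ∀ j m, l ≤ S j m) (w : List (Fin d)) {m : ℕ} (hm : m < 2 * d - 1) :
    truncTree a S N w m ∈ Icc l (1 - l) := by
  have hlow : ∀ i < 2 * d - 1, l ≤ truncTree a S N w i := by
    intro i hi
    rcases lt_or_ge w.length N with h | h
    · have hpos : (0 : ℝ) < (2 * d - 1 : ℕ) := Nat.cast_pos.2 (by omega)
      rw [truncTree_of_lt h, ← one_div, le_div_iff₀ hpos, ← (hSsimp fun _ => a).2, mul_comm]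
      simpa using Finset.sum_le_sum fun i (_ : i ∈ Finset.univ) => hlS (fun _ => a) i
    · rw [truncTree_of_le h hi]
      exact hlS _ _
  refine ⟨hlow m hm, ?_⟩
  obtain ⟨i, hi, him⟩ : ∃ i < 2 * d - 1, m ≠ i := by
    rcases Nat.eq_zero_or_pos m with rfl | h
    · exact ⟨1, by omega, by omega⟩
    · exact ⟨0, by omega, by omega⟩
  have h1 : ∑ t ∈ {m, i}, truncTree a S N w t ≤
      ∑ t ∈ Finset.range (2 * d - 1), truncTree a S N w t := by
    refine Finset.sum_le_sum_of_subset_of_nonneg ?_ fun t ht _ =>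
      hl.le.trans (hlow t (Finset.mem_range.1 ht))
    intro t ht
    rcases Finset.mem_insert.1 ht with rfl | ht
    · exact Finset.mem_range.2 hm
    · rw [Finset.mem_singleton.1 ht]
      exact Finset.mem_range.2 hi
  rw [sum_truncTree hd hSsimp, Finset.sum_pair him] at h1
  linarith [hlow i hi]

lemma abs_truncTree_sub_le {K γ : ℝ}
    (hS : ∀ (j j' : ℕ → Fin d) (n : ℕ), (∀ t < n, j t = j' t) → ∀ m, |S j m - S j' m| ≤ K * γ ^ n)
    {w : List (Fin d)} (h : N ≤ w.length) (k : Fin d) {m : ℕ} (hm : m < 2 * d - 1) :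
    |truncTree a S N (w ++ [k]) m - truncTree a S N w m| ≤ K * γ ^ w.length := by
  rw [truncTree_of_le h hm, truncTree_of_le (by simp; omega) hm]
  refine hS _ _ _ (fun t ht => ?_) _
  exact List.getD_append _ _ _ _ ht

lemma branchRatio_truncTree_of_lt (hd : 2 ≤ d) (hN : 0 < N) (k : Fin d) {w : List (Fin d)}
    (h : w.length < N) : branchRatio (truncTree a S N) k w = ((2 * d - 1 : ℕ) : ℝ)⁻¹ := by
  induction w with
  | nil => simp [branchRatio, treeLen, truncTree_of_lt (w := []) hN]
  | cons i w ih =>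
    rw [List.length_cons] at h
    have : ((2 * d - 1 : ℕ) : ℝ) ≠ 0 := Nat.cast_ne_zero.2 (by omega)
    rw [IsScalingTree.branchRatio_cons, ih (by omega), truncTree_of_lt (by simp; omega),
      truncTree_of_lt (by omega), div_self (inv_ne_zero this), mul_one]

/-- The slopes of the truncated tree stay away from `0` and `1`, with an error that improves
geometrically from level `N` on. -/
lemma slope_truncTree_mem (hd : 2 ≤ d) (hN : 0 < N) (hSsimp : ∀ j, S j ∈ Simp d) {l K γ B : ℝ}
    (hl : 0 < l) (hlS : ∀ j m, l ≤ S j m) (hγ : 0 < γ)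
    (hS : ∀ (j j' : ℕ → Fin d) (n : ℕ), (∀ t < n, j t = j' t) → ∀ m, |S j m - S j' m| ≤ K * γ ^ n)
    (hB0 : 0 ≤ B) (hB : B * (1 - γ) = K / l) (hBN : B * γ ^ N ≤ l / 2)
    (k : Fin d) (w : List (Fin d)) (hw : N ≤ w.length + 1) {m : ℕ} (hm : m < 2 * d - 1) :
    branchRatio (truncTree a S N) k w * (truncTree a S N (w ++ [k]) m / truncTree a S N w m) ∈
      Icc (l / 2 + B * γ ^ (w.length + 1)) (1 - l / 2 - B * γ ^ (w.length + 1)) := by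
  induction w generalizing m with
  | nil =>
    obtain rfl : N = 1 := by simp at hw; omega
    obtain ⟨h1, h2⟩ := truncTree_mem (a := a) (N := 1) hd hSsimp hl hlS ([] ++ [k]) hm
    have : ((2 * d - 1 : ℕ) : ℝ) ≠ 0 := Nat.cast_ne_zero.2 (by omega)
    rw [branchRatio_truncTree_of_lt hd hN k (by simp), truncTree_of_lt (w := []) (by simp),
      mul_div_cancel₀ _ (inv_ne_zero this)]
    simp only [List.length_nil, zero_add]
    constructor <;> linarith
  | cons i w ih =>
    rcases lt_or_ge (i :: w).length N with hlt | hge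
    · have e : (i :: w).length + 1 = N := by omega
      obtain ⟨h1, h2⟩ := truncTree_mem (a := a) (N := N) hd hSsimp hl hlS (i :: w ++ [k]) hm
      have : ((2 * d - 1 : ℕ) : ℝ) ≠ 0 := Nat.cast_ne_zero.2 (by omega)
      rw [branchRatio_truncTree_of_lt hd hN k hlt, truncTree_of_lt hlt,
        mul_div_cancel₀ _ (inv_ne_zero this), e]
      constructor <;> linarith
    · rw [IsScalingTree.branchRatio_cons]
      obtain ⟨h1, h2⟩ := ih (by simpa using hge) (m := i) (by omega)
      set r := branchRatio (truncTree a S N) k w *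
        (truncTree a S N (w ++ [k]) i / truncTree a S N w i)
      obtain ⟨h3, -⟩ := truncTree_mem (a := a) (N := N) hd hSsimp hl hlS (i :: w) hm
      have h4 := abs_truncTree_sub_le (a := a) hS hge k hm
      set p := truncTree a S N (i :: w) m
      set q := truncTree a S N (i :: w ++ [k]) m
      rw [List.length_cons] at h4 ⊢
      set n := w.length + 1
      have hp : 0 < p := hl.trans_le h3
      have hpow : 0 ≤ B * γ ^ n := by positivity
      have h5 : |r * (q / p) - r| ≤ K / l * γ ^ n := by
        have e : r * (q / p) - r = r * ((q - p) / p) := by field_simp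
        rw [e, abs_mul, abs_div, abs_of_pos hp, abs_of_nonneg (by linarith)]
        calc r * (|q - p| / p) ≤ 1 * (K * γ ^ n / l) :=
              mul_le_mul (by linarith) (div_le_div₀ ((abs_nonneg _).trans h4) h4 hl h3)
                (by positivity) zero_le_one
          _ = _ := by ring
      have h6 : K / l * γ ^ n = B * γ ^ n - B * γ ^ (n + 1) := by rw [← hB]; ring
      rw [h6] at h5
      obtain ⟨h7, h8⟩ := abs_le.1 h5
      constructor <;> linarith

lemma isScalingTree_truncTree (hd : 2 ≤ d) (hN : 0 < N) (hSsimp : ∀ j, S j ∈ Simp d) {l K γ B : ℝ}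
    (hl : 0 < l) (hlS : ∀ j m, l ≤ S j m) (hK : 0 < K) (hγ : γ ∈ Ioo (0 : ℝ) 1)
    (hS : ∀ (j j' : ℕ → Fin d) (n : ℕ), (∀ t < n, j t = j' t) → ∀ m, |S j m - S j' m| ≤ K * γ ^ n)
    (hB0 : 0 ≤ B) (hB : B * (1 - γ) = K / l) (hBN : B * γ ^ N ≤ l / 2) :
    IsScalingTree (truncTree a S N) l (K + (γ ^ N)⁻¹) γ (l / 2) := by
  obtain ⟨hγ0, hγ1⟩ := hγ
  have hmem := fun w m (hm : m < 2 * d - 1) =>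
    truncTree_mem (a := a) (N := N) hd hSsimp hl hlS w hm
  refine ⟨hd, hl, by positivity, hγ0, hγ1, by linarith, fun w m hm => (hmem w m hm).1,
    ?_, ?_, ?_, ?_⟩
  · intro w
    have e : 2 * d - 1 = d + (d - 1) := by omega
    rw [← Finset.sum_range_add, ← e, sum_truncTree hd hSsimp]
  · intro w k m hm
    rcases lt_or_ge w.length N with h | h
    · obtain ⟨h1, h2⟩ := hmem w m hm
      obtain ⟨h3, h4⟩ := hmem (w ++ [k]) m hm
      have h5 : 1 ≤ (γ ^ N)⁻¹ * γ ^ w.length := by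
        rw [inv_mul_eq_div, one_le_div (by positivity)]
        exact pow_le_pow_of_le_one hγ0.le hγ1.le h.le
      have h6 : 0 ≤ K * γ ^ w.length := by positivity
      rw [add_mul, abs_le]
      constructor <;> linarith
    · refine (abs_truncTree_sub_le hS h k hm).trans ?_
      gcongr
      have : 0 < (γ ^ N)⁻¹ := by positivity
      linarith
  · intro k
    obtain ⟨h1, h2⟩ := hmem [] k (by omega)
    rw [treeLen, treeLen, one_mul]
    constructor <;> linarith
  · intro k w m hm
    rcases lt_or_ge (w.length + 1) N with h | h
    · have hb := branchRatio_truncTree_of_lt (a := a) (S := S) hd hN k (w := w) (by omega)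
      have : ((2 * d - 1 : ℕ) : ℝ) ≠ 0 := Nat.cast_ne_zero.2 (by omega)
      obtain ⟨h1, h2⟩ := hmem w m hm
      rw [truncTree_of_lt (by omega)] at h1 h2
      rw [← branchRatio, hb, truncTree_of_lt (w := w) (by omega),
        truncTree_of_lt (w := w ++ [k]) (by simpa using h), div_self (inv_ne_zero this), mul_one]
      constructor <;> linarith
    · obtain ⟨h1, h2⟩ := slope_truncTree_mem (a := a) hd hN hSsimp hl hlS hγ0 hS hB0 hB hBN k w h hm
      have : 0 ≤ B * γ ^ (w.length + 1) := by positivity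
      rw [branchRatio] at h1 h2
      constructor <;> linarith

lemma tendsto_truncTree_dword {K γ : ℝ} (hγ : γ ∈ Ioo (0 : ℝ) 1)
    (hS : ∀ (j j' : ℕ → Fin d) (n : ℕ), (∀ t < n, j t = j' t) → ∀ m, |S j m - S j' m| ≤ K * γ ^ n)
    (j : ℕ → Fin d) (m : Fin (2 * d - 1)) :
    Tendsto (fun n => truncTree a S N (dword j n) m) atTop (nhds (S j m)) := by
  have hlim : Tendsto (fun n : ℕ => K * γ ^ n) atTop (nhds 0) := by
    simpa using (tendsto_pow_atTop_nhds_zero_of_lt_one hγ.1.le hγ.2).const_mul K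
  rw [tendsto_iff_dist_tendsto_zero]
  refine squeeze_zero' (Eventually.of_forall fun n => dist_nonneg) ?_ hlim
  filter_upwards [eventually_ge_atTop N] with n hn
  rw [truncTree_of_le (by simpa [dword] using hn) m.isLt, Real.dist_eq]
  refine hS _ _ n (fun t ht => ?_) m
  simp [dword, List.getD_eq_getElem?_getD, ht]

end truncTree

/-- Sullivan realization: every Hölder continuous function
`S : Σ_d^dual → Simp_{2d-2}` (i.e. `|S(j) - S(j')|_∞ ≤ K γ^{#(j∩j')}`) is the scaling
function of a `C^{1+ε'}` Cantor system for some `ε' ∈ (0,1]`. -/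
theorem stmt6 (d : ℕ) (hd : 2 ≤ d) (S : (ℕ → Fin d) → Fin (2*d-1) → ℝ)
    (hSsimp : ∀ j, S j ∈ Simp d)
    (K : ℝ) (hK : 0 < K) (γ : ℝ) (hγ : γ ∈ Set.Ioo (0:ℝ) 1)
    (hhold : ∀ j j' : ℕ → Fin d, ∀ p : ℕ, (∀ t < p, j t = j' t) → j p ≠ j' p →
      ∀ m, |S j m - S j' m| ≤ K * γ ^ p) :
    ∃ ε' ∈ Set.Ioc (0:ℝ) 1, ∃ g : Fin d → ℝ → ℝ,
      IsCantorSystem 1 ε' g ∧ HasScalingFunction g S := by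
  have hS : ∀ (j j' : ℕ → Fin d) (n : ℕ), (∀ t < n, j t = j' t) →
      ∀ m, |S j m - S j' m| ≤ K * γ ^ n :=
    fun j j' n h m => abs_sub_le_of_agree hK hγ hhold h m
  obtain ⟨l, hl, hlS⟩ := exists_uniform_lower_bound hd hSsimp fun m =>
    continuous_of_agree hγ fun j j' n h => hS j j' n h m
  have hγ1 : 0 < 1 - γ := by linarith [hγ.2]
  have hlim : Tendsto (fun n : ℕ => K / l / (1 - γ) * γ ^ n) atTop (nhds 0) := by
    simpa using (tendsto_pow_atTop_nhds_zero_of_lt_one hγ.1.le hγ.2).const_mul (K / l / (1 - γ))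
  obtain ⟨N, hBN, hN⟩ :=
    ((hlim.eventually (gt_mem_nhds (half_pos hl))).and (eventually_gt_atTop 0)).exists
  have hT := isScalingTree_truncTree (a := ⟨0, by omega⟩) hd hN hSsimp hl hlS hK hγ hS
    (by positivity) (div_mul_cancel₀ (K / l) hγ1.ne') hBN.le
  obtain ⟨ε, hε, g, hg, hgT⟩ := hT.exists_cantorSystem
  refine ⟨ε, hε, g, hg, fun j => ?_⟩
  simp only [hT.scalingData_eq hgT]
  exact tendsto_pi_nhds.2 fun m => tendsto_truncTree_dword hγ hS j m
end

section
/- (Main Theorem, necessity.) Let k ≥ 1, d ≥ 2 be integers with k < 2d and ε ∈ (0,1]. Let g_1,…,g_d be a C^{k+ε} Cantor system on [0,1] with scaling function S. Then there exists C > 0 such that for all j ≠ j' in Σ_d^dual and every j₀ ∈ {1,…,d}, the intersection D^k_var(C·ρ_S(j₀·j, j₀·j')^{k+ε−1})(A(j₀·j), A(j₀·j')) ∩ R_{j₀}( D^k_var(C·ρ_S(j,j')^{k+ε−1})(A(j), A(j')) ) is nonempty; that is, there exists ψ ∈ D^k_var(C·ρ_S(j,j')^{k+ε−1})(A(j), A(j'))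 with R_{j₀}ψ ∈ D^k_var(C·ρ_S(j₀·j, j₀·j')^{k+ε−1})(A(j₀·j), A(j₀·j')). -/
open Set Filter

/-- A quantitative `C^{r+ε}` bound on `[0,1]`: `f` and its first `r` derivatives are bounded
by `K`, and the `r`-th derivative is `ε`-Hölder with constant `K`. -/
def HolderBd (ε : ℝ) : ℕ → ℝ → (ℝ → ℝ) → Prop
  | 0, K, f => (∀ x ∈ I01, |f x| ≤ K) ∧ HolderBoundOn01 ε K f
  | r + 1, K, f => (∀ x ∈ I01, |f x| ≤ K) ∧
      ∃ f' : ℝ → ℝ, (∀ x ∈ I01, HasDerivWithinAt f (f' x) I01 x) ∧ HolderBd ε r K f'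

lemma uniqueDiffOn_I01 : UniqueDiffOn ℝ I01 := uniqueDiffOn_Icc zero_lt_one

lemma abs_sub_le_one_of_mem_I01 {x y : ℝ} (hx : x ∈ I01) (hy : y ∈ I01) : |x - y| ≤ 1 := by
  rw [abs_le]; constructor <;> linarith [hx.1, hx.2, hy.1, hy.2]

lemma abs_sub_le_rpow {ε x y : ℝ} (hε : ε ∈ Set.Ioc (0:ℝ) 1) (hx : x ∈ I01) (hy : y ∈ I01) :
    |x - y| ≤ |x - y| ^ ε := by
  simpa using Real.rpow_le_rpow_of_exponent_ge_of_imp (abs_nonneg (x - y))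
    (abs_sub_le_one_of_mem_I01 hx hy) hε.2 (fun _ h => absurd h one_ne_zero)

lemma tendsto_mul_abs_sub_rpow {ε : ℝ} (hε : ε ∈ Set.Ioc (0:ℝ) 1) (K x : ℝ) :
    Tendsto (fun y => K * |y - x| ^ ε) (nhdsWithin x I01) (nhds 0) := by
  have : Continuous fun y : ℝ => K * |y - x| ^ ε :=
    continuous_const.mul (((continuous_id.sub continuous_const).abs).rpow_const
      (fun _ => Or.inr hε.1.le))
  have h := this.tendsto x
  simp only [sub_self, abs_zero, Real.zero_rpow hε.1.ne', mul_zero] at h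
  exact h.mono_left nhdsWithin_le_nhds

lemma lipschitz_of_abs_deriv_le {K : ℝ} {f f' : ℝ → ℝ}
    (hf : ∀ x ∈ I01, HasDerivWithinAt f (f' x) I01 x) (hK : ∀ x ∈ I01, |f' x| ≤ K) :
    ∀ x ∈ I01, ∀ y ∈ I01, |f x - f y| ≤ K * |x - y| := by
  intro x hx y hy
  simpa using (convex_Icc (0:ℝ) 1).norm_image_sub_le_of_norm_hasDerivWithin_le hf hK hy hx

namespace HolderBd

variable {ε : ℝ}

lemma bound {r : ℕ} {K : ℝ} {f : ℝ → ℝ} (h : HolderBd ε r K f) : ∀ x ∈ I01, |f x| ≤ K := by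
  cases r <;> exact h.1

lemma nonneg {r : ℕ} {K : ℝ} {f : ℝ → ℝ} (h : HolderBd ε r K f) : 0 ≤ K :=
  (abs_nonneg _).trans (h.bound 0 (by simp))

lemma mono {r : ℕ} {K L : ℝ} {f : ℝ → ℝ} (h : HolderBd ε r K f) (hKL : K ≤ L) :
    HolderBd ε r L f := by
  induction r generalizing f with
  | zero =>
    refine ⟨fun x hx => (h.1 x hx).trans hKL, fun x hx y hy => (h.2 x hx y hy).trans ?_⟩
    gcongr
  | succ r ih =>
    obtain ⟨h1, f', h2, h3⟩ := h
    exact ⟨fun x hx => (h1 x hx).trans hKL, f', h2, ih h3⟩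

lemma congr {r : ℕ} {K : ℝ} {f g : ℝ → ℝ} (h : HolderBd ε r K f) (hfg : ∀ x ∈ I01, g x = f x) :
    HolderBd ε r K g := by
  cases r with
  | zero =>
    refine ⟨fun x hx => by rw [hfg x hx]; exact h.1 x hx, fun x hx y hy => ?_⟩
    rw [hfg x hx, hfg y hy]; exact h.2 x hx y hy
  | succ r =>
    obtain ⟨h1, f', h2, h3⟩ := h
    exact ⟨fun x hx => by rw [hfg x hx]; exact h1 x hx, f',
      fun x hx => (h2 x hx).congr hfg (hfg x hx), h3⟩

lemma lipschitz {r : ℕ} {K : ℝ} {f : ℝ → ℝ} (h : HolderBd ε (r + 1) K f) :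
    ∀ x ∈ I01, ∀ y ∈ I01, |f x - f y| ≤ K * |x - y| := by
  obtain ⟨-, f', h2, h3⟩ := h
  exact lipschitz_of_abs_deriv_le h2 h3.bound

lemma holder (hε : ε ∈ Set.Ioc (0:ℝ) 1) {r : ℕ} {K : ℝ} {f : ℝ → ℝ} (h : HolderBd ε r K f) :
    HolderBoundOn01 ε K f := by
  cases r with
  | zero => exact h.2
  | succ r =>
    intro x hx y hy
    exact (h.lipschitz x hx y hy).trans
      (mul_le_mul_of_nonneg_left (abs_sub_le_rpow hε hx hy) h.nonneg)

lemma pred (hε : ε ∈ Set.Ioc (0:ℝ) 1) {r : ℕ} {K : ℝ} {f : ℝ → ℝ} (h : HolderBd ε (r + 1) K f) :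
    HolderBd ε r K f := by
  induction r generalizing f with
  | zero => exact ⟨h.1, h.holder hε⟩
  | succ r ih =>
    obtain ⟨h1, f', h2, h3⟩ := h
    exact ⟨h1, f', h2, ih h3⟩

lemma of_le (hε : ε ∈ Set.Ioc (0:ℝ) 1) {r s : ℕ} (hrs : r ≤ s) {K : ℝ} {f : ℝ → ℝ}
    (h : HolderBd ε s K f) : HolderBd ε r K f := by
  induction s, hrs using Nat.le_induction with
  | base => exact h
  | succ s _ ih => exact ih (h.pred hε)

lemma continuousOn (hε : ε ∈ Set.Ioc (0:ℝ) 1) {r : ℕ} {K : ℝ} {f : ℝ → ℝ}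
    (h : HolderBd ε r K f) : ContinuousOn f I01 := by
  intro x hx
  rw [ContinuousWithinAt, tendsto_iff_norm_sub_tendsto_zero]
  refine squeeze_zero' (.of_forall fun _ => norm_nonneg _) ?_
    (tendsto_mul_abs_sub_rpow hε K x)
  filter_upwards [self_mem_nhdsWithin] with y hy
  exact h.holder hε y hy x hx

lemma add {r : ℕ} {K L : ℝ} {f g : ℝ → ℝ} (hf : HolderBd ε r K f) (hg : HolderBd ε r L g) :
    HolderBd ε r (K + L) (fun x => f x + g x) := by
  have key : ∀ x ∈ I01, |f x + g x| ≤ K + L := fun x hx =>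
    (abs_add_le _ _).trans (add_le_add (hf.bound x hx) (hg.bound x hx))
  induction r generalizing f g with
  | zero =>
    refine ⟨key, fun x hx y hy => ?_⟩
    calc |f x + g x - (f y + g y)| = |(f x - f y) + (g x - g y)| := by ring_nf
      _ ≤ _ := (abs_add_le _ _).trans (add_le_add (hf.2 x hx y hy) (hg.2 x hx y hy))
      _ = _ := by ring
  | succ r ih =>
    obtain ⟨-, f', hf2, hf3⟩ := hf
    obtain ⟨-, g', hg2, hg3⟩ := hg
    exact ⟨key, _, fun x hx => (hf2 x hx).add (hg2 x hx), ih hf3 hg3 fun x hx =>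
      (abs_add_le _ _).trans (add_le_add (hf3.bound x hx) (hg3.bound x hx))⟩

lemma const_mul {r : ℕ} {K : ℝ} {f : ℝ → ℝ} (hf : HolderBd ε r K f) (c : ℝ) :
    HolderBd ε r (|c| * K) (fun x => c * f x) := by
  induction r generalizing f with
  | zero =>
    refine ⟨fun x hx => ?_, fun x hx y hy => ?_⟩
    · rw [abs_mul]; exact mul_le_mul_of_nonneg_left (hf.1 x hx) (abs_nonneg c)
    · rw [← mul_sub, abs_mul, mul_assoc]
      exact mul_le_mul_of_nonneg_left (hf.2 x hx y hy) (abs_nonneg c)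
  | succ r ih =>
    obtain ⟨hf1, f', hf2, hf3⟩ := hf
    refine ⟨fun x hx => ?_, _, fun x hx => (hf2 x hx).const_mul c, ih hf3⟩
    rw [abs_mul]; exact mul_le_mul_of_nonneg_left (hf1 x hx) (abs_nonneg c)

lemma zero (r : ℕ) : HolderBd ε r 0 (fun _ => 0) := by
  induction r with
  | zero => exact ⟨by simp, by intro x _ y _; simp⟩
  | succ r ih => exact ⟨by simp, _, fun x _ => hasDerivWithinAt_const x _ 0, ih⟩

lemma sum {r : ℕ} {ι : Type*} (s : Finset ι) {K : ι → ℝ} {f : ι → ℝ → ℝ}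
    (h : ∀ i ∈ s, HolderBd ε r (K i) (f i)) :
    HolderBd ε r (∑ i ∈ s, K i) (fun x => ∑ i ∈ s, f i x) := by
  classical
  induction s using Finset.induction_on with
  | empty => simpa using zero r
  | insert a s ha ih =>
    simp only [Finset.sum_insert ha]
    exact (h a (by simp)).add (ih fun i hi => h i (by simp [hi]))

lemma mul (hε : ε ∈ Set.Ioc (0:ℝ) 1) {r : ℕ} {K L : ℝ} {f g : ℝ → ℝ}
    (hf : HolderBd ε r K f) (hg : HolderBd ε r L g) :
    HolderBd ε r (2 ^ (r + 1) * (K * L)) (fun x => f x * g x) := by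
  have hKL : 0 ≤ K * L := mul_nonneg hf.nonneg hg.nonneg
  have key : ∀ x ∈ I01, |f x * g x| ≤ K * L := fun x hx => by
    rw [abs_mul]; exact mul_le_mul (hf.bound x hx) (hg.bound x hx) (abs_nonneg _) hf.nonneg
  have key' : ∀ x ∈ I01, |f x * g x| ≤ 2 ^ (r + 1) * (K * L) := fun x hx =>
    (key x hx).trans (le_mul_of_one_le_left hKL (one_le_pow₀ one_le_two))
  induction r generalizing f g with
  | zero =>
    refine ⟨key', fun x hx y hy => ?_⟩
    calc |f x * g x - f y * g y| = |f x * (g x - g y) + (f x - f y) * g y| := by ring_nf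
      _ ≤ |f x| * |g x - g y| + |f x - f y| * |g y| := by
        rw [← abs_mul, ← abs_mul]; exact abs_add_le _ _
      _ ≤ K * (L * |x - y| ^ ε) + (K * |x - y| ^ ε) * L :=
        add_le_add
          (mul_le_mul (hf.1 x hx) (hg.2 x hx y hy) (abs_nonneg _) hf.nonneg)
          (mul_le_mul (hf.2 x hx y hy) (hg.1 y hy) (abs_nonneg _)
            (mul_nonneg hf.nonneg (by positivity)))
      _ = _ := by ring
  | succ r ih =>
    have hfp := hf.pred hε
    have hgp := hg.pred hε
    obtain ⟨-, f', hf2, hf3⟩ := hf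
    obtain ⟨-, g', hg2, hg3⟩ := hg
    have aux : ∀ {u v : ℝ → ℝ}, HolderBd ε r K u → HolderBd ε r L v →
        HolderBd ε r (2 ^ (r + 1) * (K * L)) (fun x => u x * v x) := by
      intro u v hu hv
      have k1 : ∀ x ∈ I01, |u x * v x| ≤ K * L := fun x hx => by
        rw [abs_mul]; exact mul_le_mul (hu.bound x hx) (hv.bound x hx) (abs_nonneg _) hu.nonneg
      exact ih hu hv k1 fun x hx =>
        (k1 x hx).trans (le_mul_of_one_le_left hKL (one_le_pow₀ one_le_two))
    refine ⟨key', _, fun x hx => (hf2 x hx).mul (hg2 x hx), ?_⟩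
    exact ((aux hf3 hgp).add (aux hfp hg3)).mono (le_of_eq (by ring))

lemma comp (hε : ε ∈ Set.Ioc (0:ℝ) 1) (r : ℕ) (K L : ℝ) :
    ∃ C, ∀ f F : ℝ → ℝ, HolderBd ε r K f → HolderBd ε r L F → MapsTo F I01 I01 →
      (∀ x ∈ I01, ∀ y ∈ I01, |F x - F y| ≤ L * |x - y|) →
      HolderBd ε r C (fun x => f (F x)) := by
  induction r with
  | zero =>
    refine ⟨max K (K * L ^ ε), fun f F hf hF hm hL => ⟨fun x hx => ?_, fun x hx y hy => ?_⟩⟩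
    · exact (hf.1 _ (hm hx)).trans (le_max_left _ _)
    · calc |f (F x) - f (F y)| ≤ K * |F x - F y| ^ ε := hf.2 _ (hm hx) _ (hm hy)
        _ ≤ K * (L * |x - y|) ^ ε := by
          have := hf.nonneg
          gcongr
          · exact hε.1.le
          · exact hL x hx y hy
        _ = K * L ^ ε * |x - y| ^ ε := by
          rw [Real.mul_rpow hF.nonneg (abs_nonneg _), mul_assoc]
        _ ≤ _ := by gcongr; exact le_max_right _ _
  | succ r ih =>
    obtain ⟨C, hC⟩ := ih
    refine ⟨max K (2 ^ (r + 1) * (C * L)), fun f F hf hF hm hL => ?_⟩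
    have hFp := hF.pred hε
    obtain ⟨hf1, f', hf2, hf3⟩ := hf
    obtain ⟨hF1, F', hF2, hF3⟩ := hF
    refine ⟨fun x hx => (hf1 _ (hm hx)).trans (le_max_left _ _), fun x => f' (F x) * F' x,
      fun x hx => (hf2 _ (hm hx)).comp x (hF2 x hx) hm, ?_⟩
    exact ((hC f' F hf3 hFp hm hL).mul hε hF3).mono (le_max_right _ _)

lemma inv (hε : ε ∈ Set.Ioc (0:ℝ) 1) (r : ℕ) (K : ℝ) {c : ℝ} (hc : 0 < c) :
    ∃ C, ∀ f : ℝ → ℝ, HolderBd ε r K f → (∀ x ∈ I01, c ≤ f x) →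
      HolderBd ε r C (fun x => (f x)⁻¹) := by
  have hinv : ∀ f : ℝ → ℝ, (∀ x ∈ I01, c ≤ f x) → ∀ x ∈ I01, |(f x)⁻¹| ≤ c⁻¹ := by
    intro f hf x hx
    have := hf x hx
    rw [abs_of_pos (inv_pos.2 (hc.trans_le this))]
    gcongr
  induction r with
  | zero =>
    refine ⟨max c⁻¹ (K * (c⁻¹ * c⁻¹)), fun f hf hcf =>
      ⟨fun x hx => (hinv f hcf x hx).trans (le_max_left _ _), fun x hx y hy => ?_⟩⟩
    have hx0 : f x ≠ 0 := (hc.trans_le (hcf x hx)).ne'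
    have hy0 : f y ≠ 0 := (hc.trans_le (hcf y hy)).ne'
    calc |(f x)⁻¹ - (f y)⁻¹| = |(f y - f x) * ((f x)⁻¹ * (f y)⁻¹)| := by
          congr 1; field_simp
      _ = |f x - f y| * (|(f x)⁻¹| * |(f y)⁻¹|) := by
          rw [abs_mul, abs_mul, abs_sub_comm]
      _ ≤ (K * |x - y| ^ ε) * (c⁻¹ * c⁻¹) := by
          have := hf.nonneg
          have := hinv f hcf x hx
          have := hinv f hcf y hy
          have := hf.2 x hx y hy
          gcongr
      _ = K * (c⁻¹ * c⁻¹) * |x - y| ^ ε := by ring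
      _ ≤ _ := by gcongr; exact le_max_right _ _
  | succ r ih =>
    obtain ⟨C, hC⟩ := ih
    refine ⟨max c⁻¹ (2 ^ (r + 1) * (|(-1)| * K * (2 ^ (r + 1) * (C * C)))), fun f hf hcf => ?_⟩
    have h1 := hC f (hf.pred hε) hcf
    obtain ⟨-, f', hf2, hf3⟩ := hf
    refine ⟨fun x hx => (hinv f hcf x hx).trans (le_max_left _ _), _, fun x hx => ?_,
      ((hf3.const_mul (-1)).mul hε (h1.mul hε h1)).mono (le_max_right _ _)⟩
    have hx0 : f x ≠ 0 := (hc.trans_le (hcf x hx)).ne'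
    exact ((hf2 x hx).fun_inv hx0).congr_deriv (by ring)

lemma log (hε : ε ∈ Set.Ioc (0:ℝ) 1) (r : ℕ) (K : ℝ) {c : ℝ} (hc : 0 < c) :
    ∃ C, ∀ f : ℝ → ℝ, HolderBd ε r K f → (∀ x ∈ I01, c ≤ f x) →
      HolderBd ε r C (fun x => Real.log (f x)) := by
  have hlog : ∀ f : ℝ → ℝ, HolderBd ε r K f → (∀ x ∈ I01, c ≤ f x) →
      ∀ x ∈ I01, |Real.log (f x)| ≤ |Real.log c| + |Real.log K| := by
    intro f hfK hf x hx
    have h1 := Real.log_le_log hc (hf x hx)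
    have h2 := Real.log_le_log (hc.trans_le (hf x hx)) ((le_abs_self _).trans (hfK.bound x hx))
    rw [abs_le]
    constructor <;> linarith [neg_abs_le (Real.log c), le_abs_self (Real.log K),
      abs_nonneg (Real.log c), abs_nonneg (Real.log K)]
  cases r with
  | zero =>
    refine ⟨max (|Real.log c| + |Real.log K|) (c⁻¹ * K), fun f hf hcf =>
      ⟨fun x hx => (hlog f hf hcf x hx).trans (le_max_left _ _), fun x hx y hy => ?_⟩⟩
    have hlip : ∀ a b : ℝ, c ≤ a → c ≤ b → Real.log a - Real.log b ≤ c⁻¹ * |a - b| := by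
      intro a b ha hb
      have ha0 := hc.trans_le ha
      have hb0 := hc.trans_le hb
      rw [← Real.log_div ha0.ne' hb0.ne']
      have h1 := Real.log_le_sub_one_of_pos (div_pos ha0 hb0)
      have h2 : a / b - 1 = b⁻¹ * (a - b) := by field_simp
      rw [h2] at h1
      refine h1.trans ?_
      calc b⁻¹ * (a - b) ≤ b⁻¹ * |a - b| := by gcongr; exact le_abs_self _
        _ ≤ _ := by gcongr
    have : |Real.log (f x) - Real.log (f y)| ≤ c⁻¹ * |f x - f y| := by
      rw [abs_sub_le_iff]
      refine ⟨hlip _ _ (hcf x hx) (hcf y hy), ?_⟩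
      rw [abs_sub_comm]; exact hlip _ _ (hcf y hy) (hcf x hx)
    calc _ ≤ c⁻¹ * |f x - f y| := this
      _ ≤ c⁻¹ * (K * |x - y| ^ ε) := by gcongr; exact hf.2 x hx y hy
      _ = c⁻¹ * K * |x - y| ^ ε := by ring
      _ ≤ _ := by gcongr; exact le_max_right _ _
  | succ r =>
    obtain ⟨C, hC⟩ := inv hε r K hc
    refine ⟨max (|Real.log c| + |Real.log K|) (2 ^ (r + 1) * (K * C)), fun f hf hcf => ?_⟩
    have h1 := hC f (hf.pred hε) hcf
    have h0 := hlog f hf hcf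
    obtain ⟨-, f', hf2, hf3⟩ := hf
    refine ⟨fun x hx => (h0 x hx).trans (le_max_left _ _), _, fun x hx => ?_,
      (hf3.mul hε h1).mono (le_max_right _ _)⟩
    have hx0 : f x ≠ 0 := (hc.trans_le (hcf x hx)).ne'
    simpa only [div_eq_mul_inv] using (hf2 x hx).log hx0

/-- Pointwise limits preserve `C^{r+ε}` bounds. -/
lemma of_tendsto (hε : ε ∈ Set.Ioc (0:ℝ) 1) {ι : Type*} {l : Filter ι} [l.NeBot] {r : ℕ} {K : ℝ}
    {f : ι → ℝ → ℝ} {F : ℝ → ℝ} (hf : ∀ i, HolderBd ε r K (f i))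
    (hF : ∀ x ∈ I01, Tendsto (fun i => f i x) l (nhds (F x))) : HolderBd ε r K F := by
  induction r generalizing f F l with
  | zero =>
    refine ⟨fun x hx => le_of_tendsto (hF x hx).abs (.of_forall fun i => (hf i).1 x hx),
      fun x hx y hy => le_of_tendsto ((hF x hx).sub (hF y hy)).abs
        (.of_forall fun i => (hf i).2 x hx y hy)⟩
  | succ r ih =>
    have hb : ∀ x ∈ I01, |F x| ≤ K := fun x hx =>
      le_of_tendsto (hF x hx).abs (.of_forall fun i => (hf i).1 x hx)
    choose f' hf2 hf3 using fun i => (hf i).2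
    have hK : 0 ≤ K := by obtain ⟨i⟩ := l.nonempty_of_neBot; exact (hf i).nonneg
    -- first order Taylor estimate
    have taylor : ∀ i, ∀ x ∈ I01, ∀ y ∈ I01,
        |f i y - f i x - f' i x * (y - x)| ≤ K * |y - x| ^ ε * |y - x| := by
      intro i x hx y hy
      have hsub : uIcc x y ⊆ I01 := uIcc_subset_Icc hx hy
      have h := (convex_uIcc x y).norm_image_sub_le_of_norm_hasDerivWithin_le
        (f := fun z => f i z - f' i x * z) (f' := fun z => f' i z - f' i x)
        (C := K * |y - x| ^ ε) (x := x) (y := y)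
        (fun z hz => by
          simpa using
            ((hf2 i z (hsub hz)).mono hsub).fun_sub ((hasDerivWithinAt_id z _).const_mul (f' i x)))
        (fun z hz => by
          refine ((hf3 i).holder hε z (hsub hz) x hx).trans ?_
          exact mul_le_mul_of_nonneg_left (Real.rpow_le_rpow (abs_nonneg _)
            (abs_sub_left_of_mem_uIcc hz) hε.1.le) hK)
        left_mem_uIcc right_mem_uIcc
      simp only [Real.norm_eq_abs] at h
      convert h using 2
      ring
    -- the derivatives converge along a finer ultrafilter
    let U : Ultrafilter ι := Ultrafilter.of l
    have hUl : (U : Filter ι) ≤ l := Ultrafilter.of_le l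
    have hlim : ∀ x ∈ I01, ∃ a, Tendsto (fun i => f' i x) U (nhds a) := by
      intro x hx
      obtain ⟨a, -, ha⟩ := (isCompact_Icc (a := -K) (b := K)).ultrafilter_le_nhds
        (U.map (fun i => f' i x)) (by
          rw [le_principal_iff]
          exact Filter.mem_map.2 (univ_mem' fun i => abs_le.1 ((hf3 i).bound x hx)))
      exact ⟨a, ha⟩
    choose! F' hF' using hlim
    refine ⟨hb, F', fun x hx => ?_, ih (l := (U : Filter ι)) hf3 hF'⟩
    have hT : ∀ y ∈ I01, |F y - F x - F' x * (y - x)| ≤ K * |y - x| ^ ε * |y - x| := fun y hy =>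
      le_of_tendsto ((((hF y hy).mono_left hUl).sub ((hF x hx).mono_left hUl)).sub
        ((hF' x hx).mul_const _)).abs (.of_forall fun i => taylor i x hx y hy)
    rw [hasDerivWithinAt_iff_isLittleO, Asymptotics.isLittleO_iff]
    intro c hc
    filter_upwards [self_mem_nhdsWithin,
      (tendsto_mul_abs_sub_rpow hε K x).eventually (gt_mem_nhds hc)] with y hy hyc
    rw [smul_eq_mul, mul_comm (y - x), Real.norm_eq_abs, Real.norm_eq_abs]
    refine (hT y hy).trans ?_
    gcongr

lemma contDiffOn (hε : ε ∈ Set.Ioc (0:ℝ) 1) {r : ℕ} {K : ℝ} {f : ℝ → ℝ} (h : HolderBd ε r K f) :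
    ContDiffOn ℝ r f I01 := by
  induction r generalizing f with
  | zero => exact contDiffOn_zero.2 (h.continuousOn hε)
  | succ r ih =>
    obtain ⟨-, f', h2, h3⟩ := h
    push_cast
    rw [contDiffOn_succ_iff_derivWithin uniqueDiffOn_I01]
    refine ⟨fun x hx => (h2 x hx).differentiableWithinAt, by simp, (ih h3).congr fun x hx => ?_⟩
    exact (h2 x hx).derivWithin (uniqueDiffOn_I01 x hx)

lemma of_contDiffOn {r : ℕ} {H : ℝ} {f : ℝ → ℝ} (hf : ContDiffOn ℝ r f I01)
    (hH : HolderBoundOn01 ε H (iteratedDerivWithin r f I01)) : ∃ K, HolderBd ε r K f := by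
  obtain ⟨B, hB⟩ := isCompact_Icc.exists_bound_of_continuousOn hf.continuousOn
  induction r generalizing f B with
  | zero =>
    rw [iteratedDerivWithin_zero] at hH
    refine ⟨max B H, fun x hx => (hB x hx).trans (le_max_left _ _), fun x hx y hy =>
      (hH x hx y hy).trans ?_⟩
    gcongr
    exact le_max_right _ _
  | succ r ih =>
    push_cast at hf
    rw [contDiffOn_succ_iff_derivWithin uniqueDiffOn_I01] at hf
    obtain ⟨h1, -, h2⟩ := hf
    obtain ⟨B', hB'⟩ := isCompact_Icc.exists_bound_of_continuousOn h2.continuousOn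
    obtain ⟨K, hK⟩ := ih h2 (by
      intro x hx y hy
      simp only [← iteratedDerivWithin_succ']
      exact hH x hx y hy) B' hB'
    exact ⟨max B K, fun x hx => (hB x hx).trans (le_max_left _ _), _,
      fun x hx => (h1 x hx).hasDerivWithinAt, hK.mono (le_max_right _ _)⟩

lemma iteratedDerivWithin_affine_le (hε : ε ∈ Set.Ioc (0:ℝ) 1) {r : ℕ} {K : ℝ} {f : ℝ → ℝ}
    (h : HolderBd ε r K f) {α ℓ : ℝ} (hℓ : 0 ≤ ℓ) (hm : MapsTo (fun x => α + ℓ * x) I01 I01)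
    (c e : ℝ) : ∀ x ∈ I01, ∀ y ∈ I01,
      |iteratedDerivWithin r (fun x => e + c * f (α + ℓ * x)) I01 x -
        iteratedDerivWithin r (fun x => e + c * f (α + ℓ * x)) I01 y| ≤
      |c| * K * ℓ ^ r * ℓ ^ ε := by
  intro x hx y hy
  induction r generalizing f c e with
  | zero =>
    simp only [iteratedDerivWithin_zero, pow_zero, mul_one]
    have h1 : |α + ℓ * x - (α + ℓ * y)| ≤ ℓ := by
      rw [show α + ℓ * x - (α + ℓ * y) = ℓ * (x - y) by ring, abs_mul, abs_of_nonneg hℓ]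
      exact mul_le_of_le_one_right hℓ (abs_sub_le_one_of_mem_I01 hx hy)
    have hK := h.nonneg
    calc _ = |c| * |f (α + ℓ * x) - f (α + ℓ * y)| := by rw [← abs_mul]; ring_nf
      _ ≤ |c| * (K * |α + ℓ * x - (α + ℓ * y)| ^ ε) := by
        gcongr; exact h.2 _ (hm hx) _ (hm hy)
      _ ≤ |c| * (K * ℓ ^ ε) := by
        gcongr
        exact hε.1.le
      _ = _ := by ring
  | succ r ih =>
    obtain ⟨-, f', h2, h3⟩ := h
    have hd : EqOn (derivWithin (fun x => e + c * f (α + ℓ * x)) I01)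
        (fun x => 0 + (c * ℓ) * f' (α + ℓ * x)) I01 := by
      intro z hz
      have ha : HasDerivWithinAt (fun x => α + ℓ * x) ℓ I01 z := by
        simpa using ((hasDerivWithinAt_id z I01).const_mul ℓ).const_add α
      have := ((((h2 _ (hm hz)).comp z ha hm).const_mul c).const_add e).derivWithin
        (uniqueDiffOn_I01 z hz)
      simp only [Function.comp_def] at this
      rw [this]; ring
    have := ih h3 (c * ℓ) 0
    rw [iteratedDerivWithin_succ', iteratedDerivWithin_congr hd hx, iteratedDerivWithin_congr hd hy]
    refine this.trans (le_of_eq ?_)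
    rw [abs_mul, abs_of_nonneg hℓ]; ring

end HolderBd

lemma exists_slope_eq_deriv {f f' : ℝ → ℝ} (hf : ∀ x ∈ I01, HasDerivWithinAt f (f' x) I01 x)
    {x y : ℝ} (hx : x ∈ I01) (hy : y ∈ I01) (hxy : x < y) :
    ∃ z ∈ I01, f y - f x = f' z * (y - x) := by
  have hsub : Icc x y ⊆ I01 := Icc_subset_Icc hx.1 hy.2
  obtain ⟨z, hz, h⟩ := exists_hasDerivAt_eq_slope f f' hxy
    (fun z hz => (hf z (hsub hz)).continuousWithinAt.mono hsub)
    (fun z hz => (hf z (hsub (Ioo_subset_Icc_self hz))).hasDerivAt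
      (mem_of_superset (Ioo_mem_nhds hz.1 hz.2) (Ioo_subset_Icc_self.trans hsub)))
  refine ⟨z, hsub (Ioo_subset_Icc_self hz), ?_⟩
  rw [h, div_mul_cancel₀ _ (sub_pos.2 hxy).ne']

lemma mul_sub_le_of_le_deriv {c : ℝ} {f f' : ℝ → ℝ}
    (hf : ∀ x ∈ I01, HasDerivWithinAt f (f' x) I01 x) (hc : ∀ x ∈ I01, c ≤ f' x) :
    ∀ x ∈ I01, ∀ y ∈ I01, x ≤ y → c * (y - x) ≤ f y - f x := by
  intro x hx y hy hxy
  rcases hxy.eq_or_lt with rfl | hlt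
  · simp
  obtain ⟨z, hz, h⟩ := exists_slope_eq_deriv hf hx hy hlt
  rw [h]
  exact mul_le_mul_of_nonneg_right (hc z hz) (sub_nonneg.2 hxy)

lemma le_deriv_of_mul_sub_le {c : ℝ} {f f' : ℝ → ℝ}
    (hf : ∀ x ∈ I01, HasDerivWithinAt f (f' x) I01 x)
    (hc : ∀ x ∈ I01, ∀ y ∈ I01, x ≤ y → c * (y - x) ≤ f y - f x) : ∀ x ∈ I01, c ≤ f' x := by
  intro x hx
  have hm : MonotoneOn (fun x => f x - c * x) I01 := fun a ha b hb hab => by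
    have := hc a ha b hb hab
    simp only; linarith
  have h := hm.derivWithin_nonneg (x := x)
  have hd : HasDerivWithinAt (fun x => f x - c * x) (f' x - c) I01 x := by
    simpa using (hf x hx).fun_sub ((hasDerivWithinAt_id x _).const_mul c)
  rw [hd.derivWithin (uniqueDiffOn_I01 x hx)] at h
  linarith

lemma geom_sum_le_inv {μ : ℝ} (h0 : 0 ≤ μ) (h1 : μ < 1) (n : ℕ) :
    ∑ m ∈ Finset.range n, μ ^ m ≤ (1 - μ)⁻¹ := by
  rw [← tsum_geometric_of_lt_one h0 h1]
  exact (summable_geometric_of_lt_one h0 h1).sum_le_tsum _ fun _ _ => by positivity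

section PrefixMaps

variable {d : ℕ}

/-- The shifted sequence `(j_{p+1}, j_{p+2}, …)`. -/
def shiftSeq (j : ℕ → Fin d) (p : ℕ) : ℕ → Fin d := fun m => j (p + m)

/-- The map `G_{j|_n}` of the initial word of length `n` of `j`. -/
def prefixMap (g : Fin d → ℝ → ℝ) (j : ℕ → Fin d) (n : ℕ) : ℝ → ℝ := wordMap g (dword j n)

lemma wordMap_append (g : Fin d → ℝ → ℝ) (v w : List (Fin d)) (x : ℝ) :
    wordMap g (v ++ w) x = wordMap g w (wordMap g v x) := by
  induction v generalizing x with
  | nil => rfl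
  | cons i v ih => exact ih _

lemma dword_succ (j : ℕ → Fin d) (n : ℕ) : dword j (n + 1) = dword j n ++ [j n] := by
  rw [dword, List.ofFn_succ_last]; rfl

lemma dword_consSeq (i : Fin d) (j : ℕ → Fin d) (n : ℕ) :
    dword (consSeq i j) (n + 1) = i :: dword j n := by
  simp [dword, List.ofFn_succ, consSeq]

variable (g : Fin d → ℝ → ℝ)

@[simp] lemma prefixMap_zero (j : ℕ → Fin d) (x : ℝ) : prefixMap g j 0 x = x := by
  simp [prefixMap, dword, wordMap]

lemma prefixMap_succ (j : ℕ → Fin d) (n : ℕ) (x : ℝ) :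
    prefixMap g j (n + 1) x = g (j n) (prefixMap g j n x) := by
  rw [prefixMap, dword_succ, wordMap_append]; rfl

lemma prefixMap_consSeq (i : Fin d) (j : ℕ → Fin d) (n : ℕ) (x : ℝ) :
    prefixMap g (consSeq i j) (n + 1) x = prefixMap g j n (g i x) := by
  rw [prefixMap, dword_consSeq]; rfl

lemma prefixMap_add (j : ℕ → Fin d) (p n : ℕ) (x : ℝ) :
    prefixMap g j (p + n) x = prefixMap g (shiftSeq j p) n (prefixMap g j p x) := by
  induction n with
  | zero => simp
  | succ n ih => rw [← add_assoc, prefixMap_succ, ih, prefixMap_succ]; rfl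

lemma prefixMap_congr {j j' : ℕ → Fin d} {p : ℕ} (h : ∀ t < p, j t = j' t) :
    prefixMap g j p = prefixMap g j' p := by
  have : dword j p = dword j' p := by
    simp only [dword]; congr 1; ext i; rw [h i i.2]
  rw [prefixMap, prefixMap, this]

/-- The length of the interval `G_{j|_n}([0,1])`. -/
def prefixLen (j : ℕ → Fin d) (n : ℕ) : ℝ := prefixMap g j n 1 - prefixMap g j n 0

/-- `G_{j|_n}` followed by the increasing affine bijection of its image onto `[0,1]`. -/
noncomputable def normPrefixMap (j : ℕ → Fin d) (n : ℕ) (x : ℝ) : ℝ :=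
  (prefixMap g j n x - prefixMap g j n 0) / prefixLen g j n

/-- A contracting family of self-maps of `[0,1]` with derivatives `exp ∘ v i`. -/
structure IsExpDeriv (v : Fin d → ℝ → ℝ) (lam : ℝ) : Prop where
  lam_pos : 0 < lam
  lam_lt_one : lam < 1
  maps : ∀ i, MapsTo (g i) I01 I01
  hasDeriv : ∀ i, ∀ x ∈ I01, HasDerivWithinAt (g i) (Real.exp (v i x)) I01 x
  le : ∀ i, ∀ x ∈ I01, Real.exp (v i x) ≤ lam

/-- The logarithm of the derivative of `G_{j|_n}`. -/
def prefixLogDeriv (v : Fin d → ℝ → ℝ) (j : ℕ → Fin d) (n : ℕ) (x : ℝ) : ℝ :=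
  ∑ m ∈ Finset.range n, v (j m) (prefixMap g j m x)

namespace IsExpDeriv

variable {g} {v : Fin d → ℝ → ℝ} {lam ε : ℝ}

lemma mapsTo (h : IsExpDeriv g v lam) (j : ℕ → Fin d) (n : ℕ) :
    MapsTo (prefixMap g j n) I01 I01 := by
  induction n with
  | zero => intro x hx; simpa using hx
  | succ n ih => intro x hx; rw [prefixMap_succ]; exact h.maps _ (ih hx)

lemma hasDeriv_prefixMap (h : IsExpDeriv g v lam) (j : ℕ → Fin d) (n : ℕ) :
    ∀ x ∈ I01, HasDerivWithinAt (prefixMap g j n) (Real.exp (prefixLogDeriv g v j n x)) I01 x := by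
  induction n with
  | zero =>
    intro x hx
    have : prefixMap g j 0 = id := by ext; simp
    simpa [prefixLogDeriv, this] using hasDerivWithinAt_id x I01
  | succ n ih =>
    intro x hx
    have hc := (h.hasDeriv (j n) _ (h.mapsTo j n hx)).comp x (ih x hx) (h.mapsTo j n)
    have he : prefixMap g j (n + 1) = g (j n) ∘ prefixMap g j n := by
      ext y; exact prefixMap_succ g j n y
    rw [he]
    refine hc.congr_deriv ?_
    rw [← Real.exp_add, prefixLogDeriv, prefixLogDeriv, Finset.sum_range_succ, add_comm]

lemma exp_prefixLogDeriv_le (h : IsExpDeriv g v lam) (j : ℕ → Fin d) (n : ℕ) :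
    ∀ x ∈ I01, Real.exp (prefixLogDeriv g v j n x) ≤ lam ^ n := by
  intro x hx
  rw [prefixLogDeriv, Real.exp_sum]
  calc _ ≤ ∏ _m ∈ Finset.range n, lam :=
        Finset.prod_le_prod (fun _ _ => (Real.exp_pos _).le)
          fun m _ => h.le _ _ (h.mapsTo j m hx)
    _ = _ := by simp

lemma lipschitz (h : IsExpDeriv g v lam) (j : ℕ → Fin d) (n : ℕ) :
    ∀ x ∈ I01, ∀ y ∈ I01, |prefixMap g j n x - prefixMap g j n y| ≤ lam ^ n * |x - y| :=
  lipschitz_of_abs_deriv_le (h.hasDeriv_prefixMap j n) fun x hx => by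
    rw [abs_of_pos (Real.exp_pos _)]; exact h.exp_prefixLogDeriv_le j n x hx

lemma prefixMap_lt (h : IsExpDeriv g v lam) (j : ℕ → Fin d) (n : ℕ) {x y : ℝ} (hx : x ∈ I01)
    (hy : y ∈ I01) (hxy : x < y) : prefixMap g j n x < prefixMap g j n y := by
  obtain ⟨z, -, hz⟩ := exists_slope_eq_deriv (h.hasDeriv_prefixMap j n) hx hy hxy
  have := mul_pos (Real.exp_pos (prefixLogDeriv g v j n z)) (sub_pos.2 hxy)
  linarith

lemma prefixLen_pos (h : IsExpDeriv g v lam) (j : ℕ → Fin d) (n : ℕ) : 0 < prefixLen g j n :=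
  sub_pos.2 (h.prefixMap_lt j n (by simp) (by simp) zero_lt_one)

lemma prefixLen_le (h : IsExpDeriv g v lam) (j : ℕ → Fin d) (n : ℕ) :
    prefixLen g j n ≤ lam ^ n := by
  simpa [prefixLen] using (le_abs_self (prefixLen g j n)).trans
    (h.lipschitz j n 1 (by simp) 0 (by simp))

lemma holder_prefixLogDeriv (h : IsExpDeriv g v lam) (hε : ε ∈ Set.Ioc (0:ℝ) 1) {K : ℝ}
    (hv : ∀ i, HolderBd ε 0 K (v i)) (j : ℕ → Fin d) (n : ℕ) :
    HolderBoundOn01 ε (K * (1 - lam ^ ε)⁻¹) (prefixLogDeriv g v j n) := by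
  intro x hx y hy
  have hK : 0 ≤ K := (hv (j 0)).nonneg
  have hl0 : 0 ≤ lam ^ ε := Real.rpow_nonneg h.lam_pos.le _
  have hl1 : lam ^ ε < 1 := Real.rpow_lt_one h.lam_pos.le h.lam_lt_one hε.1
  rw [prefixLogDeriv, prefixLogDeriv, ← Finset.sum_sub_distrib]
  calc _ ≤ ∑ m ∈ Finset.range n, K * |x - y| ^ ε * (lam ^ ε) ^ m := by
        refine (Finset.abs_sum_le_sum_abs _ _).trans (Finset.sum_le_sum fun m _ => ?_)
        refine ((hv (j m)).2 _ (h.mapsTo j m hx) _ (h.mapsTo j m hy)).trans ?_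
        calc _ ≤ K * (lam ^ m * |x - y|) ^ ε := by
              gcongr
              · exact hε.1.le
              · exact h.lipschitz j m x hx y hy
          _ = _ := by
              have := h.lam_pos.le
              rw [Real.mul_rpow (by positivity) (abs_nonneg _), ← Real.rpow_natCast_mul this,
                mul_comm (m : ℝ) ε, Real.rpow_mul_natCast this]
              ring
    _ = K * |x - y| ^ ε * ∑ m ∈ Finset.range n, (lam ^ ε) ^ m := by rw [Finset.mul_sum]
    _ ≤ K * |x - y| ^ ε * (1 - lam ^ ε)⁻¹ := by
        gcongr; exact geom_sum_le_inv hl0 hl1 n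
    _ = _ := by ring

/-- Bounded distortion. -/
lemma distortion (h : IsExpDeriv g v lam) (hε : ε ∈ Set.Ioc (0:ℝ) 1) {K : ℝ}
    (hv : ∀ i, HolderBd ε 0 K (v i)) (j : ℕ → Fin d) (n : ℕ) : ∀ x ∈ I01,
      Real.exp (-(K * (1 - lam ^ ε)⁻¹)) * prefixLen g j n ≤ Real.exp (prefixLogDeriv g v j n x) ∧
      Real.exp (prefixLogDeriv g v j n x) ≤ Real.exp (K * (1 - lam ^ ε)⁻¹) * prefixLen g j n := by
  intro x hx
  obtain ⟨z, hz, hL⟩ := exists_slope_eq_deriv (h.hasDeriv_prefixMap j n)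
    (x := 0) (y := 1) (by simp) (by simp) zero_lt_one
  rw [prefixLen, hL, sub_zero, mul_one, ← Real.exp_add, ← Real.exp_add, Real.exp_le_exp,
    Real.exp_le_exp]
  have hl1 : lam ^ ε < 1 := Real.rpow_lt_one h.lam_pos.le h.lam_lt_one hε.1
  have hK : 0 ≤ K * (1 - lam ^ ε)⁻¹ :=
    mul_nonneg (hv (j 0)).nonneg (inv_nonneg.2 (sub_nonneg.2 hl1.le))
  have h1 := h.holder_prefixLogDeriv hε hv j n x hx z hz
  have h2 : |x - z| ^ ε ≤ 1 :=
    Real.rpow_le_one (abs_nonneg _) (abs_sub_le_one_of_mem_I01 hx hz) hε.1.le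
  have h3 := abs_le.1 (h1.trans (mul_le_of_le_one_right hK h2))
  constructor <;> linarith [h3.1, h3.2]

lemma exists_holderBd_exp_prefixLogDeriv (h : IsExpDeriv g v lam) (hε : ε ∈ Set.Ioc (0:ℝ) 1)
    {r : ℕ} {K : ℝ} (hv : ∀ i, HolderBd ε r K (v i)) :
    ∃ C, 0 ≤ C ∧ ∀ j n, HolderBd ε r (C * prefixLen g j n)
      (fun x => Real.exp (prefixLogDeriv g v j n x)) := by
  set K₁ := K * (1 - lam ^ ε)⁻¹ with hK₁
  induction r with
  | zero =>
    refine ⟨max (Real.exp K₁) (Real.exp K₁ * K₁), (Real.exp_pos _).le.trans (le_max_left _ _),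
      fun j n => ?_⟩
    have hL := h.prefixLen_pos j n
    have hb := fun x hx => (h.distortion hε hv j n x hx).2
    refine ⟨fun x hx => ?_, fun x hx y hy => ?_⟩
    · rw [abs_of_pos (Real.exp_pos _)]
      refine (hb x hx).trans ?_
      gcongr; exact le_max_left _ _
    · have hexp : ∀ a b : ℝ, Real.exp a ≤ Real.exp K₁ * prefixLen g j n →
          Real.exp a - Real.exp b ≤ Real.exp K₁ * prefixLen g j n * |a - b| := by
        intro a b ha
        have h1 : Real.exp a - Real.exp b = Real.exp a * (1 - Real.exp (b - a)) := by
          rw [Real.exp_sub]; field_simp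
        have h2 := Real.add_one_le_exp (b - a)
        rw [h1]
        calc _ ≤ Real.exp a * |a - b| := by
              gcongr; linarith [le_abs_self (a - b)]
          _ ≤ _ := by gcongr
      have habs : |Real.exp (prefixLogDeriv g v j n x) - Real.exp (prefixLogDeriv g v j n y)| ≤
          Real.exp K₁ * prefixLen g j n * |prefixLogDeriv g v j n x - prefixLogDeriv g v j n y| := by
        rw [abs_sub_le_iff]
        refine ⟨hexp _ _ (hb x hx), ?_⟩
        rw [abs_sub_comm]
        exact hexp _ _ (hb y hy)
      calc _ ≤ _ := habs
        _ ≤ Real.exp K₁ * prefixLen g j n * (K₁ * |x - y| ^ ε) := by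
            gcongr; exact h.holder_prefixLogDeriv hε hv j n x hx y hy
        _ = Real.exp K₁ * K₁ * prefixLen g j n * |x - y| ^ ε := by ring
        _ ≤ _ := by gcongr; exact le_max_right _ _
  | succ r ih =>
    obtain ⟨C, hC0, hC⟩ := ih fun i => (hv i).pred hε
    choose v' hv2 hv3 using fun i => (hv i).2
    obtain ⟨C₁, hC₁⟩ := HolderBd.comp hε r K (max 1 C)
    set C₂ := 2 ^ (r + 1) * (max 0 C₁ * C) * (1 - lam)⁻¹ with hC₂
    refine ⟨max (Real.exp K₁) (2 ^ (r + 1) * (C * C₂)),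
      (Real.exp_pos _).le.trans (le_max_left _ _), fun j n => ?_⟩
    have hL := h.prefixLen_pos j n
    have hL1 : ∀ m, prefixLen g j m ≤ 1 := fun m =>
      (h.prefixLen_le j m).trans (pow_le_one₀ h.lam_pos.le h.lam_lt_one.le)
    have hpm : ∀ m, HolderBd ε r (max 1 C) (prefixMap g j m) := fun m => by
      refine HolderBd.pred hε ⟨fun x hx => ?_, _, h.hasDeriv_prefixMap j m, (hC j m).mono ?_⟩
      · have := h.mapsTo j m hx
        rw [abs_of_nonneg this.1]; exact this.2.trans (le_max_left _ _)
      · exact (mul_le_of_le_one_right hC0 (hL1 m)).trans (le_max_right _ _)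
    have hlip : ∀ m, ∀ x ∈ I01, ∀ y ∈ I01,
        |prefixMap g j m x - prefixMap g j m y| ≤ max 1 C * |x - y| := fun m x hx y hy => by
      refine (h.lipschitz j m x hx y hy).trans ?_
      gcongr
      exact (pow_le_one₀ h.lam_pos.le h.lam_lt_one.le).trans (le_max_left _ _)
    have hterm : ∀ m ∈ Finset.range n, HolderBd ε r (2 ^ (r + 1) * (max 0 C₁ * C) * lam ^ m)
        (fun x => v' (j m) (prefixMap g j m x) * Real.exp (prefixLogDeriv g v j m x)) := fun m _ => by
      refine (((hC₁ _ _ (hv3 (j m)) (hpm m) (h.mapsTo j m) (hlip m)).mono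
        (le_max_right 0 C₁)).mul hε (hC j m)).mono ?_
      have := h.prefixLen_le j m
      calc _ = 2 ^ (r + 1) * (max 0 C₁ * C) * prefixLen g j m := by ring
        _ ≤ _ := by gcongr
    have hsum := (HolderBd.sum _ hterm).mono (L := C₂) (by
      rw [← Finset.mul_sum, hC₂]
      gcongr
      exact geom_sum_le_inv h.lam_pos.le h.lam_lt_one n)
    refine ⟨fun x hx => ?_, _, fun x hx => ?_, ((hC j n).mul hε hsum).mono ?_⟩
    · rw [abs_of_pos (Real.exp_pos _)]
      refine (h.distortion hε (fun i => (hv i).of_le hε (Nat.zero_le _)) j n x hx).2.trans ?_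
      gcongr; exact le_max_left _ _
    · exact HasDerivWithinAt.exp (HasDerivWithinAt.fun_sum fun m _ =>
        (hv2 (j m) _ (h.mapsTo j m hx)).comp x (h.hasDeriv_prefixMap j m x hx) (h.mapsTo j m))
    · calc _ = 2 ^ (r + 1) * (C * C₂) * prefixLen g j n := by ring
        _ ≤ _ := by gcongr; exact le_max_right _ _

lemma normPrefixMap_mem (h : IsExpDeriv g v lam) (j : ℕ → Fin d) (n : ℕ) :
    MapsTo (normPrefixMap g j n) I01 I01 := by
  have hmono : ∀ x ∈ I01, ∀ y ∈ I01, x ≤ y → prefixMap g j n x ≤ prefixMap g j n y :=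
    fun x hx y hy hxy => hxy.eq_or_lt.elim (fun e => by rw [e])
      fun hlt => (h.prefixMap_lt j n hx hy hlt).le
  intro x hx
  have h0 := hmono 0 (by simp) x hx hx.1
  have h1 := hmono x hx 1 (by simp) hx.2
  constructor
  · exact div_nonneg (sub_nonneg.2 h0) (h.prefixLen_pos j n).le
  · rw [normPrefixMap, div_le_one (h.prefixLen_pos j n), prefixLen]; linarith

/-- The normalized maps `G_{j|_n}` are uniformly `C^{r+1+ε}` with uniformly positive slopes. -/
lemma exists_holderBd_normPrefixMap (h : IsExpDeriv g v lam) (hε : ε ∈ Set.Ioc (0:ℝ) 1)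
    {r : ℕ} {K : ℝ} (hv : ∀ i, HolderBd ε r K (v i)) :
    ∃ C, ∃ c > 0, ∀ j n, HolderBd ε (r + 1) C (normPrefixMap g j n) ∧
      ∀ x ∈ I01, ∀ y ∈ I01, x ≤ y →
        c * (y - x) ≤ normPrefixMap g j n y - normPrefixMap g j n x := by
  obtain ⟨C, hC0, hC⟩ := h.exists_holderBd_exp_prefixLogDeriv hε hv
  refine ⟨max 1 C, Real.exp (-(K * (1 - lam ^ ε)⁻¹)), Real.exp_pos _, fun j n => ?_⟩
  have hL := h.prefixLen_pos j n
  have hd : ∀ x ∈ I01, HasDerivWithinAt (normPrefixMap g j n)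
      ((prefixLen g j n)⁻¹ * Real.exp (prefixLogDeriv g v j n x)) I01 x := fun x hx =>
    (((h.hasDeriv_prefixMap j n x hx).sub_const _).div_const _).congr_deriv (by
      rw [div_eq_inv_mul])
  refine ⟨⟨fun x hx => ?_, _, hd, ((hC j n).const_mul _).mono ?_⟩,
    mul_sub_le_of_le_deriv hd fun x hx => ?_⟩
  · have := h.normPrefixMap_mem j n hx
    rw [abs_of_nonneg this.1]; exact this.2.trans (le_max_left _ _)
  · rw [abs_of_pos (inv_pos.2 hL), mul_left_comm, inv_mul_cancel₀ hL.ne', mul_one]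
    exact le_max_right _ _
  · have := (h.distortion hε (fun i => (hv i).of_le hε (Nat.zero_le _)) j n x hx).1
    rwa [← div_eq_inv_mul, le_div_iff₀ hL]

end IsExpDeriv

end PrefixMaps

/-- An increasing map of `[0,1]` fixing the endpoints, with a `C^{r+ε}` bound `C` and with
slopes at least `c`. -/
structure IsBoundedDiffeo (ε : ℝ) (r : ℕ) (C c : ℝ) (f : ℝ → ℝ) : Prop where
  holderBd : HolderBd ε r C f
  slope : ∀ x ∈ I01, ∀ y ∈ I01, x ≤ y → c * (y - x) ≤ f y - f x
  map_zero : f 0 = 0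
  map_one : f 1 = 1

lemma strictMonoOn_of_slope {c : ℝ} (hc : 0 < c) {f : ℝ → ℝ}
    (hf : ∀ x ∈ I01, ∀ y ∈ I01, x ≤ y → c * (y - x) ≤ f y - f x) : StrictMonoOn f I01 := by
  intro x hx y hy hxy
  have := hf x hx y hy hxy.le
  have := mul_pos hc (sub_pos.2 hxy)
  linarith

lemma bijOn_I01 {f : ℝ → ℝ} (hf : StrictMonoOn f I01) (hc : ContinuousOn f I01) (h0 : f 0 = 0)
    (h1 : f 1 = 1) : BijOn f I01 I01 := by
  refine ⟨fun x hx => ⟨?_, ?_⟩, hf.injOn, ?_⟩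
  · rw [← h0]; exact hf.monotoneOn (by simp) hx hx.1
  · rw [← h1]; exact hf.monotoneOn hx (by simp) hx.2
  · have := intermediate_value_Icc zero_le_one hc
    rwa [h0, h1] at this

namespace IsBoundedDiffeo

variable {ε : ℝ} {r : ℕ} {C c : ℝ} {f : ℝ → ℝ}

lemma bijOn (h : IsBoundedDiffeo ε r C c f) (hε : ε ∈ Set.Ioc (0:ℝ) 1) (hc : 0 < c) :
    BijOn f I01 I01 :=
  bijOn_I01 (strictMonoOn_of_slope hc h.slope) (h.holderBd.continuousOn hε) h.map_zero h.map_one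

end IsBoundedDiffeo

lemma HasDerivWithinAt.of_left_inverse {f q : ℝ → ℝ} {f' y : ℝ} {s t : Set ℝ}
    (hq : ContinuousWithinAt q s y) (hst : MapsTo q s t) (hf : HasDerivWithinAt f f' t (q y))
    (hf' : f' ≠ 0) (hy : y ∈ s) (hfq : ∀ x ∈ s, f (q x) = x) :
    HasDerivWithinAt q f'⁻¹ s y := by
  have h := HasFDerivWithinAt.of_local_left_inverse (g := q) (f := f) (s := s) (t := t) (a := y)
    (f' := ContinuousLinearEquiv.unitsEquivAut ℝ (Units.mk0 f' hf'))
    (tendsto_nhdsWithin_iff.2 ⟨hq, eventually_mem_nhdsWithin.mono fun x hx => hst hx⟩)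
    (by
      have : (ContinuousLinearEquiv.unitsEquivAut ℝ (Units.mk0 f' hf') : ℝ →L[ℝ] ℝ) =
          ContinuousLinearMap.toSpanSingleton ℝ f' := by ext; simp
      rw [this]; exact hf.hasFDerivWithinAt)
    hy (eventually_mem_nhdsWithin.mono hfq)
  simpa using h.hasDerivWithinAt

lemma exists_holderBd_inverse {ε : ℝ} (hε : ε ∈ Set.Ioc (0:ℝ) 1) (r : ℕ) (C : ℝ) {c : ℝ}
    (hc : 0 < c) : ∃ C', ∀ f q : ℝ → ℝ, HolderBd ε r C f →
      (∀ x ∈ I01, ∀ y ∈ I01, x ≤ y → c * (y - x) ≤ f y - f x) → MapsTo q I01 I01 →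
      (∀ y ∈ I01, f (q y) = y) →
      (∀ x ∈ I01, ∀ y ∈ I01, |q x - q y| ≤ c⁻¹ * |x - y|) → HolderBd ε r C' q := by
  have hb : ∀ q : ℝ → ℝ, MapsTo q I01 I01 → ∀ x ∈ I01, |q x| ≤ 1 := fun q hq x hx => by
    rw [abs_of_nonneg (hq hx).1]; exact (hq hx).2
  induction r with
  | zero =>
    refine ⟨max 1 c⁻¹, fun f q _ _ hq _ hlip => ⟨fun x hx => (hb q hq x hx).trans (le_max_left _ _),
      fun x hx y hy => (hlip x hx y hy).trans ?_⟩⟩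
    calc c⁻¹ * |x - y| ≤ c⁻¹ * |x - y| ^ ε := by gcongr; exact abs_sub_le_rpow hε hx hy
      _ ≤ _ := by gcongr; exact le_max_right _ _
  | succ r ih =>
    obtain ⟨C₁, hC₁⟩ := ih
    obtain ⟨C₂, hC₂⟩ := HolderBd.comp hε r C (max C₁ c⁻¹)
    obtain ⟨C₃, hC₃⟩ := HolderBd.inv hε r C₂ hc
    refine ⟨max 1 C₃, fun f q hf hslope hq hfq hlip => ?_⟩
    have hq1 := hC₁ f q (hf.pred hε) hslope hq hfq hlip
    obtain ⟨-, f', hf2, hf3⟩ := hf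
    have hf' := le_deriv_of_mul_sub_le hf2 hslope
    refine ⟨fun x hx => (hb q hq x hx).trans (le_max_left _ _), fun y => (f' (q y))⁻¹,
      fun y hy => ?_, (hC₃ _ (hC₂ f' q hf3 (hq1.mono (le_max_left _ _)) hq fun x hx y hy => ?_)
        fun x hx => hf' _ (hq hx)).mono (le_max_right _ _)⟩
    · exact HasDerivWithinAt.of_left_inverse (hq1.continuousOn hε y hy) hq (hf2 _ (hq hy))
        (hc.trans_le (hf' _ (hq hy))).ne' hy hfq
    · refine (hlip x hx y hy).trans ?_
      gcongr; exact le_max_right _ _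

/-- Transition maps between diffeomorphisms with uniform bounds have uniform bounds. -/
lemma exists_transition {ε : ℝ} (hε : ε ∈ Set.Ioc (0:ℝ) 1) (r : ℕ) (C : ℝ) {c : ℝ} (hc : 0 < c) :
    ∃ C', ∃ c' > 0, ∀ a b : ℝ → ℝ, IsBoundedDiffeo ε (r + 1) C c a →
      IsBoundedDiffeo ε (r + 1) C c b → ∃ θ : ℝ → ℝ, HolderBd ε (r + 1) C' θ ∧
        (∀ x ∈ I01, ∀ y ∈ I01, x ≤ y → c' * (y - x) ≤ θ y - θ x) ∧
        ∀ x ∈ I01, θ (a x) = b x := by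
  obtain ⟨C₁, hC₁⟩ := exists_holderBd_inverse hε (r + 1) C hc
  obtain ⟨C₂, hC₂⟩ := HolderBd.comp hε (r + 1) C (max C₁ c⁻¹)
  refine ⟨C₂, c * (max 1 C)⁻¹, by positivity, fun a b ha hb => ?_⟩
  have hbij := ha.bijOn hε hc
  have hq : MapsTo (Function.invFunOn a I01) I01 I01 := hbij.surjOn.mapsTo_invFunOn
  have haq : ∀ y ∈ I01, a (Function.invFunOn a I01 y) = y := fun y hy =>
    hbij.invOn_invFunOn.2 hy
  have hqa : ∀ x ∈ I01, Function.invFunOn a I01 (a x) = x := fun x hx =>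
    hbij.invOn_invFunOn.1 hx
  have hmono := strictMonoOn_of_slope hc ha.slope
  set q := Function.invFunOn a I01
  have hqmono : ∀ x ∈ I01, ∀ y ∈ I01, x ≤ y → q x ≤ q y := fun x hx y hy hxy => by
    rw [← hmono.le_iff_le (hq hx) (hq hy), haq x hx, haq y hy]; exact hxy
  have hup : ∀ x ∈ I01, ∀ y ∈ I01, x ≤ y → q y - q x ≤ c⁻¹ * (y - x) := fun x hx y hy hxy => by
    have := ha.slope _ (hq hx) _ (hq hy) (hqmono x hx y hy hxy)
    rw [haq x hx, haq y hy] at this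
    rwa [← div_eq_inv_mul, le_div_iff₀' hc]
  have hlip : ∀ x ∈ I01, ∀ y ∈ I01, |q x - q y| ≤ c⁻¹ * |x - y| := by
    intro x hx y hy
    rcases le_total x y with hxy | hxy
    · rw [abs_sub_comm, abs_sub_comm x y, abs_of_nonneg (sub_nonneg.2 hxy),
        abs_of_nonneg (sub_nonneg.2 (hqmono x hx y hy hxy))]
      exact hup x hx y hy hxy
    · rw [abs_of_nonneg (sub_nonneg.2 hxy), abs_of_nonneg (sub_nonneg.2 (hqmono y hy x hx hxy))]
      exact hup y hy x hx hxy
  refine ⟨fun x => b (q x), hC₂ b q hb.holderBd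
    ((hC₁ a q ha.holderBd ha.slope hq haq hlip).mono (le_max_left _ _)) hq fun x hx y hy =>
      (hlip x hx y hy).trans (by gcongr; exact le_max_right _ _), fun x hx y hy hxy => ?_,
    fun x hx => by simp only [hqa x hx]⟩
  have h1 := hqmono x hx y hy hxy
  have h2 : y - x ≤ max 1 C * (q y - q x) := by
    have := ha.holderBd.lipschitz _ (hq hy) _ (hq hx)
    rw [haq x hx, haq y hy, abs_of_nonneg (sub_nonneg.2 hxy),
      abs_of_nonneg (sub_nonneg.2 h1)] at this
    exact this.trans (mul_le_mul_of_nonneg_right (le_max_right _ _) (sub_nonneg.2 h1))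
  calc c * (max 1 C)⁻¹ * (y - x) = c * ((max 1 C)⁻¹ * (y - x)) := by ring
    _ ≤ c * (q y - q x) := by
      gcongr
      rwa [← div_eq_inv_mul, div_le_iff₀' (by positivity)]
    _ ≤ _ := hb.slope _ (hq hx) _ (hq hy) h1

section Renorm

variable {ε : ℝ} {r : ℕ} {K c α β : ℝ} {θ : ℝ → ℝ}

lemma mapsTo_affine (hα : α ∈ I01) (hβ : β ∈ I01) (hαβ : α < β) :
    MapsTo (fun x => α + (β - α) * x) I01 I01 := by
  intro x hx
  have h1 : 0 ≤ (β - α) * x := mul_nonneg (sub_nonneg.2 hαβ.le) hx.1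
  have h2 : (β - α) * x ≤ β - α := mul_le_of_le_one_right (sub_nonneg.2 hαβ.le) hx.2
  constructor <;> simp only <;> linarith [hα.1, hβ.2]

lemma isDiffeo01_renorm (hε : ε ∈ Set.Ioc (0:ℝ) 1) (hθ : HolderBd ε (r + 1) K θ) (hc : 0 < c)
    (hslope : ∀ x ∈ I01, ∀ y ∈ I01, x ≤ y → c * (y - x) ≤ θ y - θ x)
    (hα : α ∈ I01) (hβ : β ∈ I01) (hαβ : α < β) :
    IsDiffeo01 (r + 1) (renorm α β (θ α) (θ β) θ) := by
  have hm := mapsTo_affine hα hβ hαβ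
  have hθmono := strictMonoOn_of_slope hc hslope
  have hℓ : 0 < θ β - θ α := sub_pos.2 (hθmono hα hβ hαβ)
  have hmono : StrictMonoOn (renorm α β (θ α) (θ β) θ) I01 := fun x hx y hy hxy => by
    have := hθmono (hm hx) (hm hy)
      (add_lt_add_right (mul_lt_mul_of_pos_left hxy (sub_pos.2 hαβ)) α)
    simp only at this
    exact div_lt_div_of_pos_right (by linarith) hℓ
  have hsm : ContDiffOn ℝ ((r + 1 : ℕ) : WithTop ℕ∞) (renorm α β (θ α) (θ β) θ) I01 :=
    (((hθ.contDiffOn hε).comp (by fun_prop : ContDiff ℝ _ fun x => α + (β - α) * x).contDiffOn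
      hm).sub contDiffOn_const).div_const _
  refine ⟨hsm, hmono, fun x hx => ?_, bijOn_I01 hmono hsm.continuousOn (by simp [renorm])
    (by simp [renorm, hℓ.ne'])⟩
  obtain ⟨-, θ', hθ2, -⟩ := hθ
  have ha : HasDerivWithinAt (fun x => α + (β - α) * x) (β - α) I01 x := by
    simpa using ((hasDerivWithinAt_id x I01).const_mul (β - α)).const_add α
  have hd : HasDerivWithinAt (renorm α β (θ α) (θ β) θ)
      (θ' (α + (β - α) * x) * (β - α) / (θ β - θ α)) I01 x :=
    (((hθ2 _ (hm hx)).comp x ha hm).sub_const _).div_const _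
  rw [hd.derivWithin (uniqueDiffOn_I01 x hx)]
  exact div_pos (mul_pos (hc.trans_le (le_deriv_of_mul_sub_le hθ2 hslope _ (hm hx)))
    (sub_pos.2 hαβ)) hℓ

lemma variation_renorm_le (hε : ε ∈ Set.Ioc (0:ℝ) 1) (hθ : HolderBd ε (r + 1) K θ) (hc : 0 < c)
    (hslope : ∀ x ∈ I01, ∀ y ∈ I01, x ≤ y → c * (y - x) ≤ θ y - θ x)
    (hα : α ∈ I01) (hβ : β ∈ I01) (hαβ : α < β) : ∀ x ∈ I01, ∀ y ∈ I01,
    |iteratedDerivWithin (r + 1) (renorm α β (θ α) (θ β) θ) I01 x -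
      iteratedDerivWithin (r + 1) (renorm α β (θ α) (θ β) θ) I01 y| ≤
      K / c * (β - α) ^ (((r + 1 : ℕ) : ℝ) + ε - 1) := by
  intro x hx y hy
  have hℓ0 : 0 < β - α := sub_pos.2 hαβ
  have hℓ : c * (β - α) ≤ θ β - θ α := hslope α hα β hβ hαβ.le
  have hℓpos : 0 < θ β - θ α := (mul_pos hc hℓ0).trans_le hℓ
  have he : renorm α β (θ α) (θ β) θ = fun x => -(θ α) / (θ β - θ α) +
      (θ β - θ α)⁻¹ * θ (α + (β - α) * x) := by
    ext z; rw [renorm]; ring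
  rw [he]
  refine (hθ.iteratedDerivWithin_affine_le hε hℓ0.le (mapsTo_affine hα hβ hαβ) _ _
    x hx y hy).trans ?_
  have hK := hθ.nonneg
  rw [abs_of_pos (inv_pos.2 hℓpos)]
  calc (θ β - θ α)⁻¹ * K * (β - α) ^ (r + 1) * (β - α) ^ ε
      ≤ (c * (β - α))⁻¹ * K * (β - α) ^ (r + 1) * (β - α) ^ ε := by gcongr
    _ = K / c * ((β - α) ^ r * (β - α) ^ ε) := by rw [pow_succ]; field_simp
    _ = _ := by
      rw [← Real.rpow_natCast, ← Real.rpow_add hℓ0]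
      push_cast
      ring_nf

end Renorm

section CantorSystem

variable {d : ℕ} {g : Fin d → ℝ → ℝ}

lemma IsCantorSystem.exists_isExpDeriv [NeZero d] {r : ℕ} {ε : ℝ} (hε : ε ∈ Set.Ioc (0:ℝ) 1)
    (hg : IsCantorSystem (r + 1) ε g) :
    ∃ v : Fin d → ℝ → ℝ, ∃ lam K : ℝ, IsExpDeriv g v lam ∧ ∀ i, HolderBd ε r K (v i) := by
  have hcont : ∀ i, ContinuousOn (derivWithin (g i) I01) I01 := fun i =>
    (hg.smooth i).continuousOn_derivWithin uniqueDiffOn_I01 (by simp)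
  have hne : I01.Nonempty := ⟨0, by simp⟩
  choose xm hxm hmax using fun i => isCompact_Icc.exists_isMaxOn hne (hcont i)
  choose yn hyn hmin using fun i => isCompact_Icc.exists_isMinOn hne (hcont i)
  obtain ⟨i₀, hi₀⟩ := Finite.exists_max fun i => derivWithin (g i) I01 (xm i)
  have hlog : ∀ i, ∃ K, HolderBd ε r K fun x => Real.log (derivWithin (g i) I01 x) := by
    intro i
    obtain ⟨H, -, hH⟩ := hg.holder i
    obtain ⟨K, -, g', h2, h3⟩ := HolderBd.of_contDiffOn (hg.smooth i) hH
    obtain ⟨C, hC⟩ := HolderBd.log hε r K (hg.deriv_pos i _ (hyn i))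
    exact ⟨C, hC _ (h3.congr fun x hx => (h2 x hx).derivWithin (uniqueDiffOn_I01 x hx))
      fun x hx => hmin i hx⟩
  choose K hK using hlog
  obtain ⟨M, hM⟩ := Finite.bddAbove_range K
  have hexp : ∀ i, ∀ x ∈ I01, Real.exp (Real.log (derivWithin (g i) I01 x)) =
      derivWithin (g i) I01 x := fun i x hx => Real.exp_log (hg.deriv_pos i x hx)
  refine ⟨fun i x => Real.log (derivWithin (g i) I01 x), derivWithin (g i₀) I01 (xm i₀), M,
    ⟨hg.deriv_pos _ _ (hxm _), hg.deriv_lt_one _ _ (hxm _), hg.maps, fun i x hx => ?_,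
      fun i x hx => ?_⟩, fun i => (hK i).mono (hM ⟨i, rfl⟩)⟩
  · rw [hexp i x hx]
    exact ((hg.smooth i).differentiableOn (by simp) x hx).hasDerivWithinAt
  · rw [hexp i x hx]
    exact (hmax i hx).trans (hi₀ i)

lemma childLeft_scalingData (hg0 : ∀ i : Fin d, (i : ℕ) = 0 → g i 0 = 0) (j : ℕ → Fin d) (n : ℕ)
    (i : Fin d) : childLeft (scalingData g (dword j n)) i = normPrefixMap g j n (g i 0) := by
  let u : ℕ → ℝ := fun m => if h : m < d then normPrefixMap g j n (g ⟨m, h⟩ 0) else 0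
  have hu0 : u 0 = 0 := by
    have h0 : 0 < d := i.pos
    simp [u, h0, hg0 ⟨0, h0⟩ rfl, normPrefixMap]
  have hterm : ∀ m : {m // m ∈ Finset.range (i : ℕ)},
      scalingData g (dword j n) ⟨(m : ℕ), by have := Finset.mem_range.mp m.2; have := i.isLt; omega⟩
      + scalingData g (dword j n) ⟨d + (m : ℕ), by
          have := Finset.mem_range.mp m.2; have := i.isLt; omega⟩ = u (m + 1) - u m := by
    intro m
    have hm := Finset.mem_range.mp m.2
    have h1 : (m : ℕ) + 1 < d := by have := i.isLt; omega
    have h2 : (m : ℕ) < d := by omega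
    simp only [scalingData, h1, h2, u, dif_pos, normPrefixMap, prefixLen, prefixMap, wordLen,
      wordMap, Nat.add_sub_cancel_left, add_lt_iff_neg_left, not_lt_zero, dif_neg, not_false_iff]
    ring
  rw [childLeft, Finset.sum_congr rfl fun m _ => hterm m,
    Finset.sum_attach (Finset.range i) fun m => u (m + 1) - u m, Finset.sum_range_sub, hu0, sub_zero]
  simp [u]

lemma scalingData_child (j : ℕ → Fin d) (n : ℕ) (i : Fin d) (hi : (i : ℕ) < 2 * d - 1) :
    scalingData g (dword j n) ⟨i, hi⟩ =
      normPrefixMap g j n (g i 1) - normPrefixMap g j n (g i 0) := by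
  simp only [scalingData, i.isLt, dif_pos, normPrefixMap, prefixLen, prefixMap, wordLen, wordMap]
  ring

lemma childRight_scalingData (hg0 : ∀ i : Fin d, (i : ℕ) = 0 → g i 0 = 0) (j : ℕ → Fin d) (n : ℕ)
    (i : Fin d) : childRight (scalingData g (dword j n)) i = normPrefixMap g j n (g i 1) := by
  rw [childRight, childLeft_scalingData hg0, scalingData_child]
  ring

lemma continuous_childLeft (i : Fin d) : Continuous fun s : Fin (2 * d - 1) → ℝ => childLeft s i :=
  continuous_finsetSum _ fun _ _ => (continuous_apply _).add (continuous_apply _)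

lemma continuous_childRight (i : Fin d) :
    Continuous fun s : Fin (2 * d - 1) → ℝ => childRight s i :=
  (continuous_childLeft i).add (continuous_apply _)

variable {S : (ℕ → Fin d) → Fin (2 * d - 1) → ℝ}

lemma HasScalingFunction.tendsto_childLeft (hS : HasScalingFunction g S)
    (hg0 : ∀ i : Fin d, (i : ℕ) = 0 → g i 0 = 0) (j : ℕ → Fin d) (i : Fin d) :
    Tendsto (fun n => normPrefixMap g j n (g i 0)) atTop (nhds (childLeft (S j) i)) := by
  simpa only [Function.comp_def, childLeft_scalingData hg0] using
    ((continuous_childLeft i).tendsto (S j)).comp (hS j)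

lemma HasScalingFunction.tendsto_childRight (hS : HasScalingFunction g S)
    (hg0 : ∀ i : Fin d, (i : ℕ) = 0 → g i 0 = 0) (j : ℕ → Fin d) (i : Fin d) :
    Tendsto (fun n => normPrefixMap g j n (g i 1)) atTop (nhds (childRight (S j) i)) := by
  simpa only [Function.comp_def, childRight_scalingData hg0] using
    ((continuous_childRight i).tendsto (S j)).comp (hS j)

/-- `a` is a limit of the normalized maps `G_{j|_n}` along an ultrafilter. -/
def IsLimitMap (g : Fin d → ℝ → ℝ) (j : ℕ → Fin d) (a : ℝ → ℝ) : Prop :=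
  ∀ x ∈ I01, Tendsto (fun n => normPrefixMap g j n x) (hyperfilter ℕ) (nhds (a x))

section

variable {v : Fin d → ℝ → ℝ} {lam : ℝ}

lemma IsExpDeriv.exists_isLimitMap (h : IsExpDeriv g v lam) (j : ℕ → Fin d) :
    ∃ a, IsLimitMap g j a := by
  have : ∀ x ∈ I01, ∃ y, Tendsto (fun n => normPrefixMap g j n x) (hyperfilter ℕ) (nhds y) := by
    intro x hx
    obtain ⟨y, -, hy⟩ := (isCompact_Icc (a := (0:ℝ)) (b := 1)).ultrafilter_le_nhds
      ((hyperfilter ℕ).map fun n => normPrefixMap g j n x) (by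
        rw [le_principal_iff]
        exact Filter.mem_map.2 (univ_mem' fun n => h.normPrefixMap_mem j n hx))
    exact ⟨y, hy⟩
  choose! a ha using this
  exact ⟨a, ha⟩

lemma IsExpDeriv.normPrefixMap_one (h : IsExpDeriv g v lam) (j : ℕ → Fin d) (n : ℕ) :
    normPrefixMap g j n 1 = 1 := div_self (h.prefixLen_pos j n).ne'

lemma IsLimitMap.isBoundedDiffeo (h : IsExpDeriv g v lam) {ε : ℝ} (hε : ε ∈ Set.Ioc (0:ℝ) 1)
    {r : ℕ} {C c : ℝ} {j : ℕ → Fin d} {a : ℝ → ℝ} (ha : IsLimitMap g j a)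
    (hn : ∀ n, HolderBd ε r C (normPrefixMap g j n) ∧ ∀ x ∈ I01, ∀ y ∈ I01, x ≤ y →
      c * (y - x) ≤ normPrefixMap g j n y - normPrefixMap g j n x) :
    IsBoundedDiffeo ε r C c a := by
  refine ⟨HolderBd.of_tendsto hε (fun n => (hn n).1) ha, fun x hx y hy hxy =>
    ge_of_tendsto ((ha y hy).sub (ha x hx)) (.of_forall fun n => (hn n).2 x hx y hy hxy),
    tendsto_nhds_unique (ha 0 (by simp)) ?_, tendsto_nhds_unique (ha 1 (by simp)) ?_⟩
  · simp [normPrefixMap]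
  · simp [h.normPrefixMap_one]

lemma IsExpDeriv.normPrefixMap_sub (h : IsExpDeriv g v lam) (j : ℕ → Fin d) (p n : ℕ) (x : ℝ) :
    normPrefixMap g (shiftSeq j p) n (prefixMap g j p x) -
      normPrefixMap g (shiftSeq j p) n (prefixMap g j p 0) =
      normPrefixMap g j (p + n) x *
        (prefixLen g j (p + n) / prefixLen g (shiftSeq j p) n) := by
  have h1 := (h.prefixLen_pos j (p + n)).ne'
  rw [normPrefixMap, normPrefixMap, normPrefixMap, ← prefixMap_add, ← prefixMap_add]
  field_simp
  ring

/-- The limit maps of `j` and of its shift differ by an affine rescaling. -/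
lemma IsLimitMap.sub_eq (h : IsExpDeriv g v lam) {j : ℕ → Fin d} {p : ℕ} {a : ℝ → ℝ}
    (ha : IsLimitMap g (shiftSeq j p) a) {x y : ℝ} (hx : x ∈ I01)
    (hy : Tendsto (fun n => normPrefixMap g j n x) atTop (nhds y)) :
    a (prefixMap g j p x) =
      a (prefixMap g j p 0) + (a (prefixMap g j p 1) - a (prefixMap g j p 0)) * y := by
  have hmem : ∀ {z}, z ∈ I01 → prefixMap g j p z ∈ I01 := fun hz => h.mapsTo j p hz
  have h0 := ha _ (hmem (z := 0) (by simp))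
  have h1 := (ha _ (hmem (z := 1) (by simp))).sub h0
  have h2 := (ha _ (hmem hx)).sub h0
  simp only [h.normPrefixMap_sub, h.normPrefixMap_one, one_mul] at h1 h2
  have hy' : Tendsto (fun n => normPrefixMap g j (p + n) x) (hyperfilter ℕ) (nhds y) :=
    (hy.comp (tendsto_add_atTop_nat p)).mono_left Nat.hyperfilter_le_atTop |>.congr fun n => by
      simp [add_comm]
  have := tendsto_nhds_unique h2 (hy'.mul h1)
  linarith

lemma shiftSeq_cons (j : ℕ → Fin d) (t : ℕ) :
    shiftSeq j t = consSeq (j t) (shiftSeq j (t + 1)) := by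
  ext m
  cases m with
  | zero => rfl
  | succ m => simp [shiftSeq, consSeq]; congr 2; ring

lemma scalingData_eq_prefixLen_div (j : ℕ → Fin d) (i : Fin d) (n : ℕ)
    (hi : (i : ℕ) < 2 * d - 1) : scalingData g (dword j n) ⟨i, hi⟩ =
      prefixLen g (consSeq i j) (n + 1) / prefixLen g j n := by
  rw [scalingData_child, normPrefixMap, normPrefixMap]
  simp only [prefixLen, prefixMap_consSeq]
  ring

lemma scalingFunction_child_mem_I01 (h : IsExpDeriv g v lam) (hS : HasScalingFunction g S)
    (j : ℕ → Fin d) (i : Fin d) (hi : (i : ℕ) < 2 * d - 1) :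
    S j ⟨i, hi⟩ ∈ I01 := by
  refine isClosed_Icc.mem_of_tendsto ((tendsto_pi_nhds.1 (hS j)) ⟨i, hi⟩) (.of_forall fun n => ?_)
  have h0 := h.normPrefixMap_mem j n (h.maps i (show (0:ℝ) ∈ I01 by simp))
  have h1 := h.normPrefixMap_mem j n (h.maps i (show (1:ℝ) ∈ I01 by simp))
  refine ⟨?_, ?_⟩
  · rw [scalingData_eq_prefixLen_div]
    exact div_nonneg (h.prefixLen_pos _ _).le (h.prefixLen_pos _ _).le
  · rw [scalingData_child]; linarith [h0.1, h1.2]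

lemma IsLimitMap.sub_eq_prod (h : IsExpDeriv g v lam) (hS : HasScalingFunction g S)
    {j : ℕ → Fin d} {p : ℕ} {a : ℝ → ℝ} (ha : IsLimitMap g (shiftSeq j p) a) :
    a (prefixMap g j p 1) - a (prefixMap g j p 0) = ∏ t ∈ Finset.range p,
      S (shiftSeq j (t + 1)) ⟨j t, by have := (j t).isLt; omega⟩ := by
  have hmem : ∀ {z}, z ∈ I01 → prefixMap g j p z ∈ I01 := fun hz => h.mapsTo j p hz
  have h1 := (ha _ (hmem (z := 1) (by simp))).sub (ha _ (hmem (z := 0) (by simp)))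
  simp only [h.normPrefixMap_sub, h.normPrefixMap_one, one_mul] at h1
  refine tendsto_nhds_unique h1 ?_
  have hfac : ∀ t ∈ Finset.range p, Tendsto
      (fun n => prefixLen g (shiftSeq j t) (p - t + n) /
        prefixLen g (shiftSeq j (t + 1)) (p - (t + 1) + n)) (hyperfilter ℕ)
      (nhds (S (shiftSeq j (t + 1)) ⟨j t, by have := (j t).isLt; omega⟩)) := by
    intro t ht
    have ht := Finset.mem_range.1 ht
    have h2 := ((tendsto_pi_nhds.1 (hS (shiftSeq j (t + 1))))
      ⟨j t, by have := (j t).isLt; omega⟩).comp (tendsto_add_atTop_nat (p - (t + 1)))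
    refine (h2.mono_left Nat.hyperfilter_le_atTop).congr fun n => ?_
    simp only [Function.comp]
    rw [scalingData_eq_prefixLen_div, ← shiftSeq_cons, add_comm n,
      show p - (t + 1) + n + 1 = p - t + n by omega]
  refine (tendsto_finsetProd _ hfac).congr fun n => ?_
  have hne : ∀ t, prefixLen g (shiftSeq j t) (p - t + n) ≠ 0 := fun t =>
    (h.prefixLen_pos _ _).ne'
  have htel : ∀ q, ∏ t ∈ Finset.range q, (prefixLen g (shiftSeq j t) (p - t + n) /
      prefixLen g (shiftSeq j (t + 1)) (p - (t + 1) + n)) =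
      prefixLen g (shiftSeq j 0) (p - 0 + n) / prefixLen g (shiftSeq j q) (p - q + n) := by
    intro q
    induction q with
    | zero => rw [Finset.prod_range_zero, div_self (hne 0)]
    | succ q ih => rw [Finset.prod_range_succ, ih, div_mul_div_cancel₀ (hne q)]
  rw [htel p, Nat.sub_self, zero_add, Nat.sub_zero]
  congr 2
  ext m
  simp [shiftSeq]

lemma le_rhoS (h : IsExpDeriv g v lam) (hS : HasScalingFunction g S) (j : ℕ → Fin d) (p : ℕ) :
    ∏ t ∈ Finset.range p, S (shiftSeq j (t + 1)) ⟨j t, by have := (j t).isLt; omega⟩ ≤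
      rhoS S j p := by
  have hbdd : BddAbove (range fun w : ℕ → Fin d => ∏ t ∈ Finset.range p,
      S (fun m => if t + 1 + m < p then j (t + 1 + m) else w (t + 1 + m - p))
        ⟨((j t) : ℕ), by have := (j t).isLt; omega⟩) := by
    refine ⟨1, ?_⟩
    rintro _ ⟨w, rfl⟩
    exact Finset.prod_le_one
      (fun t _ => (scalingFunction_child_mem_I01 h hS _ (j t) _).1)
      (fun t _ => (scalingFunction_child_mem_I01 h hS _ (j t) _).2)
  refine le_trans (le_of_eq ?_) (le_ciSup hbdd (shiftSeq j p))
  refine Finset.prod_congr rfl fun t _ => ?_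
  congr 2
  ext m
  simp only [shiftSeq]
  split_ifs with hlt
  · rfl
  · rw [Nat.add_sub_cancel' (not_lt.1 hlt)]

lemma renorm_mem_DkVar (h : IsExpDeriv g v lam) (hS : HasScalingFunction g S)
    (hg0 : ∀ i : Fin d, (i : ℕ) = 0 → g i 0 = 0) {ε : ℝ} (hε : ε ∈ Set.Ioc (0:ℝ) 1) {r : ℕ}
    {K c C₀ c₀ : ℝ} (hc : 0 < c) (hc₀ : 0 < c₀) {j j' : ℕ → Fin d} {p : ℕ}
    (hjj : ∀ t < p, j t = j' t) {a b θ : ℝ → ℝ} (ha : IsLimitMap g (shiftSeq j p) a)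
    (hb : IsLimitMap g (shiftSeq j' p) b) (had : IsBoundedDiffeo ε (r + 1) C₀ c₀ a)
    (hθ : HolderBd ε (r + 1) K θ)
    (hslope : ∀ x ∈ I01, ∀ y ∈ I01, x ≤ y → c * (y - x) ≤ θ y - θ x)
    (hθa : ∀ x ∈ I01, θ (a x) = b x) :
    renorm (a (prefixMap g j p 0)) (a (prefixMap g j p 1)) (b (prefixMap g j p 0))
      (b (prefixMap g j p 1)) θ ∈
      DkVar (r + 1) ((K / c + 1) * rhoS S j p ^ (((r + 1 : ℕ) : ℝ) + ε - 1))
        (Apts (S j)) (Apts (S j')) := by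
  have h0 : (0:ℝ) ∈ I01 := by simp
  have h1 : (1:ℝ) ∈ I01 := by simp
  have hw := h.mapsTo j p
  have hmem := (had.bijOn hε hc₀).mapsTo
  have hab : a (prefixMap g j p 0) < a (prefixMap g j p 1) :=
    strictMonoOn_of_slope hc₀ had.slope (hw h0) (hw h1) (h.prefixMap_lt j p h0 h1 zero_lt_one)
  have hρ : a (prefixMap g j p 1) - a (prefixMap g j p 0) ≤ rhoS S j p := by
    rw [ha.sub_eq_prod h hS]; exact le_rhoS h hS j p
  have hpj := prefixMap_congr g hjj
  have hpt : ∀ x ∈ I01, ∀ y y', Tendsto (fun n => normPrefixMap g j n x) atTop (nhds y) →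
      Tendsto (fun n => normPrefixMap g j' n x) atTop (nhds y') →
      renorm (a (prefixMap g j p 0)) (a (prefixMap g j p 1)) (b (prefixMap g j p 0))
        (b (prefixMap g j p 1)) θ y = y' := by
    intro x hx y y' hy hy'
    have hlt := strictMonoOn_of_slope hc hslope (hmem (hw h0)) (hmem (hw h1)) hab
    rw [hθa _ (hw h0), hθa _ (hw h1)] at hlt
    rw [renorm, ← ha.sub_eq h hx hy, hθa _ (hw hx), hpj, hb.sub_eq h hx hy', ← hpj]
    have := (sub_pos.2 hlt).ne'
    field_simp
    ring
  rw [← hθa _ (hw h0), ← hθa _ (hw h1)] at hpt ⊢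
  refine ⟨⟨isDiffeo01_renorm hε hθ hc hslope (hmem (hw h0)) (hmem (hw h1)) hab, ?_⟩,
    fun x hx y hy => (variation_renorm_le hε hθ hc hslope (hmem (hw h0)) (hmem (hw h1)) hab
      x hx y hy).trans_lt ?_⟩
  · have hL : ∀ i, _ = _ := fun i => hpt _ (h.maps i h0) _ _ (hS.tendsto_childLeft hg0 j i)
      (hS.tendsto_childLeft hg0 j' i)
    have hR : ∀ i, _ = _ := fun i => hpt _ (h.maps i h1) _ _ (hS.tendsto_childRight hg0 j i)
      (hS.tendsto_childRight hg0 j' i)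
    simp only [Apts, image_iUnion, image_pair, hL, hR]
  · have hρ0 : 0 < rhoS S j p := (sub_pos.2 hab).trans_le hρ
    have hK := hθ.nonneg
    have he : 0 ≤ ((r + 1 : ℕ) : ℝ) + ε - 1 := by
      push_cast
      have := hε.1
      have : (0:ℝ) ≤ r := r.cast_nonneg
      linarith
    have hpow := Real.rpow_le_rpow (sub_pos.2 hab).le hρ he
    have hpos := Real.rpow_pos_of_pos hρ0 (((r + 1 : ℕ) : ℝ) + ε - 1)
    have := mul_le_mul_of_nonneg_left hpow (div_nonneg hK hc.le)
    linarith

end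

end CantorSystem

/-- Main Theorem, necessity: for a `C^{k+ε}` Cantor system (`k < 2d`) with
scaling function `S` there is `C > 0` such that for all `j ≠ j'` (with `p = #(j∩j')`) and
every `j₀`, some `ψ ∈ D^k_var(C ρ_S(j,j')^{k+ε-1})(A(j),A(j'))` has
`R_{j₀} ψ ∈ D^k_var(C ρ_S(j₀j,j₀j')^{k+ε-1})(A(j₀j),A(j₀j'))`. -/
theorem stmt14 (d k : ℕ) (hd : 2 ≤ d) (hk : 1 ≤ k) (hkd : k < 2*d)
    (ε : ℝ) (hε : ε ∈ Set.Ioc (0:ℝ) 1)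
    (g : Fin d → ℝ → ℝ) (hg : IsCantorSystem k ε g)
    (S : (ℕ → Fin d) → Fin (2*d-1) → ℝ) (hS : HasScalingFunction g S) :
    ∃ C > 0, ∀ j j' : ℕ → Fin d, ∀ p : ℕ,
      (∀ t < p, j t = j' t) → j p ≠ j' p →
      ∀ j₀ : Fin d, ∃ ψ : ℝ → ℝ,
        ψ ∈ DkVar k (C * rhoS S j p ^ ((k : ℝ) + ε - 1)) (Apts (S j)) (Apts (S j')) ∧
        Rmap (S j) (S j') j₀ ψ ∈
          DkVar k (C * rhoS S (consSeq j₀ j) (p + 1) ^ ((k : ℝ) + ε - 1))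
            (Apts (S (consSeq j₀ j))) (Apts (S (consSeq j₀ j'))) := by
  have : NeZero d := ⟨by omega⟩
  obtain ⟨r, rfl⟩ : ∃ r, k = r + 1 := ⟨k - 1, by omega⟩
  obtain ⟨v, lam, K, h, hv⟩ := hg.exists_isExpDeriv hε
  obtain ⟨C, c, hc, hn⟩ := h.exists_holderBd_normPrefixMap hε hv
  obtain ⟨C', c', hc', hθ⟩ := exists_transition hε r C hc
  refine ⟨max C' 0 / c' + 1, by positivity, fun j j' p hjj _ j₀ => ?_⟩
  obtain ⟨a, ha⟩ := h.exists_isLimitMap (shiftSeq j p)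
  obtain ⟨b, hb⟩ := h.exists_isLimitMap (shiftSeq j' p)
  have had := ha.isBoundedDiffeo h hε (hn (shiftSeq j p))
  have hbd := hb.isBoundedDiffeo h hε (hn (shiftSeq j' p))
  obtain ⟨θ, hθb, hslope, hθa⟩ := hθ a b had hbd
  have hθb := hθb.mono (le_max_left C' 0)
  have hpj := prefixMap_congr g hjj
  refine ⟨_, renorm_mem_DkVar h hS hg.first hε hc' hc hjj ha hb had hθb hslope hθa, ?_⟩
  have hshift : ∀ i : ℕ → Fin d, shiftSeq (consSeq j₀ i) (p + 1) = shiftSeq i p := fun i => by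
    ext m
    have : p + 1 + m - 1 = p + m := by omega
    simp [shiftSeq, consSeq, this]
  have hmem := renorm_mem_DkVar (j := consSeq j₀ j) (j' := consSeq j₀ j') (p := p + 1)
    h hS hg.first hε hc' hc (fun t ht => by
      cases t with
      | zero => rfl
      | succ t => exact hjj t (by omega)) (by rwa [hshift]) (by rwa [hshift]) had hθb hslope hθa
  convert hmem using 1
  have h0 : (0:ℝ) ∈ I01 := by simp
  have h1 : (1:ℝ) ∈ I01 := by simp
  have hL := hS.tendsto_childLeft hg.first
  have hR := hS.tendsto_childRight hg.first
  have hlt : b (prefixMap g j p 0) < b (prefixMap g j p 1) :=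
    strictMonoOn_of_slope hc hbd.slope (h.mapsTo j p h0) (h.mapsTo j p h1)
      (h.prefixMap_lt j p h0 h1 zero_lt_one)
  have hne := (sub_pos.2 hlt).ne'
  ext x
  simp only [Rmap, renorm, prefixMap_consSeq]
  rw [ha.sub_eq h (h.maps j₀ h0) (hL j j₀), ha.sub_eq h (h.maps j₀ h1) (hR j j₀), hpj,
    hb.sub_eq h (h.maps j₀ h0) (hL j' j₀), hb.sub_eq h (h.maps j₀ h1) (hR j' j₀), ← hpj]
  generalize a (prefixMap g j p 0) = α at *
  generalize a (prefixMap g j p 1) = β at *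
  generalize b (prefixMap g j p 0) = α' at *
  generalize b (prefixMap g j p 1) = β' at *
  have harg : α + (β - α) * (childLeft (S j) j₀ + (childRight (S j) j₀ - childLeft (S j) j₀) * x) =
      α + (β - α) * childLeft (S j) j₀ + (α + (β - α) * childRight (S j) j₀ -
        (α + (β - α) * childLeft (S j) j₀)) * x := by ring
  rw [harg, div_sub' hne, div_div]
  congr 1 <;> ring
end
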